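/- Fix δ with 1/2 < δ < 1 and set ε = 2δ − 1. There exist constants C > 0 and x₀ such that for every real x ≥ x₀ with x^ε > q and log x > 2·log m/(1−ε), the function Z_x has a zero s with Re(s) > 1 and |s − (1 + 2(S₂ + 2·log m)/((−2δ² + 1 + ε²)·(log x)²))| ≤ C/(log x)³. -/

import Mathlib

section Tauberian

open MeasureTheory Filter Topology FourierTransform

/-- The Gaussian average of an integrable function, expressed through its Fourier transform. -/
lemma integral_mul_gaussian_eq {φ : ℝ → ℂ} (hφ : Integrable φ) {R : ℝ} (hR : 0 < R) (u₀ : ℝ) :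
    ∫ u, φ u * ((R * Real.exp (-(Real.pi * R ^ 2) * (u - u₀) ^ 2) : ℝ) : ℂ) =
      ∫ ξ : ℝ, 𝓕 φ ξ * Complex.exp (-Real.pi * ((R ^ 2)⁻¹ : ℝ) * ξ ^ 2
        + 2 * Real.pi * (-Complex.I * u₀ * (-1)) * ξ) := by
  have hb : 0 < (((R ^ 2)⁻¹ : ℝ) : ℂ).re := by
    rw [Complex.ofReal_re]; positivity
  have hk : Integrable (fun ξ : ℝ => Complex.exp (-Real.pi * ((R ^ 2)⁻¹ : ℝ) * ξ ^ 2
        + 2 * Real.pi * (-Complex.I * u₀ * (-1)) * ξ)) := by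
    have hneg : (-Real.pi * ((R ^ 2)⁻¹ : ℝ) : ℂ).re < 0 := by
      rw [neg_mul, Complex.neg_re, Complex.re_ofReal_mul]
      exact neg_lt_zero.mpr (mul_pos Real.pi_pos hb)
    simpa using integrable_cexp_quadratic' hneg (2 * Real.pi * (-Complex.I * u₀ * (-1))) 0
  have h := VectorFourier.integral_fourierIntegral_smul_eq_flip (L := innerₗ ℝ)
      Real.continuous_fourierChar continuous_inner hφ hk
  simp only [smul_eq_mul] at h
  refine Eq.trans ?_ h.symm
  refine integral_congr_ae (Eventually.of_forall fun u => ?_)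
  have hg := congrFun (fourier_gaussian_pi' hb (-Complex.I * u₀ * (-1))) u
  have hfl : (innerₗ ℝ).flip = innerₗ ℝ := by ext; simp
  rw [hfl]
  have hg' : VectorFourier.fourierIntegral Real.fourierChar volume (innerₗ ℝ)
      (fun ξ : ℝ => Complex.exp (-Real.pi * ((R ^ 2)⁻¹ : ℝ) * ξ ^ 2
        + 2 * Real.pi * (-Complex.I * u₀ * (-1)) * ξ)) u =
      1 / (((R ^ 2)⁻¹ : ℝ) : ℂ) ^ (1 / 2 : ℂ) * Complex.exp (-Real.pi / (((R ^ 2)⁻¹ : ℝ) : ℂ) *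
        (u + Complex.I * (-Complex.I * u₀ * (-1))) ^ 2) := hg
  simp only
  rw [hg']
  congr 1
  have h1 : (((R ^ 2)⁻¹ : ℝ) : ℂ) ^ (1 / 2 : ℂ) = ((R⁻¹ : ℝ) : ℂ) := by
    rw [show (1 / 2 : ℂ) = ((1 / 2 : ℝ) : ℂ) by push_cast; rfl,
      ← Complex.ofReal_cpow (by positivity), ← Real.sqrt_eq_rpow, ← inv_pow,
      Real.sqrt_sq (by positivity)]
  have h2 : Complex.I * (-Complex.I * u₀ * (-1)) = -u₀ := by
    linear_combination u₀ * Complex.I_mul_I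
  rw [h1, h2]
  push_cast
  have hRc : (R : ℂ) ≠ 0 := by exact_mod_cast hR.ne'
  congr 1
  · field_simp
  · congr 1
    field_simp
    ring

lemma gaussian_first_moment {R : ℝ} (hR : 0 < R) (u₀ : ℝ) :
    ∫ u : ℝ, |u - u₀| * (R * Real.exp (-(Real.pi * R ^ 2) * (u - u₀) ^ 2)) ≤ 1 / R := by
  have hpi := Real.pi_gt_three
  rw [integral_sub_right_eq_self (fun u : ℝ => |u| * (R * Real.exp (-(Real.pi * R ^ 2) * u ^ 2))) u₀]
  have : (fun u : ℝ => |u| * (R * Real.exp (-(Real.pi * R ^ 2) * u ^ 2))) =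
      fun u => (fun v : ℝ => R * (v ^ (1 : ℝ) * Real.exp (-(Real.pi * R ^ 2) * v ^ (2 : ℝ)))) |u| := by
    ext u
    simp only [Real.rpow_one, Real.rpow_two, sq_abs]
    ring
  rw [this, integral_comp_abs
      (f := fun v : ℝ => R * (v ^ (1 : ℝ) * Real.exp (-(Real.pi * R ^ 2) * v ^ (2 : ℝ)))),
    integral_const_mul,
    integral_rpow_mul_exp_neg_mul_rpow (by norm_num) (by norm_num) (by positivity)]
  norm_num
  rw [Real.rpow_neg_one]
  field_simp
  linarith

lemma gaussian_mass {R : ℝ} (hR : 0 < R) (u₀ : ℝ) :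
    ∫ u : ℝ, R * Real.exp (-(Real.pi * R ^ 2) * (u - u₀) ^ 2) = 1 := by
  rw [integral_sub_right_eq_self (fun u : ℝ => R * Real.exp (-(Real.pi * R ^ 2) * u ^ 2)) u₀,
    integral_const_mul, integral_gaussian]
  rw [show Real.pi / (Real.pi * R ^ 2) = (R⁻¹) ^ 2 by field_simp,
    Real.sqrt_sq (by positivity)]
  field_simp

lemma gaussian_integrable {R : ℝ} (hR : 0 < R) (u₀ : ℝ) :
    Integrable fun u : ℝ => R * Real.exp (-(Real.pi * R ^ 2) * (u - u₀) ^ 2) :=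
  ((integrable_exp_neg_mul_sq (b := Real.pi * R ^ 2) (by positivity)).const_mul R).comp_sub_right u₀

lemma gaussian_moment_integrable {R : ℝ} (hR : 0 < R) (u₀ : ℝ) :
    Integrable fun u : ℝ => |u - u₀| * (R * Real.exp (-(Real.pi * R ^ 2) * (u - u₀) ^ 2)) := by
  have h := (integrable_mul_exp_neg_mul_sq (b := Real.pi * R ^ 2) (by positivity)).norm.const_mul R
  refine (h.comp_sub_right u₀).congr (Eventually.of_forall fun u => ?_)
  simp only [norm_mul, Real.norm_eq_abs, Real.abs_exp]
  ring

lemma exists_integral_rpow_gaussian_le : ∃ c : ℝ, 0 < c ∧ ∀ R : ℝ, 0 < R →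
    Integrable (fun ξ : ℝ => |ξ| ^ (-(1 / 2) : ℝ) * Real.exp (-(Real.pi * (R ^ 2)⁻¹) * ξ ^ 2)) ∧
    ∫ ξ : ℝ, |ξ| ^ (-(1 / 2) : ℝ) * Real.exp (-(Real.pi * (R ^ 2)⁻¹) * ξ ^ 2) ≤ c * √R := by
  refine ⟨2 * (Real.pi ^ (-(-(1 / 2) + 1) / 2 : ℝ) * (1 / 2) * Real.Gamma ((-(1 / 2) + 1) / 2)),
    ?_, fun R hR => ⟨?_, ?_⟩⟩
  · have : 0 < Real.Gamma ((-(1 / 2) + 1) / 2) := Real.Gamma_pos_of_pos (by norm_num)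
    positivity
  · have h := integrableOn_rpow_mul_exp_neg_mul_rpow (p := 2) (s := -(1 / 2))
      (b := Real.pi * (R ^ 2)⁻¹) (by norm_num) (by norm_num) (by positivity)
    rw [← integrable_indicator_iff measurableSet_Ioi] at h
    refine (h.add h.comp_neg).congr (Eventually.of_forall fun ξ => ?_)
    rcases lt_trichotomy ξ 0 with hξ | rfl | hξ
    · simp [Set.indicator, hξ, hξ.le, abs_of_neg hξ]
    · simp
    · simp [Set.indicator, hξ, hξ.le, abs_of_pos hξ]
  · have : (fun ξ : ℝ => |ξ| ^ (-(1 / 2) : ℝ) * Real.exp (-(Real.pi * (R ^ 2)⁻¹) * ξ ^ 2)) =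
      fun u => (fun v : ℝ => v ^ (-(1 / 2) : ℝ) *
        Real.exp (-(Real.pi * (R ^ 2)⁻¹) * v ^ (2 : ℝ))) |u| := by
      ext u
      simp only [Real.rpow_two, sq_abs]
    rw [this, integral_comp_abs (f := fun v : ℝ => v ^ (-(1 / 2) : ℝ) *
        Real.exp (-(Real.pi * (R ^ 2)⁻¹) * v ^ (2 : ℝ))),
      integral_rpow_mul_exp_neg_mul_rpow (by norm_num) (by norm_num) (by positivity),
      Real.mul_rpow (by positivity) (by positivity)]
    apply le_of_eq
    have : ((R ^ 2)⁻¹ : ℝ) ^ (-(-(1 / 2) + 1) / 2 : ℝ) = √R := by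
      rw [Real.inv_rpow (by positivity), ← Real.rpow_natCast, ← Real.rpow_mul hR.le,
        ← Real.rpow_neg hR.le, Real.sqrt_eq_rpow]
      norm_num
    rw [this]
    ring

end Tauberian

section TauberianMain

open MeasureTheory Filter Topology FourierTransform

lemma norm_le_of_increment_bound {D : ℝ → ℂ} {C : ℝ} (hC : 0 ≤ C)
    (hinc : ∀ u u', 0 ≤ u → u ≤ u' → ‖D u' - D u‖ ≤ C * (1 + u') * (u' - u + Real.exp (-u)))
    (h0 : ‖D 0‖ ≤ C) {u : ℝ} (hu : 0 ≤ u) : ‖D u‖ ≤ 2 * C * (1 + u) ^ 2 := by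
  have h := hinc 0 u le_rfl hu
  have h1 : ‖D u‖ ≤ ‖D u - D 0‖ + ‖D 0‖ := by
    simpa using norm_add_le (D u - D 0) (D 0)
  simp only [neg_zero, Real.exp_zero, sub_zero] at h
  nlinarith [mul_nonneg hC hu, mul_nonneg hC (sq_nonneg u)]

lemma abs_exp_neg_sub_exp_neg_le {a b : ℝ} (ha : 0 ≤ a) (hb : 0 ≤ b) :
    |Real.exp (-a) - Real.exp (-b)| ≤ |a - b| := by
  wlog hab : a ≤ b generalizing a b
  · rw [abs_sub_comm, abs_sub_comm a]
    exact this hb ha (le_of_not_ge hab)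
  rw [abs_of_nonneg (sub_nonneg.2 (Real.exp_le_exp.2 (neg_le_neg hab))),
    abs_of_nonpos (sub_nonpos.2 hab)]
  have h1 : Real.exp (-b) = Real.exp (-a) * Real.exp (-(b - a)) := by
    rw [← Real.exp_add]; ring_nf
  have h2 : 1 - (b - a) ≤ Real.exp (-(b - a)) := by
    have := Real.add_one_le_exp (-(b - a)); linarith
  have h3 : Real.exp (-a) ≤ 1 := Real.exp_le_one_iff.2 (neg_nonpos.2 ha)
  have h4 := Real.exp_pos (-a)
  rw [h1]
  nlinarith

lemma one_add_pow_four_mul_exp_neg_le {y : ℝ} (hy : 0 ≤ y) :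
    (1 + y) ^ 4 * Real.exp (-y) ≤ 256 := by
  have h1 : 1 + y ≤ 4 * Real.exp (y / 4) := by
    have := Real.add_one_le_exp (y / 4); linarith
  have h2 : (1 + y) ^ 4 ≤ (4 * Real.exp (y / 4)) ^ 4 := by gcongr
  have h3 : (4 * Real.exp (y / 4)) ^ 4 = 256 * Real.exp y := by
    rw [mul_pow, ← Real.exp_nat_mul]; norm_num
    ring_nf
  rw [Real.exp_neg, ← div_eq_mul_inv, div_le_iff₀ (Real.exp_pos y)]
  linarith

lemma weighted_increment_bound {D : ℝ → ℂ} {C : ℝ} (hC : 0 ≤ C)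
    (hneg : ∀ u < 0, D u = 0)
    (hinc : ∀ u u', 0 ≤ u → u ≤ u' → ‖D u' - D u‖ ≤ C * (1 + u') * (u' - u + Real.exp (-u)))
    (h0 : ‖D 0‖ ≤ C) {u₀ : ℝ} (hu₀ : 1 ≤ u₀) (u : ℝ) :
    ‖(u ^ 2 * Real.exp (-(1 / u₀) * u)) • D u - (u₀ ^ 2 * Real.exp (-(1 / u₀) * u₀)) • D u₀‖ ≤
      2000 * C * u₀ ^ 3 * (|u - u₀| + Real.exp (-(u₀ / 2))) := by
  have hu₀' : 0 < u₀ := by linarith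
  have he0 := Real.exp_pos (-(u₀ / 2))
  have hw1 : Real.exp (-(1 / u₀) * u₀) ≤ 1 := by
    rw [Real.exp_le_one_iff]; have : 0 < 1 / u₀ := by positivity
    nlinarith
  have hD0 : ‖D u₀‖ ≤ 8 * C * u₀ ^ 2 := by
    have := norm_le_of_increment_bound hC hinc h0 hu₀'.le
    nlinarith [mul_nonneg hC hu₀'.le, mul_nonneg hC (by nlinarith : 0 ≤ u₀ ^ 2 - 1),
      mul_nonneg hC (by nlinarith : 0 ≤ u₀ ^ 2 - u₀)]
  have hH0 : ‖(u₀ ^ 2 * Real.exp (-(1 / u₀) * u₀)) • D u₀‖ ≤ 8 * C * u₀ ^ 4 := by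
    rw [norm_smul, Real.norm_of_nonneg (by positivity)]
    calc _ ≤ (u₀ ^ 2 * 1) * (8 * C * u₀ ^ 2) := by gcongr
      _ = _ := by ring
  have habs : 0 ≤ |u - u₀| := abs_nonneg _
  have hCu : 0 ≤ C * u₀ ^ 3 := by positivity
  rcases lt_or_ge u 0 with hu | hu
  · rw [hneg u hu, smul_zero, zero_sub, norm_neg]
    have h1 : u₀ ≤ |u - u₀| := by rw [abs_of_neg (by linarith)]; linarith
    calc _ ≤ 8 * C * u₀ ^ 4 := hH0
      _ = 8 * (C * u₀ ^ 3) * u₀ := by ring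
      _ ≤ 2000 * (C * u₀ ^ 3) * (|u - u₀| + Real.exp (-(u₀ / 2))) := by
        gcongr
        · norm_num
        · linarith
      _ = _ := by ring
  · have hDu := norm_le_of_increment_bound hC hinc h0 hu
    rcases le_or_gt (u₀ / 2) |u - u₀| with hfar | hnear
    · have hH : ‖(u ^ 2 * Real.exp (-(1 / u₀) * u)) • D u‖ ≤ 512 * C * u₀ ^ 4 := by
        rw [norm_smul, Real.norm_of_nonneg (by positivity)]
        set y := u / u₀ with hy
        have hy0 : 0 ≤ y := by positivity
        have huy : u = y * u₀ := by rw [hy]; field_simp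
        have hexp : -(1 / u₀) * u = -y := by rw [hy]; ring
        have h4 := one_add_pow_four_mul_exp_neg_le hy0
        rw [hexp]
        have h5 : (1 + u) ^ 2 ≤ u₀ ^ 2 * (1 + y) ^ 2 := by
          rw [← mul_pow]
          gcongr
          rw [huy]; nlinarith
        have h6 : u ^ 2 ≤ u₀ ^ 2 * (1 + y) ^ 2 := by
          rw [← mul_pow]
          gcongr
          rw [huy]; nlinarith
        calc _ ≤ (u₀ ^ 2 * (1 + y) ^ 2 * Real.exp (-y)) * (2 * C * (u₀ ^ 2 * (1 + y) ^ 2)) := by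
              gcongr
              exact hDu.trans (by gcongr)
          _ = 2 * C * u₀ ^ 4 * ((1 + y) ^ 4 * Real.exp (-y)) := by ring
          _ ≤ 2 * C * u₀ ^ 4 * 256 := by gcongr
          _ = _ := by ring
      calc _ ≤ 512 * C * u₀ ^ 4 + 8 * C * u₀ ^ 4 := (norm_sub_le _ _).trans (add_le_add hH hH0)
        _ = 1040 * (C * u₀ ^ 3) * (u₀ / 2) := by ring
        _ ≤ 2000 * (C * u₀ ^ 3) * (|u - u₀| + Real.exp (-(u₀ / 2))) := by
          gcongr
          · norm_num
          · linarith
        _ = _ := by ring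
    · have hlo : u₀ / 2 ≤ u := by have := (abs_lt.1 hnear).1; linarith
      have hhi : u ≤ 3 / 2 * u₀ := by have := (abs_lt.1 hnear).2; linarith
      have hdD : ‖D u - D u₀‖ ≤ C * (5 / 2 * u₀) * (|u - u₀| + Real.exp (-(u₀ / 2))) := by
        rcases le_total u u₀ with h | h
        · rw [norm_sub_rev]
          refine (hinc u u₀ hu h).trans ?_
          rw [abs_of_nonpos (by linarith)]
          gcongr
          · linarith
          · linarith
          
        · refine (hinc u₀ u hu₀'.le h).trans ?_
          rw [abs_of_nonneg (by linarith)]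
          gcongr
          · linarith
          · linarith
      have hwu : Real.exp (-(1 / u₀) * u) ≤ 1 := by
        rw [Real.exp_le_one_iff]; have : 0 < 1 / u₀ := by positivity
        nlinarith
      have hdw : |u ^ 2 * Real.exp (-(1 / u₀) * u) - u₀ ^ 2 * Real.exp (-(1 / u₀) * u₀)| ≤
          7 / 2 * u₀ * |u - u₀| := by
        have e1 := abs_exp_neg_sub_exp_neg_le (a := 1 / u₀ * u) (b := 1 / u₀ * u₀)
          (by positivity) (by positivity)
        rw [← mul_sub, abs_mul, abs_of_pos (by positivity : 0 < 1 / u₀), ← neg_mul, ← neg_mul] at e1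
        have e2 : |u ^ 2 - u₀ ^ 2| ≤ 5 / 2 * u₀ * |u - u₀| := by
          rw [show u ^ 2 - u₀ ^ 2 = (u + u₀) * (u - u₀) by ring, abs_mul,
            abs_of_nonneg (by linarith)]
          gcongr
          linarith
        calc _ = |(u ^ 2 - u₀ ^ 2) * Real.exp (-(1 / u₀) * u) + u₀ ^ 2 *
              (Real.exp (-(1 / u₀) * u) - Real.exp (-(1 / u₀) * u₀))| := by ring_nf
          _ ≤ |u ^ 2 - u₀ ^ 2| * Real.exp (-(1 / u₀) * u) + u₀ ^ 2 *
              |Real.exp (-(1 / u₀) * u) - Real.exp (-(1 / u₀) * u₀)| := by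
            refine (abs_add_le _ _).trans ?_
            rw [abs_mul, abs_mul, abs_of_pos (Real.exp_pos _), abs_of_nonneg (sq_nonneg u₀)]
          _ ≤ 5 / 2 * u₀ * |u - u₀| * 1 + u₀ ^ 2 * (1 / u₀ * |u - u₀|) := by gcongr
          _ = _ := by field_simp; ring
      calc _ = ‖(u ^ 2 * Real.exp (-(1 / u₀) * u)) • (D u - D u₀) +
            (u ^ 2 * Real.exp (-(1 / u₀) * u) - u₀ ^ 2 * Real.exp (-(1 / u₀) * u₀)) • D u₀‖ := by
            congr 1; module
        _ ≤ ‖(u ^ 2 * Real.exp (-(1 / u₀) * u)) • (D u - D u₀)‖ +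
            ‖(u ^ 2 * Real.exp (-(1 / u₀) * u) - u₀ ^ 2 * Real.exp (-(1 / u₀) * u₀)) • D u₀‖ :=
            norm_add_le _ _
        _ ≤ ((3 / 2 * u₀) ^ 2 * 1) * (C * (5 / 2 * u₀) * (|u - u₀| + Real.exp (-(u₀ / 2)))) +
            (7 / 2 * u₀ * |u - u₀|) * (8 * C * u₀ ^ 2) := by
            rw [norm_smul, norm_smul, Real.norm_of_nonneg (by positivity), Real.norm_eq_abs]
            gcongr
        _ ≤ _ := by nlinarith [mul_nonneg hCu habs, mul_nonneg hCu he0.le]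

/-- A quantitative Tauberian theorem: a slowly varying function whose Laplace transform has a
second derivative of size `O(|ξ| ^ (-1/2))` along vertical lines decays like `1 / u`. -/
theorem exists_norm_le_div_of_fourier_bound {D : ℝ → ℂ} {B C : ℝ} (hC : 0 ≤ C) (hB : 0 ≤ B)
    (hneg : ∀ u < 0, D u = 0)
    (hinc : ∀ u u', 0 ≤ u → u ≤ u' → ‖D u' - D u‖ ≤ C * (1 + u') * (u' - u + Real.exp (-u)))
    (h0 : ‖D 0‖ ≤ C)
    (hint : ∀ σ : ℝ, 0 < σ → Integrable fun u : ℝ => (u ^ 2 * Real.exp (-σ * u)) • D u)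
    (hF : ∀ σ : ℝ, 0 < σ → σ ≤ 1 → ∀ ξ : ℝ, ξ ≠ 0 →
      ‖𝓕 (fun u : ℝ => (u ^ 2 * Real.exp (-σ * u)) • D u) ξ‖ ≤ B * |ξ| ^ (-(1 / 2) : ℝ)) :
    ∃ C' : ℝ, 0 < C' ∧ ∀ u : ℝ, 1 ≤ u → ‖D u‖ ≤ C' / u := by
  obtain ⟨c, hc, hcR⟩ := exists_integral_rpow_gaussian_le
  refine ⟨Real.exp 1 * (18000 * C + B * c) + 1, by positivity, fun u₀ hu₀ => ?_⟩
  have hu₀' : 0 < u₀ := by linarith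
  set H : ℝ → ℂ := fun u => (u ^ 2 * Real.exp (-(1 / u₀) * u)) • D u with hH
  have hHint : Integrable H := hint (1 / u₀) (by positivity)
  set R : ℝ := u₀ ^ 2 with hRdef
  have hR : 0 < R := by positivity
  set K : ℝ → ℝ := fun u => R * Real.exp (-(Real.pi * R ^ 2) * (u - u₀) ^ 2) with hK
  have hKint : Integrable K := gaussian_integrable hR u₀
  have hK0 : ∀ u, 0 ≤ K u := fun u => by positivity
  have hKle : ∀ u, K u ≤ R := fun u => by
    have : Real.exp (-(Real.pi * R ^ 2) * (u - u₀) ^ 2) ≤ 1 := by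
      rw [Real.exp_le_one_iff, neg_mul]
      have : 0 ≤ Real.pi * R ^ 2 * (u - u₀) ^ 2 := by positivity
      linarith
    calc K u ≤ R * 1 := by simp only [hK]; gcongr
      _ = R := mul_one R
  have hKcont : Continuous K := by simp only [hK]; fun_prop
  have hHK : Integrable fun u => H u * (K u : ℂ) := by
    refine hHint.mul_bdd (c := R) (Complex.continuous_ofReal.comp hKcont).aestronglyMeasurable
      (Eventually.of_forall fun u => ?_)
    simpa [abs_of_nonneg (hK0 u)] using hKle u
  have hfour : ‖∫ u, H u * (K u : ℂ)‖ ≤ B * c * u₀ := by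
    rw [integral_mul_gaussian_eq hHint hR u₀]
    obtain ⟨hi, hle⟩ := hcR R hR
    have hle' : ∫ ξ : ℝ, B * (|ξ| ^ (-(1 / 2) : ℝ) *
        Real.exp (-(Real.pi * (R ^ 2)⁻¹) * ξ ^ 2)) ≤ B * c * u₀ := by
      rw [integral_const_mul, mul_assoc]
      have : √R = u₀ := by rw [hRdef, Real.sqrt_sq hu₀'.le]
      rw [this] at hle
      gcongr
    refine (norm_integral_le_of_norm_le (hi.const_mul B) ?_).trans hle'
    filter_upwards [compl_mem_ae_iff.2 (measure_singleton (0 : ℝ))] with ξ hξ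
    rw [norm_mul, Complex.norm_exp, ← mul_assoc B]
    refine mul_le_mul
      (hF (1 / u₀) (by positivity) (by rw [div_le_one hu₀']; exact hu₀) ξ hξ)
      (le_of_eq ?_) (Real.exp_pos _).le (by positivity)
    have : (-(Real.pi : ℂ) * (((R ^ 2)⁻¹ : ℝ) : ℂ) * (ξ : ℂ) ^ 2 +
        2 * Real.pi * (-Complex.I * u₀ * (-1)) * ξ) =
        ((-(Real.pi * (R ^ 2)⁻¹) * ξ ^ 2 : ℝ) : ℂ) + ((2 * Real.pi * u₀ * ξ : ℝ) : ℂ) * Complex.I := by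
      push_cast; ring
    rw [this, Complex.add_re, Complex.re_ofReal_mul, Complex.I_re, Complex.ofReal_re, mul_zero,
      add_zero]
  have hdiff : ‖H u₀ - ∫ u, H u * (K u : ℂ)‖ ≤
      2000 * C * u₀ ^ 3 * (1 / R + Real.exp (-(u₀ / 2))) := by
    have h1 : H u₀ = ∫ u, H u₀ * (K u : ℂ) := by
      rw [integral_const_mul, integral_complex_ofReal, gaussian_mass hR u₀]; simp
    have hi' : Integrable fun u => H u₀ * (K u : ℂ) := hKint.ofReal.const_mul _
    rw [h1, ← integral_sub hi' hHK]
    have hi := ((gaussian_moment_integrable hR u₀).add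
      (hKint.const_mul (Real.exp (-(u₀ / 2))))).const_mul (2000 * C * u₀ ^ 3)
    refine (norm_integral_le_of_norm_le hi (Eventually.of_forall fun u => ?_)).trans ?_
    · rw [← sub_mul, norm_mul, Complex.norm_real, Real.norm_of_nonneg (hK0 u), norm_sub_rev]
      refine (mul_le_mul_of_nonneg_right (weighted_increment_bound hC hneg hinc h0 hu₀ u)
        (hK0 u)).trans (le_of_eq ?_)
      simp only [Pi.add_apply, hK]; ring
    · simp only [Pi.add_apply]
      rw [integral_const_mul, integral_add (gaussian_moment_integrable hR u₀)
        (hKint.const_mul _), integral_const_mul, gaussian_mass hR u₀, mul_one]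
      gcongr
      exact gaussian_first_moment hR u₀
  have hexp : u₀ ^ 2 * Real.exp (-(u₀ / 2)) ≤ 8 := by
    rw [Real.exp_neg, ← div_eq_mul_inv, div_le_iff₀ (Real.exp_pos _)]
    have := Real.quadratic_le_exp_of_nonneg (x := u₀ / 2) (by positivity)
    nlinarith
  have hH0 : ‖H u₀‖ = u₀ ^ 2 * Real.exp (-1) * ‖D u₀‖ := by
    simp only [hH]
    rw [norm_smul, Real.norm_of_nonneg (by positivity)]
    congr 3
    field_simp
  have hfin : u₀ ^ 2 * Real.exp (-1) * ‖D u₀‖ ≤ (18000 * C + B * c) * u₀ := by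
    rw [← hH0]
    calc ‖H u₀‖ ≤ ‖H u₀ - ∫ u, H u * (K u : ℂ)‖ + ‖∫ u, H u * (K u : ℂ)‖ := by
          simpa using norm_add_le (H u₀ - ∫ u, H u * (K u : ℂ)) (∫ u, H u * (K u : ℂ))
      _ ≤ 2000 * C * u₀ ^ 3 * (1 / R + Real.exp (-(u₀ / 2))) + B * c * u₀ := add_le_add hdiff hfour
      _ = 2000 * C * u₀ * (1 + u₀ ^ 2 * Real.exp (-(u₀ / 2))) + B * c * u₀ := by
          rw [hRdef]; field_simp
      _ ≤ 2000 * C * u₀ * (1 + 8) + B * c * u₀ := by gcongr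
      _ = _ := by ring
  rw [Real.exp_neg] at hfin
  rw [le_div_iff₀ hu₀']
  have he := Real.exp_pos 1
  have : u₀ * (‖D u₀‖ * u₀) ≤ u₀ * (Real.exp 1 * (18000 * C + B * c)) := by
    have := mul_le_mul_of_nonneg_left hfin he.le
    field_simp at this ⊢
    nlinarith
  have := le_of_mul_le_mul_left this hu₀'
  linarith

end TauberianMain

section PolynomialGrowth

open MeasureTheory Filter Topology Set Asymptotics

/-- The error in approximating the partial sums of `f` beyond `N` by a linear function. -/
noncomputable def tailRemainder (f : ℕ → ℂ) (ρ : ℂ) (N : ℕ) (t : ℝ) : ℂ :=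
  if (N : ℝ) < t then ∑ k ∈ Finset.Ioc N ⌊t⌋₊, f k - ρ * ((t - N : ℝ) : ℂ) else 0

lemma measurable_tailRemainder (f : ℕ → ℂ) (ρ : ℂ) (N : ℕ) :
    Measurable (tailRemainder f ρ N) := by
  unfold tailRemainder
  refine Measurable.ite measurableSet_Ioi (Measurable.sub ?_ (by fun_prop)) measurable_const
  exact (measurable_from_nat (f := fun M => ∑ k ∈ Finset.Ioc N M, f k)).comp Nat.measurable_floor

lemma norm_tailRemainder_le {f : ℕ → ℂ} {ρ : ℂ} {K : ℝ}
    (hK : ∀ n : ℕ, ‖∑ k ∈ Finset.Icc 1 n, f k - ρ * n‖ ≤ K) (N : ℕ) (t : ℝ) :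
    ‖tailRemainder f ρ N t‖ ≤ 2 * K + ‖ρ‖ := by
  have hK0 : 0 ≤ K := (norm_nonneg _).trans (hK 0)
  unfold tailRemainder
  split_ifs with h
  · have ht : 0 ≤ t := (Nat.cast_nonneg N).trans h.le
    have hM : N ≤ ⌊t⌋₊ := Nat.le_floor h.le
    have h1 : ∑ k ∈ Finset.Icc 1 ⌊t⌋₊, f k =
        ∑ k ∈ Finset.Icc 1 N, f k + ∑ k ∈ Finset.Ioc N ⌊t⌋₊, f k := by
      rw [← Finset.sum_union]
      · congr 1
        ext k; simp only [Finset.mem_Icc, Finset.mem_union, Finset.mem_Ioc]; omega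
      · rw [Finset.disjoint_left]; intro k; simp only [Finset.mem_Icc, Finset.mem_Ioc]; omega
    have h2 : ∑ k ∈ Finset.Ioc N ⌊t⌋₊, f k - ρ * ((t - N : ℝ) : ℂ) =
        (∑ k ∈ Finset.Icc 1 ⌊t⌋₊, f k - ρ * ⌊t⌋₊) - (∑ k ∈ Finset.Icc 1 N, f k - ρ * N) -
          ρ * ((t - ⌊t⌋₊ : ℝ) : ℂ) := by
      rw [h1]; push_cast; ring
    rw [h2]
    have h3 : ‖ρ * ((t - ⌊t⌋₊ : ℝ) : ℂ)‖ ≤ ‖ρ‖ := by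
      rw [norm_mul, Complex.norm_real, Real.norm_eq_abs]
      have ha := Nat.floor_le ht
      have hb := Nat.lt_floor_add_one t
      rw [abs_of_nonneg (by linarith)]
      exact mul_le_of_le_one_right (norm_nonneg _) (by linarith)
    refine (norm_sub_le _ _).trans ?_
    have := norm_sub_le (∑ k ∈ Finset.Icc 1 ⌊t⌋₊, f k - ρ * ⌊t⌋₊) (∑ k ∈ Finset.Icc 1 N, f k - ρ * N)
    linarith [hK N, hK ⌊t⌋₊]
  · simp only [norm_zero]; positivity

lemma locallyIntegrable_of_bounded {g : ℝ → ℂ} (hg : Measurable g) {B : ℝ}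
    (hB : ∀ t, ‖g t‖ ≤ B) : LocallyIntegrable g := by
  refine (locallyIntegrable_const B).mono hg.aestronglyMeasurable (Eventually.of_forall fun t => ?_)
  exact (hB t).trans (le_abs_self B)

lemma tailRemainder_isBigO_zero {f : ℕ → ℂ} {ρ : ℂ} {N : ℕ} (hN : 1 ≤ N) (b : ℝ) :
    tailRemainder f ρ N =O[𝓝[>] 0] fun t : ℝ => t ^ (-b) := by
  have : tailRemainder f ρ N =ᶠ[𝓝[>] 0] fun _ => 0 := by
    have : Iio (1 : ℝ) ∈ 𝓝[>] (0 : ℝ) := mem_nhdsWithin_of_mem_nhds (Iio_mem_nhds one_pos)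
    filter_upwards [this] with t ht
    have hN' : (1 : ℝ) ≤ N := by exact_mod_cast hN
    exact if_neg (by simp only [mem_Iio] at ht; linarith)
  exact this.trans_isBigO (isBigO_zero _ _)

lemma tailRemainder_isBigO_atTop {f : ℕ → ℂ} {ρ : ℂ} {K : ℝ}
    (hK : ∀ n : ℕ, ‖∑ k ∈ Finset.Icc 1 n, f k - ρ * n‖ ≤ K) (N : ℕ) :
    tailRemainder f ρ N =O[atTop] fun t : ℝ => t ^ (-(0 : ℝ)) := by
  simp only [neg_zero, Real.rpow_zero]
  exact isBigO_of_le' (c := 2 * K + ‖ρ‖) _ fun t => by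
    simpa using norm_tailRemainder_le hK N t

lemma differentiableAt_mellin_tailRemainder {f : ℕ → ℂ} {ρ : ℂ} {K : ℝ}
    (hK : ∀ n : ℕ, ‖∑ k ∈ Finset.Icc 1 n, f k - ρ * n‖ ≤ K) {N : ℕ} (hN : 1 ≤ N) {s : ℂ}
    (hs : s.re < 0) : DifferentiableAt ℂ (mellin (tailRemainder f ρ N)) s :=
  mellin_differentiableAt_of_isBigO_rpow
    ((locallyIntegrable_of_bounded (measurable_tailRemainder f ρ N)
      (norm_tailRemainder_le hK N)).locallyIntegrableOn _)
    (tailRemainder_isBigO_atTop hK N) hs (tailRemainder_isBigO_zero hN (s.re - 1)) (by linarith)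

lemma mellin_tailRemainder_eq (f : ℕ → ℂ) (ρ : ℂ) (N : ℕ) (s : ℂ) :
    mellin (tailRemainder f ρ N) (-s) =
      ∫ t in Ioi (N : ℝ), (t : ℂ) ^ (-(s + 1)) * tailRemainder f ρ N t := by
  rw [mellin]
  have : (-s - 1) = -(s + 1) := by ring
  simp_rw [this, smul_eq_mul]
  refine (setIntegral_eq_of_subset_of_forall_sdiff_eq_zero measurableSet_Ioi
    (Ioi_subset_Ioi (Nat.cast_nonneg N)) fun t ht => ?_)
  rw [tailRemainder, if_neg (by simpa using ht.2), mul_zero]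

lemma norm_mellin_tailRemainder_le {f : ℕ → ℂ} {ρ : ℂ} {K : ℝ}
    (hK : ∀ n : ℕ, ‖∑ k ∈ Finset.Icc 1 n, f k - ρ * n‖ ≤ K) {N : ℕ} (hN : 1 ≤ N) {s : ℂ}
    (hs : 0 < s.re) :
    ‖mellin (tailRemainder f ρ N) (-s)‖ ≤ (2 * K + ‖ρ‖) * ((N : ℝ) ^ (-s.re) / s.re) := by
  have hN' : (0 : ℝ) < N := by exact_mod_cast hN
  rw [mellin_tailRemainder_eq]
  have hi : IntegrableOn (fun t : ℝ => (2 * K + ‖ρ‖) * t ^ (-(s.re + 1))) (Ioi (N : ℝ)) :=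
    (integrableOn_Ioi_rpow_of_lt (by linarith) hN').const_mul _
  refine (norm_integral_le_of_norm_le hi ?_).trans (le_of_eq ?_)
  · filter_upwards [ae_restrict_mem measurableSet_Ioi] with t ht
    have ht' : 0 < t := hN'.trans ht
    rw [norm_mul, Complex.norm_cpow_eq_rpow_re_of_pos ht', mul_comm]
    simp only [Complex.neg_re, Complex.add_re, Complex.one_re]
    exact mul_le_mul_of_nonneg_right (norm_tailRemainder_le hK N t) (Real.rpow_nonneg ht'.le _)
  · rw [integral_const_mul, integral_Ioi_rpow_of_lt (by linarith) hN']
    congr 1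
    rw [show -(s.re + 1) + 1 = -s.re by ring]
    rw [neg_div_neg_eq]

lemma LSeries_eq_sum_add_mellin {f : ℕ → ℂ} {ρ : ℂ} {K : ℝ} (hf : ∀ n, ‖f n‖ ≤ 1)
    (hK : ∀ n : ℕ, ‖∑ k ∈ Finset.Icc 1 n, f k - ρ * n‖ ≤ K) {N : ℕ} (hN : 1 ≤ N) {s : ℂ}
    (hs : 1 < s.re) :
    LSeries f s = ∑ n ∈ Finset.Icc 1 N, f n * (n : ℂ) ^ (-s) + ρ * (N : ℂ) ^ (1 - s) / (s - 1) +
      s * mellin (tailRemainder f ρ N) (-s) := by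
  have hN' : (0 : ℝ) < N := by exact_mod_cast hN
  have hs0 : s ≠ 0 := by rintro rfl; simp at hs; linarith
  have hs1 : s - 1 ≠ 0 := by intro h; rw [sub_eq_zero.1 h] at hs; simp at hs
  set fN : ℕ → ℂ := fun n => if N < n then f n else 0 with hfN
  have hfNle : ∀ n, ‖fN n‖ ≤ 1 := fun n => by
    simp only [hfN]; split_ifs; exacts [hf n, by simp]
  have hsum : LSeriesSummable f s := LSeriesSummable_of_bounded_of_one_lt_re (fun n _ => hf n) hs
  have hsumN : LSeriesSummable fN s :=
    LSeriesSummable_of_bounded_of_one_lt_re (fun n _ => hfNle n) hs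
  have h1 : LSeries f s = ∑ n ∈ Finset.Icc 1 N, f n * (n : ℂ) ^ (-s) + LSeries fN s := by
    rw [← sub_eq_iff_eq_add, ← LSeries_sub hsum hsumN, LSeries]
    rw [tsum_eq_sum (s := Finset.Icc 1 N)]
    · refine Finset.sum_congr rfl fun n hn => ?_
      rw [Finset.mem_Icc] at hn
      rw [LSeries.term_of_ne_zero (by omega)]
      simp only [Pi.sub_apply, hfN]
      rw [if_neg (by omega), sub_zero, Complex.cpow_neg, div_eq_mul_inv]
    · intro n hn
      rcases Nat.eq_zero_or_pos n with rfl | h0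
      · simp
      · rw [LSeries.term_of_ne_zero h0.ne']
        simp only [Finset.mem_Icc, not_and, not_le] at hn
        simp [hfN, hn h0]
  have hpart : ∀ M : ℕ, ∑ k ∈ Finset.Icc 1 M, fN k = ∑ k ∈ Finset.Ioc N M, f k := fun M => by
    simp only [hfN]
    rw [← Finset.sum_filter]
    congr 1
    ext k; simp only [Finset.mem_filter, Finset.mem_Icc, Finset.mem_Ioc]; omega
  have hO : (fun n ↦ ∑ k ∈ Finset.Icc 1 n, fN k) =O[atTop] fun n : ℕ ↦ (n : ℝ) ^ (1 : ℝ) := by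
    refine isBigO_of_le _ fun n => ?_
    refine (norm_sum_le_of_le _ fun k _ => hfNle k).trans ?_
    simp
  have hiE : IntegrableOn (fun t : ℝ => (t : ℂ) ^ (-(s + 1)) * tailRemainder f ρ N t)
      (Ioi (N : ℝ)) := by
    have hi : IntegrableOn (fun t : ℝ => (t : ℂ) ^ (-(s + 1))) (Ioi (N : ℝ)) :=
      integrableOn_Ioi_cpow_of_lt (by simp; linarith) hN'
    exact hi.mul_bdd (c := 2 * K + ‖ρ‖) (measurable_tailRemainder f ρ N).aestronglyMeasurable
      (Eventually.of_forall fun t => norm_tailRemainder_le hK N t)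
  have hi1 : IntegrableOn (fun t : ℝ => (t : ℂ) ^ (-s)) (Ioi (N : ℝ)) :=
    integrableOn_Ioi_cpow_of_lt (by simp; linarith) hN'
  have hi2 : IntegrableOn (fun t : ℝ => (t : ℂ) ^ (-(s + 1))) (Ioi (N : ℝ)) :=
    integrableOn_Ioi_cpow_of_lt (by simp; linarith) hN'
  rw [h1, LSeries_eq_mul_integral fN zero_le_one hs hsumN hO, mellin_tailRemainder_eq]
  simp_rw [hpart]
  have h2 : ∫ t in Ioi (1 : ℝ), (∑ k ∈ Finset.Ioc N ⌊t⌋₊, f k) * (t : ℂ) ^ (-(s + 1)) =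
      ∫ t in Ioi (N : ℝ), ((t : ℂ) ^ (-(s + 1)) * tailRemainder f ρ N t +
        (ρ * (t : ℂ) ^ (-s) - (ρ * N) * (t : ℂ) ^ (-(s + 1)))) := by
    rw [setIntegral_eq_of_subset_of_forall_sdiff_eq_zero (s := Ioi (N : ℝ)) measurableSet_Ioi
      (Ioi_subset_Ioi (by exact_mod_cast hN))]
    · refine setIntegral_congr_fun measurableSet_Ioi fun t ht => ?_
      have ht0 : (t : ℂ) ≠ 0 := by exact_mod_cast (hN'.trans ht).ne'
      simp only [tailRemainder]
      rw [if_pos (show (N : ℝ) < t from ht)]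
      have : (t : ℂ) ^ (-s) = t * (t : ℂ) ^ (-(s + 1)) := by
        rw [show -s = 1 + -(s + 1) by ring, Complex.cpow_add _ _ ht0, Complex.cpow_one]
      rw [this]
      push_cast; ring
    · intro t ht
      have : ⌊t⌋₊ ≤ N := Nat.floor_le_of_le (by simpa using ht.2)
      rw [Finset.Ioc_eq_empty (by omega)]; simp
  have hi3 : IntegrableOn (fun t : ℝ => ρ * (t : ℂ) ^ (-s)) (Ioi (N : ℝ)) := hi1.const_mul ρ
  have hi4 : IntegrableOn (fun t : ℝ => ρ * N * (t : ℂ) ^ (-(s + 1))) (Ioi (N : ℝ)) :=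
    hi2.const_mul _
  have hi5 : IntegrableOn (fun t : ℝ => ρ * (t : ℂ) ^ (-s) - ρ * N * (t : ℂ) ^ (-(s + 1)))
    (Ioi (N : ℝ)) := hi3.sub hi4
  rw [h2, integral_add hiE hi5, integral_sub hi3 hi4, integral_const_mul, integral_const_mul,
    integral_Ioi_cpow_of_lt (by simp; linarith) hN', integral_Ioi_cpow_of_lt (by simp; linarith) hN']
  have hNc : ((N : ℝ) : ℂ) ≠ 0 := by exact_mod_cast hN'.ne'
  have e1 : (((N : ℝ) : ℂ)) ^ (-s + 1) = (N : ℂ) ^ (1 - s) := by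
    rw [Complex.ofReal_natCast]; congr 1; ring
  have e2 : (N : ℂ) * (((N : ℝ) : ℂ)) ^ (-(s + 1) + 1) = (N : ℂ) ^ (1 - s) := by
    rw [← e1, show -s + 1 = 1 + (-(s + 1) + 1) by ring, Complex.cpow_add 1 _ hNc, Complex.cpow_one,
      Complex.ofReal_natCast]
  rw [mul_assoc ρ, mul_div_assoc' (N : ℂ), mul_neg, e2, e1, show -s + 1 = -(s - 1) by ring,
    show -(s + 1) + 1 = -s by ring, mul_add]
  field_simp
  ring

end PolynomialGrowth

section PolynomialGrowthBound

open MeasureTheory Filter Topology Set Asymptotics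

lemma continuation_eq_sum_add_mellin {f : ℕ → ℂ} {ρ : ℂ} {K : ℝ} (hf : ∀ n, ‖f n‖ ≤ 1)
    (hK : ∀ n : ℕ, ‖∑ k ∈ Finset.Icc 1 n, f k - ρ * n‖ ≤ K) {Q : ℂ → ℂ} (hQ : Differentiable ℂ Q)
    (hQL : ∀ s : ℂ, 1 < s.re → Q s = (s - 1) * LSeries f s) {N : ℕ} (hN : 1 ≤ N) {s : ℂ}
    (hs : 0 < s.re) :
    Q s = (s - 1) * ∑ n ∈ Finset.Icc 1 N, f n * (n : ℂ) ^ (-s) + ρ * (N : ℂ) ^ (1 - s) +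
      (s - 1) * (s * mellin (tailRemainder f ρ N) (-s)) := by
  set U : Set ℂ := {z | 0 < z.re} with hU
  have hUo : IsOpen U := isOpen_lt continuous_const Complex.continuous_re
  have hd : DifferentiableOn ℂ (fun s : ℂ => (s - 1) * ∑ n ∈ Finset.Icc 1 N, f n * (n : ℂ) ^ (-s) +
      ρ * (N : ℂ) ^ (1 - s) + (s - 1) * (s * mellin (tailRemainder f ρ N) (-s))) U := by
    intro z hz
    have hm : DifferentiableAt ℂ (fun s : ℂ => mellin (tailRemainder f ρ N) (-s)) z := by
      have : DifferentiableAt ℂ (mellin (tailRemainder f ρ N)) (-z) :=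
        differentiableAt_mellin_tailRemainder hK hN (by simpa [hU] using hz)
      exact this.comp z differentiableAt_id.neg
    have hc : ∀ n : ℕ, 1 ≤ n → ∀ g : ℂ → ℂ, DifferentiableAt ℂ g z →
        DifferentiableAt ℂ (fun s : ℂ => (n : ℂ) ^ (g s)) z := fun n hn g hg =>
      hg.const_cpow (Or.inl (by exact_mod_cast (by omega : n ≠ 0)))
    have hsm : DifferentiableAt ℂ (fun s : ℂ => ∑ n ∈ Finset.Icc 1 N, f n * (n : ℂ) ^ (-s)) z :=
      DifferentiableAt.fun_sum fun n hn =>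
        (hc n (Finset.mem_Icc.1 hn).1 _ differentiableAt_id.neg).const_mul _
    have hl : DifferentiableAt ℂ (fun s : ℂ => s - 1) z := by fun_prop
    exact (((hl.mul hsm).add ((hc N hN _ (by fun_prop)).const_mul ρ)).add
      (hl.mul (differentiableAt_id.mul hm))).differentiableWithinAt
  have hmem : (2 : ℂ) ∈ U := by simp [hU]
  refine (hQ.differentiableOn.analyticOnNhd hUo).eqOn_of_preconnected_of_eventuallyEq
    (hd.analyticOnNhd hUo) (convex_halfSpace_re_gt 0).isPreconnected hmem ?_ hs
  have : {z : ℂ | 1 < z.re} ∈ 𝓝 (2 : ℂ) :=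
    (isOpen_lt continuous_const Complex.continuous_re).mem_nhds (by simp)
  filter_upwards [this] with z hz
  have hz1 : z - 1 ≠ 0 := by
    intro h; rw [sub_eq_zero.1 h] at hz; simp at hz
  rw [hQL z hz, LSeries_eq_sum_add_mellin hf hK hN hz]
  field_simp

lemma norm_sum_cpow_neg_le {f : ℕ → ℂ} (hf : ∀ n, ‖f n‖ ≤ 1) {N : ℕ} (hN : 1 ≤ N) {s : ℂ}
    (hs : 1 - 1 / 60 ≤ s.re) :
    ‖∑ n ∈ Finset.Icc 1 N, f n * (n : ℂ) ^ (-s)‖ ≤ 61 * (N : ℝ) ^ (1 / 30 : ℝ) := by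
  have hN' : (1 : ℝ) ≤ N := by exact_mod_cast hN
  have hN0 : (0 : ℝ) < N := by linarith
  have h1 : ∀ n ∈ Finset.Icc 1 N, ‖f n * (n : ℂ) ^ (-s)‖ ≤ (N : ℝ) ^ (1 / 60 : ℝ) * (n : ℝ)⁻¹ := by
    intro n hn
    obtain ⟨ha, hb⟩ := Finset.mem_Icc.1 hn
    have ha' : (1 : ℝ) ≤ n := by exact_mod_cast ha
    have hb' : (n : ℝ) ≤ N := by exact_mod_cast hb
    rw [norm_mul, Complex.norm_natCast_cpow_of_pos ha]
    calc ‖f n‖ * (n : ℝ) ^ (-s).re ≤ 1 * (n : ℝ) ^ (1 / 60 + (-1) : ℝ) := by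
          gcongr
          · exact hf n
          · rw [Complex.neg_re]; linarith
      _ = (n : ℝ) ^ (1 / 60 : ℝ) * (n : ℝ)⁻¹ := by
          rw [one_mul, Real.rpow_add (by linarith), Real.rpow_neg_one]
      _ ≤ _ := by gcongr
  have h2 : ∑ n ∈ Finset.Icc 1 N, (n : ℝ)⁻¹ ≤ 1 + Real.log N := by
    have := harmonic_le_one_add_log N
    rwa [harmonic_eq_sum_Icc, Rat.cast_sum, Finset.sum_congr rfl (g := fun n : ℕ => (n : ℝ)⁻¹)
      (fun n _ => by simp)] at this
  have h3 : Real.log N ≤ (N : ℝ) ^ (1 / 60 : ℝ) / (1 / 60) :=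
    Real.log_le_rpow_div hN0.le (by norm_num)
  have h4 : (1 : ℝ) ≤ (N : ℝ) ^ (1 / 60 : ℝ) := Real.one_le_rpow hN' (by norm_num)
  have h5 : (N : ℝ) ^ (1 / 60 : ℝ) * (N : ℝ) ^ (1 / 60 : ℝ) = (N : ℝ) ^ (1 / 30 : ℝ) := by
    rw [← Real.rpow_add hN0]; norm_num
  calc _ ≤ ∑ n ∈ Finset.Icc 1 N, (N : ℝ) ^ (1 / 60 : ℝ) * (n : ℝ)⁻¹ := norm_sum_le_of_le _ h1
    _ = (N : ℝ) ^ (1 / 60 : ℝ) * ∑ n ∈ Finset.Icc 1 N, (n : ℝ)⁻¹ := by rw [Finset.mul_sum]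
    _ ≤ (N : ℝ) ^ (1 / 60 : ℝ) * (61 * (N : ℝ) ^ (1 / 60 : ℝ)) := by
        gcongr; linarith
    _ = _ := by rw [← h5]; ring

lemma norm_continuation_le {f : ℕ → ℂ} {ρ : ℂ} {K : ℝ} (hf : ∀ n, ‖f n‖ ≤ 1)
    (hK : ∀ n : ℕ, ‖∑ k ∈ Finset.Icc 1 n, f k - ρ * n‖ ≤ K) {Q : ℂ → ℂ} (hQ : Differentiable ℂ Q)
    (hQL : ∀ s : ℂ, 1 < s.re → Q s = (s - 1) * LSeries f s) {s : ℂ}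
    (hs : 1 - 1 / 60 ≤ s.re) (hs3 : s.re ≤ 3) (him : 1 ≤ |s.im|) :
    ‖Q s‖ ≤ 2 * (61 + ‖ρ‖ + 8 * (2 * K + ‖ρ‖)) * |s.im| ^ (1 / 30 : ℝ) * ‖s - 1‖ := by
  have hK0 : 0 ≤ K := (norm_nonneg _).trans (hK 0)
  set N : ℕ := ⌈|s.im|⌉₊ with hNdef
  have hN : 1 ≤ N := Nat.one_le_ceil_iff.2 (by linarith)
  have hN' : (1 : ℝ) ≤ N := by exact_mod_cast hN
  have hN0 : (0 : ℝ) < N := by linarith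
  have htN : |s.im| ≤ N := Nat.le_ceil _
  have hNt : (N : ℝ) ≤ 2 * |s.im| := by
    have := Nat.ceil_lt_add_one (abs_nonneg s.im)
    linarith
  have hs1 : 1 ≤ ‖s - 1‖ := by
    refine him.trans ?_
    simpa using Complex.abs_im_le_norm (s - 1)
  have hsN : ‖s‖ ≤ 4 * N := by
    have := Complex.norm_le_abs_re_add_abs_im s
    rw [abs_of_nonneg (show 0 ≤ s.re by linarith)] at this
    linarith
  have hNpow : (N : ℝ) ^ (1 / 30 : ℝ) ≤ 2 * |s.im| ^ (1 / 30 : ℝ) := by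
    calc (N : ℝ) ^ (1 / 30 : ℝ) ≤ (2 * |s.im|) ^ (1 / 30 : ℝ) := by gcongr
      _ = 2 ^ (1 / 30 : ℝ) * |s.im| ^ (1 / 30 : ℝ) := Real.mul_rpow (by norm_num) (abs_nonneg _)
      _ ≤ 2 ^ (1 : ℝ) * |s.im| ^ (1 / 30 : ℝ) := by
        gcongr
        · norm_num
        · norm_num
      _ = _ := by rw [Real.rpow_one]
  have hσ : (N : ℝ) ^ (1 - s.re) ≤ (N : ℝ) ^ (1 / 30 : ℝ) := by
    gcongr
    linarith
  have hA := norm_sum_cpow_neg_le hf hN hs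
  have hB : ‖ρ * (N : ℂ) ^ (1 - s)‖ ≤ ‖ρ‖ * (N : ℝ) ^ (1 / 30 : ℝ) := by
    rw [norm_mul, Complex.norm_natCast_cpow_of_pos hN]
    rw [Complex.sub_re, Complex.one_re]
    exact mul_le_mul_of_nonneg_left hσ (norm_nonneg _)
  have hC : ‖s * mellin (tailRemainder f ρ N) (-s)‖ ≤
      8 * (2 * K + ‖ρ‖) * (N : ℝ) ^ (1 / 30 : ℝ) := by
    rw [norm_mul]
    have h1 := norm_mellin_tailRemainder_le hK hN (s := s) (by linarith)
    calc ‖s‖ * ‖mellin (tailRemainder f ρ N) (-s)‖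
        ≤ (4 * N) * ((2 * K + ‖ρ‖) * ((N : ℝ) ^ (-s.re) / (1 / 2))) := by
          refine mul_le_mul hsN (h1.trans ?_) (norm_nonneg _) (by positivity)
          gcongr
          linarith
      _ = 8 * (2 * K + ‖ρ‖) * (N : ℝ) ^ (1 - s.re) := by
          rw [sub_eq_add_neg, Real.rpow_add hN0, Real.rpow_one]; ring
      _ ≤ _ := by gcongr
  rw [continuation_eq_sum_add_mellin hf hK hQ hQL hN (by linarith : 0 < s.re)]
  calc _ ≤ ‖s - 1‖ * (61 * (N : ℝ) ^ (1 / 30 : ℝ)) + ‖ρ‖ * (N : ℝ) ^ (1 / 30 : ℝ) * ‖s - 1‖ +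
        ‖s - 1‖ * (8 * (2 * K + ‖ρ‖) * (N : ℝ) ^ (1 / 30 : ℝ)) := by
        refine (norm_add₃_le).trans ?_
        rw [norm_mul (s - 1), norm_mul (s - 1)]
        gcongr
        exact hB.trans (le_mul_of_one_le_right (by positivity) hs1)
    _ = (61 + ‖ρ‖ + 8 * (2 * K + ‖ρ‖)) * (N : ℝ) ^ (1 / 30 : ℝ) * ‖s - 1‖ := by ring
    _ ≤ (61 + ‖ρ‖ + 8 * (2 * K + ‖ρ‖)) * (2 * |s.im| ^ (1 / 30 : ℝ)) * ‖s - 1‖ := by gcongr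
    _ = _ := by ring

lemma norm_sum_range_le_of_periodic {g : ℕ → ℂ} {N : ℕ} {B : ℝ} (hB : ∀ n, ‖g n‖ ≤ B)
    (hN : 0 < N) (hper : ∀ n, g (n + N) = g n) (hsum : ∑ n ∈ Finset.range N, g n = 0) (M : ℕ) :
    ‖∑ n ∈ Finset.range M, g n‖ ≤ N * B := by
  have hB0 : 0 ≤ B := (norm_nonneg _).trans (hB 0)
  induction M using Nat.strong_induction_on with
  | _ M ih =>
    rcases lt_or_ge M N with h | h
    · refine (norm_sum_le_of_le _ fun n _ => hB n).trans ?_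
      rw [Finset.sum_const, Finset.card_range, nsmul_eq_mul]
      gcongr
    · obtain ⟨k, rfl⟩ := Nat.exists_eq_add_of_le h
      rw [Finset.sum_range_add, hsum, zero_add]
      simp_rw [add_comm N, hper]
      exact ih k (by omega)

lemma exists_norm_sum_dirichletCharacter_sub_le {N : ℕ} [NeZero N] (ψ : DirichletCharacter ℂ N) :
    ∃ (ρ : ℂ) (K : ℝ), ∀ n : ℕ, ‖∑ k ∈ Finset.Icc 1 n, ψ (k : ZMod N) - ρ * n‖ ≤ K := by
  have hN : 0 < N := Nat.pos_of_ne_zero (NeZero.ne N)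
  have hNc : (N : ℂ) ≠ 0 := by exact_mod_cast hN.ne'
  set ρ : ℂ := (∑ n ∈ Finset.range N, ψ (n : ZMod N)) / N with hρ
  set g : ℕ → ℂ := fun n => ψ (n : ZMod N) - ρ with hg
  have hgB : ∀ n, ‖g n‖ ≤ 1 + ‖ρ‖ := fun n =>
    (norm_sub_le _ _).trans (by gcongr; exact ψ.norm_le_one _)
  have hper : ∀ n, g (n + N) = g n := fun n => by simp [hg]
  have hsum : ∑ n ∈ Finset.range N, g n = 0 := by
    simp only [hg, Finset.sum_sub_distrib, Finset.sum_const, Finset.card_range, nsmul_eq_mul, hρ]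
    field_simp
    simp
  refine ⟨ρ, N * (1 + ‖ρ‖) + (1 + ‖ρ‖), fun n => ?_⟩
  have h1 : ∑ k ∈ Finset.Icc 1 n, ψ (k : ZMod N) - ρ * n =
      ∑ k ∈ Finset.range (n + 1), g k - g 0 := by
    have : Finset.range (n + 1) = insert 0 (Finset.Icc 1 n) := by
      ext k; simp only [Finset.mem_range, Finset.mem_insert, Finset.mem_Icc]; omega
    rw [this, Finset.sum_insert (by simp)]
    simp only [hg, Finset.sum_sub_distrib, Finset.sum_const, Nat.card_Icc, nsmul_eq_mul]
    simp; ring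
  rw [h1]
  exact (norm_sub_le _ _).trans (add_le_add
    (norm_sum_range_le_of_periodic hgB hN hper hsum _) (hgB 0))

/-- Dirichlet `L`-functions grow slowly near the line `Re s = 1`. -/
lemma exists_norm_LFunction_le {N : ℕ} [NeZero N] (ψ : DirichletCharacter ℂ N) :
    ∃ C : ℝ, 0 < C ∧ ∀ s : ℂ, 1 - 1 / 60 ≤ s.re → s.re ≤ 3 → 1 ≤ |s.im| →
      ‖DirichletCharacter.LFunction ψ s‖ ≤ C * |s.im| ^ (1 / 30 : ℝ) := by
  obtain ⟨ρ, K, hK⟩ := exists_norm_sum_dirichletCharacter_sub_le ψ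
  have hK0 : 0 ≤ K := (norm_nonneg _).trans (hK 0)
  have hne : ∀ s : ℂ, 1 ≤ |s.im| → s ≠ 1 := by
    rintro s hs rfl; simp at hs; linarith
  obtain ⟨Q, hQ, hQL⟩ : ∃ Q : ℂ → ℂ, Differentiable ℂ Q ∧
      ∀ s, s ≠ 1 → Q s = (s - 1) * DirichletCharacter.LFunction ψ s := by
    by_cases h : ψ = 1
    · subst h
      exact ⟨_, DirichletCharacter.differentiable_LFunctionTrivChar₁ N,
        fun s hs => Function.update_of_ne hs ..⟩
    · exact ⟨fun s => (s - 1) * DirichletCharacter.LFunction ψ s,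
        (differentiable_id.sub_const 1).mul (DirichletCharacter.differentiable_LFunction h),
        fun s _ => rfl⟩
  refine ⟨2 * (61 + ‖ρ‖ + 8 * (2 * K + ‖ρ‖)), by positivity, fun s h1 h2 h3 => ?_⟩
  have := norm_continuation_le (f := fun n => ψ (n : ZMod N)) (fun n => ψ.norm_le_one _) hK hQ
    (fun s hs => by
      rw [hQL s (by rintro rfl; simp at hs), DirichletCharacter.LFunction_eq_LSeries ψ hs]) h1 h2 h3
  rw [hQL s (hne s h3), norm_mul, mul_comm] at this
  exact le_of_mul_le_mul_right this (norm_pos_iff.2 (sub_ne_zero.2 (hne s h3)))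

end PolynomialGrowthBound

section LFunctionLowerBound

open MeasureTheory Filter Topology Set DirichletCharacter

variable {N : ℕ} [NeZero N] (ψ : DirichletCharacter ℂ N)

lemma rpow_le_two_mul_rpow {u t : ℝ} (hu : 0 ≤ u) (ht : 0 ≤ t) (h : u ≤ 2 * t) :
    u ^ (1 / 30 : ℝ) ≤ 2 * t ^ (1 / 30 : ℝ) := by
  calc u ^ (1 / 30 : ℝ) ≤ (2 * t) ^ (1 / 30 : ℝ) := by gcongr
    _ = 2 ^ (1 / 30 : ℝ) * t ^ (1 / 30 : ℝ) := Real.mul_rpow (by norm_num) ht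
    _ ≤ 2 ^ (1 : ℝ) * t ^ (1 / 30 : ℝ) := by
      gcongr
      · norm_num
      · norm_num
    _ = _ := by rw [Real.rpow_one]

lemma abs_re_sub_le_and_abs_im_sub_le {w s : ℂ} {r : ℝ} (h : ‖w - s‖ ≤ r) :
    |w.re - s.re| ≤ r ∧ |w.im - s.im| ≤ r :=
  ⟨by simpa using (Complex.abs_re_le_norm (w - s)).trans h,
    by simpa using (Complex.abs_im_le_norm (w - s)).trans h⟩

lemma exists_norm_deriv_LFunction_le :
    ∃ C : ℝ, 0 < C ∧ ∀ s : ℂ, 1 - 1 / 120 ≤ s.re → s.re ≤ 5 / 2 → 2 ≤ |s.im| →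
      ‖deriv (LFunction ψ) s‖ ≤ C * |s.im| ^ (1 / 30 : ℝ) := by
  obtain ⟨C, hC, h⟩ := exists_norm_LFunction_le ψ
  refine ⟨C * 2 * 120, by positivity, fun s h1 h2 h3 => ?_⟩
  have hball : ∀ w ∈ Metric.closedBall s (1 / 120), 1 - 1 / 60 ≤ w.re ∧ w.re ≤ 3 ∧ 1 ≤ |w.im| ∧
      |w.im| ≤ 2 * |s.im| := by
    intro w hw
    rw [Metric.mem_closedBall, dist_eq_norm] at hw
    obtain ⟨ha, hb⟩ := abs_re_sub_le_and_abs_im_sub_le hw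
    have hc := abs_sub_abs_le_abs_sub s.im w.im
    have hd := abs_sub_abs_le_abs_sub w.im s.im
    rw [abs_sub_comm] at hc
    rw [abs_le] at ha
    exact ⟨by linarith, by linarith, by linarith, by linarith⟩
  have hd : DiffContOnCl ℂ (LFunction ψ) (Metric.ball s (1 / 120)) := by
    refine DifferentiableOn.diffContOnCl_ball (U := {1}ᶜ)
      (fun w hw => (differentiableAt_LFunction ψ w (Or.inl hw)).differentiableWithinAt) ?_
    rintro w hw rfl
    have := (hball _ hw).2.2.1
    simp at this
    linarith
  have := Complex.norm_deriv_le_of_forall_mem_sphere_norm_le (by norm_num) hd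
    (C := C * (2 * |s.im| ^ (1 / 30 : ℝ))) fun w hw => by
      obtain ⟨a1, a2, a3, a4⟩ := hball w (Metric.sphere_subset_closedBall hw)
      refine (h w a1 a2 a3).trans ?_
      gcongr
      exact rpow_le_two_mul_rpow (abs_nonneg _) (abs_nonneg _) a4
  refine this.trans (le_of_eq ?_)
  ring

lemma exists_norm_LFunctionTrivChar_le :
    ∃ C : ℝ, 0 < C ∧ ∀ x : ℝ, 0 < x → x ≤ 2 → ‖LFunctionTrivChar N (1 + x)‖ ≤ C / x := by
  have hc : ContinuousOn (fun x : ℝ => LFunctionTrivChar₁ N (1 + x)) (Icc 0 2) :=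
    ((differentiable_LFunctionTrivChar₁ N).continuous.comp (by fun_prop)).continuousOn
  obtain ⟨C, hC⟩ := isCompact_Icc.exists_bound_of_continuousOn hc
  have hC0 : 0 ≤ C := (norm_nonneg _).trans (hC 0 (by simp))
  refine ⟨C + 1, by linarith, fun x hx hx2 => ?_⟩
  have h := hC x ⟨hx.le, hx2⟩
  have hne : (1 + x : ℂ) ≠ 1 := by
    intro h'; apply hx.ne'; simpa using h'
  simp only [LFunctionTrivChar₁] at h
  rw [Function.update_of_ne hne, norm_mul, add_sub_cancel_left, Complex.norm_real,
    Real.norm_of_nonneg hx.le] at h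
  rw [le_div_iff₀ hx]
  linarith

/-- The classical `3-4-1` lower bound to the right of the line `Re s = 1`. -/
lemma exists_le_norm_LFunction_pow_four :
    ∃ M : ℝ, 0 < M ∧ ∀ x t : ℝ, 0 < x → x ≤ 3 / 2 → 1 ≤ |t| →
      x ^ 3 ≤ M * |t| ^ (1 / 30 : ℝ) * ‖LFunction ψ (1 + x + Complex.I * t)‖ ^ 4 := by
  obtain ⟨C₁, hC₁, h₁⟩ := exists_norm_LFunctionTrivChar_le (N := N)
  obtain ⟨C₂, hC₂, h₂⟩ := exists_norm_LFunction_le (ψ ^ 2)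
  refine ⟨C₁ ^ 3 * (C₂ * 2), by positivity, fun x t hx hx2 ht => ?_⟩
  have h := norm_LFunction_product_ge_one ψ hx t
  rw [norm_mul, norm_mul, norm_pow, norm_pow] at h
  have h1 := h₁ x hx (by linarith)
  have him : (1 + x + 2 * Complex.I * t : ℂ).im = 2 * t := by simp
  have hre : (1 + x + 2 * Complex.I * t : ℂ).re = 1 + x := by simp
  have h2 := h₂ (1 + x + 2 * Complex.I * t) (by rw [hre]; linarith) (by rw [hre]; linarith)
    (by rw [him, abs_mul]; norm_num; linarith)
  rw [him] at h2
  have h3 : |2 * t| ^ (1 / 30 : ℝ) ≤ 2 * |t| ^ (1 / 30 : ℝ) :=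
    rpow_le_two_mul_rpow (abs_nonneg _) (abs_nonneg _) (by rw [abs_mul]; norm_num)
  set y := ‖LFunction ψ (1 + x + Complex.I * t)‖ with hy
  have h4 : 1 ≤ (C₁ / x) ^ 3 * y ^ 4 * (C₂ * (2 * |t| ^ (1 / 30 : ℝ))) := by
    refine h.le.trans ?_
    gcongr
    exact h2.trans (by gcongr)
  have h5 := mul_le_mul_of_nonneg_left h4 (pow_pos hx 3).le
  rw [mul_one] at h5
  refine h5.trans (le_of_eq ?_)
  field_simp

/-- A polynomial zero-free region with a lower bound for the `L`-function inside it. -/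
lemma exists_le_norm_LFunction :
    ∃ c : ℝ, 0 < c ∧ c ≤ 1 ∧ ∀ s : ℂ, 3 ≤ |s.im| → 1 - c / (|s.im| ^ (1 / 30 : ℝ)) ^ 5 ≤ s.re →
      s.re ≤ 5 / 2 → c / (|s.im| ^ (1 / 30 : ℝ)) ^ 4 ≤ ‖LFunction ψ s‖ := by
  obtain ⟨M, hM, h41⟩ := exists_le_norm_LFunction_pow_four ψ
  obtain ⟨C, hC, hder⟩ := exists_norm_deriv_LFunction_le ψ
  set k : ℝ := 1 / (M + 1) with hk
  have hk0 : 0 < k := by positivity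
  have hk1 : k ≤ 1 := by rw [hk, div_le_one (by positivity)]; linarith
  have hk4 : k ^ 4 * M ≤ 1 := by
    calc k ^ 4 * M ≤ k ^ 1 * M := by
          gcongr ?_ * M
          exact pow_le_pow_of_le_one hk0.le hk1 (by norm_num)
      _ ≤ 1 := by rw [pow_one, hk, div_mul_eq_mul_div, one_mul, div_le_one (by positivity)]; linarith
  set l : ℝ := k / (8 * C + 10) with hl
  have hl0 : 0 < l := by positivity
  have hl1 : l ≤ 1 / 10 := by
    rw [hl, div_le_iff₀ (by positivity)]; nlinarith
  have hlC : 8 * C * l ≤ k := by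
    rw [hl, mul_div_assoc', div_le_iff₀ (by positivity)]; nlinarith
  have hl4 : l ^ 4 ≤ 1 / 10000 := by
    calc l ^ 4 ≤ (1 / 10) ^ 4 := by gcongr
      _ = _ := by norm_num
  refine ⟨min (l ^ 4) (k * l ^ 3 / 2), by positivity, (min_le_left _ _).trans (by linarith),
    fun s him hre hre2 => ?_⟩
  set a : ℝ := |s.im| ^ (1 / 30 : ℝ) with ha
  have ha1 : 1 ≤ a := Real.one_le_rpow (by linarith) (by norm_num)
  have ha0 : 0 < a := by linarith
  set x₀ : ℝ := l ^ 4 / a ^ 5 with hx₀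
  have hx₀0 : 0 < x₀ := by positivity
  have hx₀1 : x₀ ≤ 1 / 10000 := by
    rw [hx₀, div_le_iff₀ (by positivity)]
    have := one_le_pow₀ ha1 (n := 5)
    nlinarith
  have hlow : ∀ x : ℝ, x₀ ≤ x → x ≤ 3 / 2 →
      k * l ^ 3 / a ^ 4 ≤ ‖LFunction ψ (1 + x + Complex.I * s.im)‖ := by
    intro x hx hx2
    have h := h41 x s.im (hx₀0.trans_le hx) hx2 (by linarith)
    rw [← ha] at h
    refine (pow_le_pow_iff_left₀ (by positivity) (norm_nonneg _) (by norm_num : 4 ≠ 0)).1 ?_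
    have h1 : x₀ ^ 3 ≤ x ^ 3 := by gcongr
    have h2 := h1.trans h
    rw [hx₀] at h2
    set y := ‖LFunction ψ (1 + x + Complex.I * s.im)‖
    have h3 : (k * l ^ 3 / a ^ 4) ^ 4 * M = (k ^ 4 * M) * ((l ^ 4 / a ^ 5) ^ 3 / a) := by
      field_simp
    have h4 : (k * l ^ 3 / a ^ 4) ^ 4 * M ≤ y ^ 4 * M := by
      rw [h3]
      calc _ ≤ 1 * ((l ^ 4 / a ^ 5) ^ 3 / a) := by gcongr
        _ ≤ 1 * ((M * a * y ^ 4) / a) := by gcongr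
        _ = _ := by field_simp
    exact le_of_mul_le_mul_right h4 hM
  have hcmp : min (l ^ 4) (k * l ^ 3 / 2) / a ^ 4 ≤ k * l ^ 3 / a ^ 4 / 2 := by
    rw [div_right_comm]
    gcongr
    exact min_le_right _ _
  rcases le_or_gt (1 + x₀) s.re with hs | hs
  · have h := hlow (s.re - 1) (by linarith) (by linarith)
    have e : (1 + ((s.re - 1 : ℝ) : ℂ) + Complex.I * s.im) = s := by
      apply Complex.ext <;> simp
    rw [e] at h
    refine hcmp.trans ((half_le_self (by positivity)).trans h)
  · set z : ℂ := 1 + x₀ + Complex.I * s.im with hz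
    have hzs : ‖z - s‖ ≤ 2 * x₀ := by
      have e : z - s = ((1 + x₀ - s.re : ℝ) : ℂ) := by
        apply Complex.ext <;> simp [hz]
      rw [e, Complex.norm_real, Real.norm_of_nonneg (by linarith)]
      have : 1 - x₀ ≤ s.re := by
        refine le_trans ?_ hre
        rw [hx₀]
        gcongr
        exact min_le_left _ _
      linarith
    have hball : ∀ w ∈ Metric.closedBall s (2 * x₀), 1 - 1 / 120 ≤ w.re ∧ w.re ≤ 5 / 2 ∧
        2 ≤ |w.im| ∧ |w.im| ≤ 2 * |s.im| := by
      intro w hw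
      rw [Metric.mem_closedBall, dist_eq_norm] at hw
      obtain ⟨hb, hc⟩ := abs_re_sub_le_and_abs_im_sub_le hw
      have hd := abs_sub_abs_le_abs_sub s.im w.im
      have he := abs_sub_abs_le_abs_sub w.im s.im
      rw [abs_sub_comm] at hd
      rw [abs_le] at hb
      have : 1 - x₀ ≤ s.re := by
        refine le_trans ?_ hre
        rw [hx₀]
        gcongr
        exact min_le_left _ _
      exact ⟨by linarith, by linarith, by linarith, by linarith⟩
    have hmv := Convex.norm_image_sub_le_of_norm_deriv_le (f := LFunction ψ) (𝕜 := ℂ)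
      (C := C * (2 * a)) (s := Metric.closedBall s (2 * x₀)) (x := s) (y := z)
      (fun w hw => differentiableAt_LFunction ψ w (Or.inl (by
        rintro rfl
        have := (hball _ hw).2.2.1
        simp at this
        linarith)))
      (fun w hw => by
        obtain ⟨a1, a2, a3, a4⟩ := hball w hw
        refine (hder w a1 a2 a3).trans ?_
        gcongr
        exact rpow_le_two_mul_rpow (abs_nonneg _) (abs_nonneg _) a4)
      (convex_closedBall _ _) (Metric.mem_closedBall_self (by positivity))
      (by rw [Metric.mem_closedBall, dist_eq_norm]; exact hzs)
    have h := hlow x₀ le_rfl (by linarith)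
    have h1 : C * (2 * a) * ‖z - s‖ ≤ k * l ^ 3 / a ^ 4 / 2 := by
      calc C * (2 * a) * ‖z - s‖ ≤ C * (2 * a) * (2 * x₀) := by gcongr
        _ = (8 * C * l) * (l ^ 3 / a ^ 4) / 2 := by rw [hx₀]; field_simp; ring
        _ ≤ k * (l ^ 3 / a ^ 4) / 2 := by gcongr
        _ = _ := by ring
    have h2 : ‖LFunction ψ z‖ ≤ ‖LFunction ψ z - LFunction ψ s‖ + ‖LFunction ψ s‖ := by
      simpa using norm_add_le (LFunction ψ z - LFunction ψ s) (LFunction ψ s)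
    linarith

end LFunctionLowerBound

section RegularLogDeriv

open MeasureTheory Filter Topology Set DirichletCharacter

variable {N : ℕ} [NeZero N] (ψ : DirichletCharacter ℂ N)

open Classical in
/-- The order of the pole of `L(ψ, s)` at `s = 1`. -/
noncomputable def poleOrder : ℕ := if ψ = 1 then 1 else 0

open Classical in
/-- The `L`-function of `ψ` with its possible pole at `1` removed. -/
noncomputable def entireLFunction : ℂ → ℂ :=
  if ψ = 1 then LFunctionTrivChar₁ N else LFunction ψ

/-- Minus the logarithmic derivative of `L(ψ, s)`, with its possible pole at `1` removed. -/
noncomputable def regularLogDeriv (s : ℂ) : ℂ :=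
  -(deriv (entireLFunction ψ) s / entireLFunction ψ s)

lemma differentiable_entireLFunction : Differentiable ℂ (entireLFunction ψ) := by
  unfold entireLFunction
  split_ifs with h
  · exact differentiable_LFunctionTrivChar₁ N
  · exact differentiable_LFunction h

lemma entireLFunction_ne_zero {s : ℂ} (h : LFunction ψ s ≠ 0) (hs : s ≠ 1) :
    entireLFunction ψ s ≠ 0 := by
  unfold entireLFunction
  split_ifs with h'
  · subst h'
    rw [LFunctionTrivChar₁, Function.update_of_ne hs]
    exact mul_ne_zero (sub_ne_zero.2 hs) h
  · exact h

lemma entireLFunction_ne_zero_of_one_le_re {s : ℂ} (hs : 1 ≤ s.re) :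
    entireLFunction ψ s ≠ 0 := by
  by_cases h1 : s = 1
  · subst h1
    unfold entireLFunction
    split_ifs with h
    · exact LFunctionTrivChar₁_apply_one_ne_zero N
    · exact LFunction_apply_one_ne_zero h
  · exact entireLFunction_ne_zero ψ (LFunction_ne_zero_of_one_le_re ψ (Or.inr h1) hs) h1

lemma regularLogDeriv_eq {s : ℂ} (h : LFunction ψ s ≠ 0) (hs : s ≠ 1) :
    regularLogDeriv ψ s = -(deriv (LFunction ψ) s / LFunction ψ s) - poleOrder ψ / (s - 1) := by
  have hs' : s - 1 ≠ 0 := sub_ne_zero.2 hs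
  unfold regularLogDeriv entireLFunction poleOrder
  by_cases h' : ψ = 1
  · subst h'
    simp only [if_true]
    rw [deriv_LFunctionTrivChar₁_apply_of_ne_one N hs, LFunctionTrivChar₁, Function.update_of_ne hs]
    field_simp
    push_cast
    ring
  · simp [h']

lemma regularLogDeriv_one (h : ψ ≠ 1) :
    regularLogDeriv ψ 1 = -(deriv (LFunction ψ) 1 / LFunction ψ 1) := by
  simp [regularLogDeriv, entireLFunction, h]

lemma isOpen_entireLFunction_ne_zero : IsOpen {s | entireLFunction ψ s ≠ 0} :=
  isOpen_ne_fun (differentiable_entireLFunction ψ).continuous continuous_const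

lemma differentiableOn_regularLogDeriv :
    DifferentiableOn ℂ (regularLogDeriv ψ) {s | entireLFunction ψ s ≠ 0} := by
  intro s hs
  have hd := differentiable_entireLFunction ψ
  have hd' : Differentiable ℂ (deriv (entireLFunction ψ)) :=
    (hd.contDiff (n := 2)).differentiable_deriv_two
  exact ((hd' s).div (hd s) hs).neg.differentiableWithinAt

lemma differentiableOn_dslope_regularLogDeriv :
    DifferentiableOn ℂ (dslope (regularLogDeriv ψ) 1) {s | entireLFunction ψ s ≠ 0} :=
  (Complex.differentiableOn_dslope ((isOpen_entireLFunction_ne_zero ψ).mem_nhds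
    (entireLFunction_ne_zero_of_one_le_re ψ (by simp)))).2 (differentiableOn_regularLogDeriv ψ)

lemma one_le_norm_sub_one_of_im {s : ℂ} (hs : 1 ≤ |s.im|) : 1 ≤ ‖s - 1‖ := by
  refine hs.trans ?_
  simpa using Complex.abs_im_le_norm (s - 1)

lemma exists_norm_dslope_regularLogDeriv_le :
    ∃ c D : ℝ, 0 < c ∧ c ≤ 1 ∧ 0 < D ∧ ∀ s : ℂ, 3 ≤ |s.im| →
      1 - c / (|s.im| ^ (1 / 30 : ℝ)) ^ 5 ≤ s.re → s.re ≤ 5 / 2 →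
      entireLFunction ψ s ≠ 0 ∧
      ‖dslope (regularLogDeriv ψ) 1 s‖ ≤ D * (|s.im| ^ (1 / 30 : ℝ)) ^ 5 / |s.im| := by
  obtain ⟨c, hc, hc1, hlow⟩ := exists_le_norm_LFunction ψ
  obtain ⟨C, hC, hder⟩ := exists_norm_deriv_LFunction_le ψ
  refine ⟨c / 120, C / c + 1 + ‖regularLogDeriv ψ 1‖, by positivity, by linarith, by positivity,
    fun s him hre hre2 => ?_⟩
  set a : ℝ := |s.im| ^ (1 / 30 : ℝ) with ha
  have ha1 : 1 ≤ a := Real.one_le_rpow (by linarith) (by norm_num)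
  have ha0 : 0 < a := by linarith
  have ha5 := one_le_pow₀ ha1 (n := 5)
  have him0 : 0 < |s.im| := by linarith
  have hs1 := one_le_norm_sub_one_of_im (s := s) (by linarith)
  have hne : s ≠ 1 := by rintro rfl; simp at hs1; linarith
  have h1 : c / a ^ 4 ≤ ‖LFunction ψ s‖ := by
    refine hlow s him (le_trans ?_ hre) hre2
    gcongr
    linarith
  have hL0 : LFunction ψ s ≠ 0 := norm_pos_iff.1 (lt_of_lt_of_le (by positivity) h1)
  have h2 : ‖deriv (LFunction ψ) s‖ ≤ C * a := by
    refine hder s (le_trans ?_ hre) hre2 (by linarith)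
    have : c / 120 / a ^ 5 ≤ 1 / 120 := by
      rw [div_le_iff₀ (by positivity)]; linarith
    linarith
  have hκ : ‖(poleOrder ψ : ℂ)‖ ≤ 1 := by
    unfold poleOrder; split_ifs <;> simp
  have h3 : ‖regularLogDeriv ψ s‖ ≤ (C / c + 1) * a ^ 5 := by
    rw [regularLogDeriv_eq ψ hL0 hne]
    refine (norm_sub_le _ _).trans ?_
    rw [norm_neg, norm_div, norm_div]
    calc _ ≤ C * a / (c / a ^ 4) + 1 / 1 := by gcongr
      _ = C / c * a ^ 5 + 1 := by field_simp
      _ ≤ _ := by linarith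
  refine ⟨entireLFunction_ne_zero ψ hL0 hne, ?_⟩
  rw [dslope_of_ne _ hne, slope_def_field, norm_div]
  have h4 : |s.im| ≤ ‖s - 1‖ := by simpa using Complex.abs_im_le_norm (s - 1)
  have h5 : ‖regularLogDeriv ψ s - regularLogDeriv ψ 1‖ ≤
      (C / c + 1 + ‖regularLogDeriv ψ 1‖) * a ^ 5 := by
    refine (norm_sub_le _ _).trans ?_
    nlinarith [norm_nonneg (regularLogDeriv ψ 1)]
  gcongr

/-- Second derivative bound for the divided difference of the logarithmic derivative of `L(ψ, s)`
up to the line `Re s = 1`. -/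
lemma exists_norm_iteratedDeriv_dslope_le :
    ∃ B : ℝ, 0 ≤ B ∧ ∀ s : ℂ, 1 ≤ s.re → s.re ≤ 2 → s.im ≠ 0 →
      ‖iteratedDeriv 2 (dslope (regularLogDeriv ψ) 1) s‖ ≤ B * |s.im| ^ (-(1 / 2) : ℝ) := by
  obtain ⟨c, D, hc, hc1, hD, hb⟩ := exists_norm_dslope_regularLogDeriv_le ψ
  set g := dslope (regularLogDeriv ψ) 1 with hg
  have hU := isOpen_entireLFunction_ne_zero ψ
  have hgd := differentiableOn_dslope_regularLogDeriv ψ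
  have hcont : ContinuousOn (iteratedDeriv 2 g) (Icc 1 2 ×ℂ Icc (-4) 4) := by
    have h2 : AnalyticOnNhd ℂ (iteratedDeriv 2 g) {s | entireLFunction ψ s ≠ 0} := by
      rw [iteratedDeriv_succ, iteratedDeriv_one]
      exact (hgd.analyticOnNhd hU).deriv.deriv
    refine h2.continuousOn.mono fun s hs => ?_
    exact entireLFunction_ne_zero_of_one_le_re ψ (Complex.mem_reProdIm.1 hs).1.1
  obtain ⟨B₀, hB₀⟩ := (isCompact_Icc.reProdIm isCompact_Icc).exists_bound_of_continuousOn hcont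
  refine ⟨max (2 * B₀) (4 * 32 ^ 3 * D / c ^ 2), le_max_of_le_right (by positivity),
    fun s h1 h2 h0 => ?_⟩
  have him0 : 0 < |s.im| := abs_pos.2 h0
  rcases le_or_gt |s.im| 4 with h4 | h4
  · have h := hB₀ s (Complex.mem_reProdIm.2 ⟨⟨h1, h2⟩, abs_le.1 h4⟩)
    have hB₀0 : 0 ≤ B₀ := (norm_nonneg _).trans h
    have h5 : (1 / 2 : ℝ) ≤ |s.im| ^ (-(1 / 2) : ℝ) := by
      calc (1 / 2 : ℝ) = 4 ^ (-(1 / 2) : ℝ) := by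
            rw [show (4 : ℝ) = 2 ^ (2 : ℝ) by norm_num, ← Real.rpow_mul (by norm_num)]
            norm_num [Real.rpow_neg_one]
        _ ≤ _ := Real.rpow_le_rpow_of_nonpos him0 h4 (by norm_num)
    calc _ ≤ B₀ := h
      _ = 2 * B₀ * (1 / 2) := by ring
      _ ≤ max (2 * B₀) (4 * 32 ^ 3 * D / c ^ 2) * |s.im| ^ (-(1 / 2) : ℝ) := by
        gcongr
        · exact le_max_left _ _
  · set a : ℝ := |s.im| ^ (1 / 30 : ℝ) with ha
    have ha1 : 1 ≤ a := Real.one_le_rpow (by linarith) (by norm_num)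
    have ha0 : 0 < a := by linarith
    have ha5 := one_le_pow₀ ha1 (n := 5)
    set r : ℝ := c / 32 / a ^ 5 with hr
    have hr0 : 0 < r := by positivity
    have hr1 : r ≤ 1 / 32 := by
      rw [hr, div_le_iff₀ (by positivity)]; linarith
    have hball : ∀ w ∈ Metric.closedBall s r, 3 ≤ |w.im| ∧ |w.im| ≤ 2 * |s.im| ∧
        |s.im| / 2 ≤ |w.im| ∧ 1 - c / (|w.im| ^ (1 / 30 : ℝ)) ^ 5 ≤ w.re ∧ w.re ≤ 5 / 2 := by
      intro w hw
      rw [Metric.mem_closedBall, dist_eq_norm] at hw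
      obtain ⟨hb, hc⟩ := abs_re_sub_le_and_abs_im_sub_le hw
      have hd := abs_sub_abs_le_abs_sub s.im w.im
      have he := abs_sub_abs_le_abs_sub w.im s.im
      rw [abs_sub_comm] at hd
      rw [abs_le] at hb
      have hw2 : |w.im| ≤ 2 * |s.im| := by linarith
      refine ⟨by linarith, hw2, by linarith, ?_, by linarith⟩
      have hw3 := rpow_le_two_mul_rpow (abs_nonneg w.im) (abs_nonneg _) hw2
      have hwpos : 0 < |w.im| ^ (1 / 30 : ℝ) := Real.rpow_pos_of_pos (by linarith) _
      have : r ≤ c / (|w.im| ^ (1 / 30 : ℝ)) ^ 5 := by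
        rw [hr, div_div]
        have : (|w.im| ^ (1 / 30 : ℝ)) ^ 5 ≤ 32 * a ^ 5 := by
          calc (|w.im| ^ (1 / 30 : ℝ)) ^ 5 ≤ (2 * a) ^ 5 := by gcongr
            _ = _ := by ring
        gcongr
      linarith
    have hdc : DiffContOnCl ℂ g (Metric.ball s r) :=
      hgd.diffContOnCl_ball fun w hw => by
        obtain ⟨a1, a2, a3, a4, a5⟩ := hball w hw
        exact (hb w a1 a4 a5).1
    have h := Complex.norm_iteratedDeriv_le_of_forall_mem_sphere_norm_le 2 hr0 hdc
      (C := D * (32 * a ^ 5) / (|s.im| / 2)) fun w hw => by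
        obtain ⟨a1, a2, a3, a4, a5⟩ := hball w (Metric.sphere_subset_closedBall hw)
        refine (hb w a1 a4 a5).2.trans ?_
        have hw3 := rpow_le_two_mul_rpow (abs_nonneg w.im) (abs_nonneg _) a2
        have : (|w.im| ^ (1 / 30 : ℝ)) ^ 5 ≤ 32 * a ^ 5 := by
          calc (|w.im| ^ (1 / 30 : ℝ)) ^ 5 ≤ (2 * a) ^ 5 := by gcongr
            _ = _ := by ring
        gcongr
    have e1 : a ^ 15 / |s.im| = |s.im| ^ (-(1 / 2) : ℝ) := by
      rw [ha, ← Real.rpow_natCast, ← Real.rpow_mul him0.le]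
      nth_rewrite 2 [← Real.rpow_one |s.im|]
      rw [← Real.rpow_sub him0]
      norm_num
    calc _ ≤ _ := h
      _ = 4 * 32 ^ 3 * D / c ^ 2 * (a ^ 15 / |s.im|) := by
        rw [hr, show (Nat.factorial 2 : ℝ) = 2 by norm_num [Nat.factorial]]
        field_simp
        ring
      _ ≤ _ := by
        rw [e1]
        gcongr
        exact le_max_right _ _

end RegularLogDeriv

section MellinSecondDerivative

open MeasureTheory Filter Topology Set Asymptotics FourierTransform

lemma isBigO_rpow_of_norm_le_log_pow {f : ℝ → ℂ} {C : ℝ}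
    (hf : ∀ t : ℝ, 1 ≤ t → ‖f t‖ ≤ C * (1 + Real.log t) ^ 4) {r : ℝ} (hr : 0 < r) :
    f =O[atTop] fun t : ℝ => t ^ r := by
  refine IsBigO.of_bound (|C| * (1 + 4 / r) ^ 4) ?_
  filter_upwards [eventually_ge_atTop 1] with t ht
  have ht0 : 0 < t := by linarith
  have h1 : Real.log t ≤ t ^ (r / 4) / (r / 4) := Real.log_le_rpow_div ht0.le (by positivity)
  have h2 : 1 ≤ t ^ (r / 4) := Real.one_le_rpow ht (by positivity)
  have h3 : 1 + Real.log t ≤ (1 + 4 / r) * t ^ (r / 4) := by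
    have : t ^ (r / 4) / (r / 4) = 4 / r * t ^ (r / 4) := by field_simp
    linarith
  have h4 : 0 ≤ Real.log t := Real.log_nonneg ht
  have h5 : (t ^ (r / 4)) ^ 4 = t ^ r := by
    rw [← Real.rpow_natCast, ← Real.rpow_mul ht0.le]; congr 1; push_cast; ring
  rw [Real.norm_of_nonneg (by positivity)]
  calc ‖f t‖ ≤ C * (1 + Real.log t) ^ 4 := hf t ht
    _ ≤ |C| * (1 + Real.log t) ^ 4 := by gcongr; exact le_abs_self C
    _ ≤ |C| * ((1 + 4 / r) * t ^ (r / 4)) ^ 4 := by gcongr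
    _ = _ := by rw [mul_pow, h5]; ring

variable {D : ℝ → ℂ} {C : ℝ}

lemma comp_log_isBigO_zero (hneg : ∀ u < 0, D u = 0) (g : ℝ → ℝ) (b : ℝ) :
    (fun t : ℝ => g t • D (Real.log t)) =O[𝓝[>] 0] fun t : ℝ => t ^ (-b) := by
  have : (fun t : ℝ => g t • D (Real.log t)) =ᶠ[𝓝[>] 0] fun _ => 0 := by
    filter_upwards [Ioo_mem_nhdsGT one_pos] with t ht
    rw [hneg _ (Real.log_neg ht.1 ht.2), smul_zero]
  exact this.trans_isBigO (isBigO_zero _ _)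

lemma comp_log_locallyIntegrableOn (hC : 0 ≤ C) (hD : Measurable D) (hneg : ∀ u < 0, D u = 0)
    (hle : ∀ u, 0 ≤ u → ‖D u‖ ≤ C * (1 + u) ^ 2) :
    LocallyIntegrableOn (fun t : ℝ => D (Real.log t)) (Ioi 0) := by
  have hc : Continuous fun t : ℝ => C * (1 + |t|) ^ 2 := by fun_prop
  refine (hc.locallyIntegrable.mono (hD.comp Real.measurable_log).aestronglyMeasurable
    (Eventually.of_forall fun t => ?_)).locallyIntegrableOn _
  rw [Real.norm_of_nonneg (by positivity)]
  rcases lt_or_ge (Real.log t) 0 with h | h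
  · simp only [Function.comp]; rw [hneg _ h, norm_zero]; positivity
  · refine (hle _ h).trans ?_
    gcongr
    rw [← Real.log_abs]
    exact Real.log_le_self (abs_nonneg t)

lemma iteratedDeriv_two_eq_fourier (hC : 0 ≤ C) (hD : Measurable D) (hneg : ∀ u < 0, D u = 0)
    (hle : ∀ u, 0 ≤ u → ‖D u‖ ≤ C * (1 + u) ^ 2) {g : ℂ → ℂ}
    (hg : ∀ z : ℂ, 0 < z.re → g (1 + z) = mellin (fun t => D (Real.log t)) (-z)) {z : ℂ}
    (hz : 0 < z.re) :
    iteratedDeriv 2 g (1 + z) =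
      𝓕 (fun u : ℝ => (u ^ 2 * Real.exp (-z.re * u)) • D u) (z.im / (2 * Real.pi)) := by
  set d : ℝ → ℂ := fun t => D (Real.log t) with hd
  have hloc := comp_log_locallyIntegrableOn hC hD hneg hle
  have hlogc : ContinuousOn Real.log (Ioi 0) :=
    Real.continuousOn_log.mono (subset_compl_singleton_iff.mpr self_notMem_Ioi)
  have hloc' : LocallyIntegrableOn (fun t => Real.log t • d t) (Ioi 0) :=
    hloc.continuousOn_smul isOpen_Ioi.isLocallyClosed hlogc
  have hb0 : ∀ t : ℝ, 1 ≤ t → ‖d t‖ ≤ C * (1 + Real.log t) ^ 4 := fun t ht => by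
    have h := Real.log_nonneg ht
    refine (hle _ h).trans ?_
    gcongr
    · linarith
    · norm_num
  have hb1 : ∀ t : ℝ, 1 ≤ t → ‖Real.log t • d t‖ ≤ C * (1 + Real.log t) ^ 4 := fun t ht => by
    have h := Real.log_nonneg ht
    rw [norm_smul, Real.norm_of_nonneg h]
    calc Real.log t * ‖d t‖ ≤ (1 + Real.log t) ^ 1 * (C * (1 + Real.log t) ^ 2) := by
          gcongr
          · linarith
          · exact hle _ h
      _ = C * (1 + Real.log t) ^ 3 := by ring
      _ ≤ _ := by
        gcongr
        · linarith
        · norm_num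
  have hO0 : ∀ r : ℝ, 0 < r → d =O[atTop] fun t : ℝ => t ^ (-(-r)) := fun r hr => by
    simpa using isBigO_rpow_of_norm_le_log_pow hb0 hr
  have hO1 : ∀ r : ℝ, 0 < r → (fun t => Real.log t • d t) =O[atTop] fun t : ℝ => t ^ (-(-r)) :=
    fun r hr => by simpa using isBigO_rpow_of_norm_le_log_pow hb1 hr
  have hder0 : ∀ s : ℂ, s.re < 0 →
      HasDerivAt (mellin d) (mellin (fun t => Real.log t • d t) s) s := fun s hs => by
    have h := comp_log_isBigO_zero hneg (fun _ => 1) (s.re - 1)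
    simp only [one_smul] at h
    exact (mellin_hasDerivAt_of_isBigO_rpow hloc (hO0 (-s.re / 2) (by linarith)) (by linarith)
      (b := s.re - 1) h (by linarith)).2
  have hder1 : ∀ s : ℂ, s.re < 0 → HasDerivAt (mellin fun t => Real.log t • d t)
      (mellin (fun t => Real.log t • Real.log t • d t) s) s := fun s hs =>
    (mellin_hasDerivAt_of_isBigO_rpow hloc' (hO1 (-s.re / 2) (by linarith)) (by linarith)
      (comp_log_isBigO_zero hneg Real.log (s.re - 1)) (by linarith)).2
  have hUo : IsOpen {w : ℂ | 1 < w.re} := isOpen_lt continuous_const Complex.continuous_re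
  have hg0 : ∀ w : ℂ, 1 < w.re → g w = mellin d (1 - w) := fun w hw => by
    have := hg (w - 1) (by simpa using hw)
    simpa using this
  have hinner : ∀ w : ℂ, HasDerivAt (fun w : ℂ => 1 - w) (-1) w := fun w => by
    simpa using (hasDerivAt_id w).const_sub 1
  have hg1 : ∀ w : ℂ, 1 < w.re → deriv g w = -mellin (fun t => Real.log t • d t) (1 - w) := by
    intro w hw
    have : g =ᶠ[𝓝 w] fun w => mellin d (1 - w) := by
      filter_upwards [hUo.mem_nhds hw] with v hv using hg0 v hv
    rw [this.deriv_eq]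
    have := ((hder0 (1 - w) (by simpa using hw)).comp w (hinner w)).deriv
    rw [mul_neg_one] at this
    exact this
  have hw : 1 < (1 + z).re := by simpa using hz
  rw [iteratedDeriv_succ, iteratedDeriv_one]
  have h2 : deriv g =ᶠ[𝓝 (1 + z)] fun w => -mellin (fun t => Real.log t • d t) (1 - w) := by
    filter_upwards [hUo.mem_nhds hw] with v hv using hg1 v hv
  rw [h2.deriv_eq]
  have h3 := ((hder1 (1 - (1 + z)) (by simpa using hw)).comp (1 + z) (hinner (1 + z))).neg
  have h4 : deriv (fun w => -mellin (fun t => Real.log t • d t) (1 - w)) (1 + z) =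
      mellin (fun t => Real.log t • Real.log t • d t) (-z) := by
    have := h3.deriv
    simp only [mul_neg, mul_one, neg_neg] at this
    rw [show (1 : ℂ) - (1 + z) = -z by ring] at this
    exact this
  rw [h4, ← mellin_comp_inv, mellin_eq_fourier]
  refine congrFun (congrArg 𝓕 (funext fun u => ?_)) _
  simp only [hd, Real.log_inv, Real.log_exp, neg_neg]
  simp only [smul_smul]
  congr 1
  ring

lemma integrable_sq_mul_exp_smul (hC : 0 ≤ C) (hD : Measurable D) (hneg : ∀ u < 0, D u = 0)
    (hle : ∀ u, 0 ≤ u → ‖D u‖ ≤ C * (1 + u) ^ 2) {σ : ℝ} (hσ : 0 < σ) :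
    Integrable fun u : ℝ => (u ^ 2 * Real.exp (-σ * u)) • D u := by
  have hm : AEStronglyMeasurable (fun u : ℝ => (u ^ 2 * Real.exp (-σ * u)) • D u) := by
    have : Measurable fun u : ℝ => u ^ 2 * Real.exp (-σ * u) := by fun_prop
    exact (this.smul hD).aestronglyMeasurable
  have hi : IntegrableOn (fun u : ℝ => (256 * C * max 1 (2 / σ) ^ 4) * Real.exp (-(σ / 2) * u))
      (Ioi 0) := (exp_neg_integrableOn_Ioi 0 (by positivity)).const_mul _
  have hi' := (integrable_indicator_iff measurableSet_Ioi).2 hi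
  refine hi'.mono' hm (Eventually.of_forall fun u => ?_)
  rcases lt_trichotomy u 0 with h | h | h
  · rw [hneg u h, smul_zero, norm_zero, indicator_of_notMem (by simpa using h.le)]
  · subst h; simp
  · rw [indicator_of_mem (by simpa using h), norm_smul, Real.norm_of_nonneg (by positivity)]
    have h1 := one_add_pow_four_mul_exp_neg_le (y := σ / 2 * u) (by positivity)
    have h2 : 1 + u ≤ max 1 (2 / σ) * (1 + σ / 2 * u) := by
      have ha : (1 : ℝ) ≤ max 1 (2 / σ) := le_max_left _ _
      have hb : 1 ≤ max 1 (2 / σ) * (σ / 2) := by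
        calc (1 : ℝ) = 2 / σ * (σ / 2) := by field_simp
          _ ≤ _ := by gcongr; exact le_max_right _ _
      nlinarith
    have h3 : Real.exp (-σ * u) = Real.exp (-(σ / 2 * u)) * Real.exp (-(σ / 2) * u) := by
      rw [← Real.exp_add]; congr 1; ring
    calc u ^ 2 * Real.exp (-σ * u) * ‖D u‖
        ≤ (1 + u) ^ 2 * Real.exp (-σ * u) * (C * (1 + u) ^ 2) := by
          gcongr
          · linarith
          · exact hle u h.le
      _ = C * (1 + u) ^ 4 * Real.exp (-σ * u) := by ring
      _ ≤ C * (max 1 (2 / σ) * (1 + σ / 2 * u)) ^ 4 * Real.exp (-σ * u) := by gcongr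
      _ = C * max 1 (2 / σ) ^ 4 * ((1 + σ / 2 * u) ^ 4 * Real.exp (-(σ / 2 * u))) *
          Real.exp (-(σ / 2) * u) := by rw [h3]; ring
      _ ≤ C * max 1 (2 / σ) ^ 4 * 256 * Real.exp (-(σ / 2) * u) := by gcongr
      _ = _ := by ring

end MellinSecondDerivative

section MertensSum

open MeasureTheory Filter Topology Set Asymptotics FourierTransform
open DirichletCharacter ArithmeticFunction

lemma integral_Ioi_one_cpow {z : ℂ} (hz : 0 < z.re) :
    IntegrableOn (fun t : ℝ => (t : ℂ) ^ (-z - 1)) (Ioi 1) ∧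
      ∫ t in Ioi (1 : ℝ), (t : ℂ) ^ (-z - 1) = 1 / z := by
  have h : (-z - 1).re < -1 := by simp; linarith
  refine ⟨integrableOn_Ioi_cpow_of_lt h one_pos, ?_⟩
  rw [integral_Ioi_cpow_of_lt h one_pos]
  simp

lemma integral_Ioi_one_log_mul_cpow {z : ℂ} (hz : 0 < z.re) :
    IntegrableOn (fun t : ℝ => (t : ℂ) ^ (-z - 1) * Real.log t) (Ioi 1) ∧
      ∫ t in Ioi (1 : ℝ), (t : ℂ) ^ (-z - 1) * Real.log t = 1 / z ^ 2 := by
  set f : ℝ → ℂ := (Ioi (1 : ℝ)).indicator fun _ => 1 with hf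
  have hsub : ∀ g : ℝ → ℂ, ∀ s : ℂ, EqOn (fun t : ℝ => (t : ℂ) ^ (s - 1) • (g t * f t))
      ((Ioi (1 : ℝ)).indicator fun t : ℝ => (t : ℂ) ^ (s - 1) * g t) (Ioi 0) := by
    intro g s t _
    by_cases ht : t ∈ Ioi (1 : ℝ)
    · simp [hf, indicator_of_mem ht]
    · simp [hf, indicator_of_notMem ht]
  have hint : ∀ g : ℝ → ℂ, ∀ s : ℂ,
      mellin (fun t => g t * f t) s = ∫ t in Ioi (1 : ℝ), (t : ℂ) ^ (s - 1) * g t := by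
    intro g s
    rw [mellin, setIntegral_congr_fun measurableSet_Ioi (hsub g s),
      setIntegral_indicator measurableSet_Ioi]
    congr 2
    ext t
    simp only [mem_inter_iff, mem_Ioi]
    constructor
    · exact fun h => h.2
    · exact fun h => ⟨by linarith, h⟩
  have hloc : LocallyIntegrableOn f (Ioi 0) := by
    refine LocallyIntegrable.locallyIntegrableOn ?_ _
    exact (locallyIntegrable_const (1 : ℂ)).indicator measurableSet_Ioi
  have htop : f =O[atTop] fun t : ℝ => t ^ (-(0 : ℝ)) := by
    refine IsBigO.of_bound 1 (Eventually.of_forall fun t => ?_)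
    by_cases ht : t ∈ Ioi (1 : ℝ)
    · simp [hf, indicator_of_mem ht]
    · simp [hf, indicator_of_notMem ht]
  have hbot : f =O[𝓝[>] 0] fun t : ℝ => t ^ (-(-z.re - 1)) := by
    have : f =ᶠ[𝓝[>] 0] fun _ => 0 := by
      filter_upwards [Ioo_mem_nhdsGT one_pos] with t ht
      exact indicator_of_notMem (by simpa using ht.2.le) _
    exact this.trans_isBigO (isBigO_zero _ _)
  have hneg : (-z).re < 0 := by simpa using hz
  obtain ⟨hconv, hder⟩ := mellin_hasDerivAt_of_isBigO_rpow (s := -z) hloc htop hneg hbot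
    (by simp)
  have heq : mellin f =ᶠ[𝓝 (-z)] fun s => -s⁻¹ := by
    have hUo : IsOpen {w : ℂ | w.re < 0} := isOpen_lt Complex.continuous_re continuous_const
    filter_upwards [hUo.mem_nhds hneg] with s hs
    have h1 := hint (fun _ => 1) s
    simp only [one_mul, mul_one] at h1
    rw [show mellin f s = ∫ t in Ioi (1 : ℝ), (t : ℂ) ^ (s - 1) from h1]
    have h2 := (integral_Ioi_one_cpow (z := -s) (by simpa using hs)).2
    rw [neg_neg] at h2
    rw [h2, one_div, inv_neg]
  have hz0 : -z ≠ 0 := fun h => by simp [h] at hneg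
  have hder' := ((hasDerivAt_inv hz0).neg.congr_of_eventuallyEq heq)
  have h3 := hder.unique hder'
  have hfun : (fun t : ℝ => Real.log t • f t) = fun t : ℝ => (Real.log t : ℂ) * f t := by
    funext t; rw [Complex.real_smul]
  rw [hfun] at h3 hconv
  have h4 := hint (fun t => (Real.log t : ℂ)) (-z)
  refine ⟨?_, ?_⟩
  · have h5 : IntegrableOn ((Ioi (1 : ℝ)).indicator fun t : ℝ =>
        (t : ℂ) ^ (-z - 1) * (Real.log t : ℂ)) (Ioi 0) :=
      IntegrableOn.congr_fun hconv (hsub (fun t => (Real.log t : ℂ)) (-z)) measurableSet_Ioi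
    have h6 : IntegrableOn ((Ioi (1 : ℝ)).indicator fun t : ℝ =>
        (t : ℂ) ^ (-z - 1) * (Real.log t : ℂ)) (Ioi 1) :=
      h5.mono_set (Ioi_subset_Ioi zero_le_one)
    exact h6.congr_fun (fun t ht => indicator_of_mem ht _) measurableSet_Ioi
  · rw [← h4, h3]
    simp

variable {N : ℕ} (ψ : DirichletCharacter ℂ N)

/-- The sum of `Λ(n) ψ(n) / n` over `n ≤ t`. -/
noncomputable def mertensSum (t : ℝ) : ℂ :=
  ∑ n ∈ Finset.Icc 1 ⌊t⌋₊, (vonMangoldt n : ℂ) * ψ n / n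

lemma measurable_mertensSum : Measurable (mertensSum ψ) :=
  (measurable_from_nat (f := fun k : ℕ =>
    ∑ n ∈ Finset.Icc 1 k, (vonMangoldt n : ℂ) * ψ n / n)).comp Nat.measurable_floor

lemma sum_Ioc_inv_le {a b : ℝ} (ha : 1 ≤ a) (hab : a ≤ b) :
    ∑ n ∈ Finset.Ioc ⌊a⌋₊ ⌊b⌋₊, (1 / n : ℝ) ≤ 1 / a + Real.log (b / a) := by
  have key : ∀ k M : ℕ, a ≤ M + 1 →
      ∑ n ∈ Finset.Ioc M (M + k + 1), (1 / n : ℝ) ≤ 1 / a + Real.log ((M + k + 1 : ℕ) / a) := by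
    intro k M hM
    have hM0 : 0 < a := by linarith
    induction k with
    | zero =>
      simp only [add_zero, Nat.Ioc_succ_singleton, Finset.sum_singleton]
      push_cast
      have h1 : 1 / ((M : ℝ) + 1) ≤ 1 / a := by gcongr
      have h2 : 0 ≤ Real.log (((M : ℝ) + 1) / a) := Real.log_nonneg (by rwa [one_le_div hM0])
      linarith
    | succ k ih =>
      rw [show M + (k + 1) + 1 = (M + k + 1) + 1 by ring,
        Finset.sum_Ioc_succ_top (by omega)]
      have hx : (0 : ℝ) < ((M + k + 1 : ℕ) : ℝ) := by positivity
      have h1 : (1 : ℝ) / ((M + k + 1 + 1 : ℕ) : ℝ) ≤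
          Real.log (((M + k + 1 + 1 : ℕ) : ℝ) / ((M + k + 1 : ℕ) : ℝ)) := by
        have := Real.one_sub_inv_le_log_of_pos
          (x := ((M + k + 1 + 1 : ℕ) : ℝ) / ((M + k + 1 : ℕ) : ℝ)) (by positivity)
        refine le_trans (le_of_eq ?_) this
        push_cast at hx ⊢
        field_simp
        ring
      have h2 : Real.log (((M + k + 1 + 1 : ℕ) : ℝ) / a) =
          Real.log (((M + k + 1 : ℕ) : ℝ) / a) +
            Real.log (((M + k + 1 + 1 : ℕ) : ℝ) / ((M + k + 1 : ℕ) : ℝ)) := by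
        rw [← Real.log_mul (by positivity) (by positivity)]
        congr 1
        field_simp
      rw [h2]
      linarith
  have ha0 : 0 < a := by linarith
  have hlog : 0 ≤ Real.log (b / a) := Real.log_nonneg (by rwa [one_le_div ha0])
  rcases (Nat.floor_mono hab).eq_or_lt with h | h
  · rw [h, Finset.Ioc_self, Finset.sum_empty]
    positivity
  · obtain ⟨k, hk⟩ := Nat.exists_eq_add_of_lt h
    rw [hk]
    refine (key k ⌊a⌋₊ (Nat.lt_floor_add_one a).le).trans ?_
    gcongr
    rw [← hk]
    exact Nat.floor_le (by linarith)

lemma norm_mertensSum_sub_le {a b : ℝ} (ha : 1 ≤ a) (hab : a ≤ b) :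
    ‖mertensSum ψ b - mertensSum ψ a‖ ≤ Real.log b * (1 / a + Real.log (b / a)) := by
  have hb : 1 ≤ b := ha.trans hab
  have hu : mertensSum ψ b - mertensSum ψ a =
      ∑ n ∈ Finset.Ioc ⌊a⌋₊ ⌊b⌋₊, (vonMangoldt n : ℂ) * ψ n / n := by
    rw [mertensSum, mertensSum, sub_eq_iff_eq_add']
    have hIcc : ∀ k : ℕ, Finset.Icc 1 k = Finset.Ioc 0 k := fun k => by
      ext; simp [Nat.succ_le_iff]
    rw [hIcc, hIcc]
    exact (Finset.sum_Ioc_consecutive _ (Nat.zero_le _) (Nat.floor_mono hab)).symm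
  rw [hu]
  calc ‖∑ n ∈ Finset.Ioc ⌊a⌋₊ ⌊b⌋₊, (vonMangoldt n : ℂ) * ψ n / n‖
      ≤ ∑ n ∈ Finset.Ioc ⌊a⌋₊ ⌊b⌋₊, Real.log b * (1 / n : ℝ) := by
        refine norm_sum_le_of_le _ fun n hn => ?_
        rw [Finset.mem_Ioc] at hn
        have hn0 : (0 : ℝ) < n := by exact_mod_cast (Nat.zero_le _).trans_lt hn.1
        rw [norm_div, norm_mul, Complex.norm_natCast, Complex.norm_real,
          Real.norm_of_nonneg vonMangoldt_nonneg, mul_one_div]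
        gcongr
        calc vonMangoldt n * ‖ψ n‖ ≤ Real.log n * 1 := by
              exact mul_le_mul vonMangoldt_le_log (ψ.norm_le_one _) (norm_nonneg _)
                (Real.log_natCast_nonneg n)
          _ ≤ Real.log b := by
              rw [mul_one]
              gcongr
              exact (Nat.le_floor_iff (by linarith)).1 hn.2
    _ = Real.log b * ∑ n ∈ Finset.Ioc ⌊a⌋₊ ⌊b⌋₊, (1 / n : ℝ) := by rw [Finset.mul_sum]
    _ ≤ _ := by
      gcongr
      · exact Real.log_nonneg hb
      · exact sum_Ioc_inv_le ha hab

end MertensSum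

section MertensAsymptotic

open MeasureTheory Filter Topology Set Asymptotics FourierTransform
open DirichletCharacter ArithmeticFunction

lemma mertensSum_one {N : ℕ} (ψ : DirichletCharacter ℂ N) : mertensSum ψ 1 = 0 := by
  simp [mertensSum]

lemma norm_mertensSum_le {N : ℕ} (ψ : DirichletCharacter ℂ N) {t : ℝ} (ht : 1 ≤ t) :
    ‖mertensSum ψ t‖ ≤ 1 * (1 + Real.log t) ^ 4 := by
  have h := norm_mertensSum_sub_le ψ le_rfl ht
  rw [mertensSum_one, sub_zero, div_one, div_one] at h
  have hl := Real.log_nonneg ht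
  refine h.trans ?_
  calc Real.log t * (1 + Real.log t) ≤ (1 + Real.log t) ^ 2 := by nlinarith
    _ ≤ (1 + Real.log t) ^ 4 := pow_le_pow_right₀ (by linarith) (by norm_num)
    _ = _ := (one_mul _).symm

variable {N : ℕ} [NeZero N] (ψ : DirichletCharacter ℂ N)

/-- The error term in the asymptotics of `mertensSum ψ (exp u)`, extended by zero to `u < 0`. -/
noncomputable def mertensError (u : ℝ) : ℂ :=
  if u < 0 then 0 else mertensSum ψ (Real.exp u) - poleOrder ψ * u - regularLogDeriv ψ 1

lemma mertensError_of_neg {u : ℝ} (hu : u < 0) : mertensError ψ u = 0 := if_pos hu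

lemma mertensError_of_nonneg {u : ℝ} (hu : 0 ≤ u) : mertensError ψ u =
    mertensSum ψ (Real.exp u) - poleOrder ψ * u - regularLogDeriv ψ 1 := if_neg hu.not_gt

lemma measurable_mertensError : Measurable (mertensError ψ) := by
  refine Measurable.ite measurableSet_Iio measurable_const ?_
  exact (((measurable_mertensSum ψ).comp Real.measurable_exp).sub
    (measurable_const.mul Complex.measurable_ofReal)).sub measurable_const

lemma poleOrder_le_one : poleOrder ψ ≤ 1 := by
  unfold poleOrder; split_ifs <;> simp

lemma norm_mertensError_sub_le {u u' : ℝ} (hu : 0 ≤ u) (huu' : u ≤ u') :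
    ‖mertensError ψ u' - mertensError ψ u‖ ≤ (1 + u') * (u' - u + Real.exp (-u)) := by
  have h1 := norm_mertensSum_sub_le ψ (Real.one_le_exp hu) (Real.exp_le_exp.2 huu')
  rw [← Real.exp_sub, Real.log_exp, Real.log_exp, one_div, ← Real.exp_neg] at h1
  rw [mertensError_of_nonneg ψ hu, mertensError_of_nonneg ψ (hu.trans huu')]
  have h2 : ‖(poleOrder ψ : ℂ) * ((u' - u : ℝ) : ℂ)‖ ≤ 1 * (u' - u) := by
    rw [norm_mul, Complex.norm_natCast, Complex.norm_real, Real.norm_of_nonneg (by linarith)]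
    exact mul_le_mul_of_nonneg_right (by exact_mod_cast poleOrder_le_one ψ) (by linarith)
  have h3 := Real.exp_pos (-u)
  calc _ = ‖(mertensSum ψ (Real.exp u') - mertensSum ψ (Real.exp u)) -
        (poleOrder ψ : ℂ) * ((u' - u : ℝ) : ℂ)‖ := by congr 1; push_cast; ring
    _ ≤ _ := norm_sub_le _ _
    _ ≤ u' * (Real.exp (-u) + (u' - u)) + 1 * (u' - u) := add_le_add h1 h2
    _ ≤ _ := by nlinarith

lemma norm_mertensError_zero : ‖mertensError ψ 0‖ ≤ 1 + ‖regularLogDeriv ψ 1‖ := by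
  rw [mertensError_of_nonneg ψ le_rfl, Real.exp_zero, mertensSum_one]
  simp

lemma norm_mertensError_sub_le' {u u' : ℝ} (hu : 0 ≤ u) (huu' : u ≤ u') :
    ‖mertensError ψ u' - mertensError ψ u‖ ≤
      (1 + ‖regularLogDeriv ψ 1‖) * (1 + u') * (u' - u + Real.exp (-u)) := by
  refine (norm_mertensError_sub_le ψ hu huu').trans ?_
  rw [mul_assoc]
  have h3 := Real.exp_pos (-u)
  exact le_mul_of_one_le_left (by apply mul_nonneg <;> linarith)
    (le_add_of_nonneg_right (norm_nonneg _))

lemma norm_mertensError_le {u : ℝ} (hu : 0 ≤ u) :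
    ‖mertensError ψ u‖ ≤ 2 * (1 + ‖regularLogDeriv ψ 1‖) * (1 + u) ^ 2 :=
  norm_le_of_increment_bound (by positivity)
    (fun _ _ h h' => norm_mertensError_sub_le' ψ h h') (norm_mertensError_zero ψ) hu

lemma LSeries_vonMangoldt_div {z : ℂ} (hz : 0 < z.re) :
    LSeriesSummable (fun n => (vonMangoldt n : ℂ) * ψ n / n) z ∧
      LSeries (fun n => (vonMangoldt n : ℂ) * ψ n / n) z =
        -(deriv (LFunction ψ) (1 + z) / LFunction ψ (1 + z)) := by
  have hs : 1 < (1 + z).re := by simpa using hz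
  have hterm : LSeries.term (fun n => (vonMangoldt n : ℂ) * ψ n / n) z =
      LSeries.term ((fun n : ℕ => ψ n) * fun n : ℕ => (vonMangoldt n : ℂ)) (1 + z) := by
    funext n
    rcases eq_or_ne n 0 with rfl | hn
    · simp
    · rw [LSeries.term_of_ne_zero hn, LSeries.term_of_ne_zero hn,
        Complex.cpow_add _ _ (by exact_mod_cast hn), Complex.cpow_one, Pi.mul_apply, div_div,
        mul_comm (ψ n)]
  refine ⟨?_, ?_⟩
  · have := LSeriesSummable_twist_vonMangoldt ψ hs
    rw [LSeriesSummable, ← hterm] at this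
    exact this
  · rw [deriv_LFunction_eq_deriv_LSeries ψ hs, LFunction_eq_LSeries ψ hs, ← neg_div,
      ← LSeries_twist_vonMangoldt_eq ψ hs, LSeries, LSeries, hterm]

lemma dslope_regularLogDeriv_eq_mellin {z : ℂ} (hz : 0 < z.re) :
    dslope (regularLogDeriv ψ) 1 (1 + z) = mellin (fun t => mertensError ψ (Real.log t)) (-z) := by
  have hz0 : z ≠ 0 := fun h => by simp [h] at hz
  set C : ℝ := 2 * (1 + ‖regularLogDeriv ψ 1‖) with hC
  have hC0 : 0 ≤ C := by positivity
  have hconv : MellinConvergent (fun t => mertensError ψ (Real.log t)) (-z) := by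
    have h := comp_log_isBigO_zero (fun u hu => mertensError_of_neg ψ hu) (fun _ => 1) (-z.re - 1)
    simp only [one_smul] at h
    refine mellinConvergent_of_isBigO_rpow (a := z.re / 2 - z.re) (b := -z.re - 1)
      (comp_log_locallyIntegrableOn hC0 (measurable_mertensError ψ)
        (fun u hu => mertensError_of_neg ψ hu) fun u hu => norm_mertensError_le ψ hu) ?_
      (by simp; linarith) h (by simp)
    rw [show -(z.re / 2 - z.re) = z.re / 2 by ring]
    refine isBigO_rpow_of_norm_le_log_pow (C := C) (fun t ht => ?_) (by linarith)
    have hl := Real.log_nonneg ht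
    refine (norm_mertensError_le ψ hl).trans ?_
    gcongr
    · linarith
    · norm_num
  have hm : mellin (fun t => mertensError ψ (Real.log t)) (-z) =
      ∫ t in Ioi (1 : ℝ), (t : ℂ) ^ (-z - 1) * mertensError ψ (Real.log t) := by
    rw [← integral_Ici_eq_integral_Ioi, mellin]
    refine (setIntegral_eq_of_subset_of_forall_sdiff_eq_zero measurableSet_Ioi
      (fun t (ht : 1 ≤ t) => show 0 < t by linarith) fun t ht => ?_)
    rw [mertensError_of_neg ψ (Real.log_neg ht.1 (not_le.1 ht.2)), smul_zero]
  have hi0 : IntegrableOn (fun t : ℝ => (t : ℂ) ^ (-z - 1) * mertensError ψ (Real.log t))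
      (Ioi 1) := IntegrableOn.mono_set hconv (Ioi_subset_Ioi zero_le_one)
  obtain ⟨hi1, h1⟩ := integral_Ioi_one_log_mul_cpow hz
  obtain ⟨hi2, h2⟩ := integral_Ioi_one_cpow hz
  have hi1' : IntegrableOn (fun t : ℝ => (poleOrder ψ : ℂ) * ((t : ℂ) ^ (-z - 1) * Real.log t))
      (Ioi 1) := hi1.const_mul _
  have hi2' : IntegrableOn (fun t : ℝ => regularLogDeriv ψ 1 * (t : ℂ) ^ (-z - 1)) (Ioi 1) :=
    hi2.const_mul _
  have hi01 : IntegrableOn (fun t : ℝ => (t : ℂ) ^ (-z - 1) * mertensError ψ (Real.log t) +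
      (poleOrder ψ : ℂ) * ((t : ℂ) ^ (-z - 1) * Real.log t)) (Ioi 1) := hi0.add hi1'
  obtain ⟨hS, hL⟩ := LSeries_vonMangoldt_div ψ hz
  have hO : (fun n : ℕ => ∑ k ∈ Finset.Icc 1 n, (vonMangoldt k : ℂ) * ψ k / k) =O[atTop]
      fun n : ℕ => (n : ℝ) ^ (z.re / 2) := by
    have h := (isBigO_rpow_of_norm_le_log_pow (fun t ht => norm_mertensSum_le ψ ht)
      (r := z.re / 2) (by linarith)).comp_tendsto tendsto_natCast_atTop_atTop
    refine h.congr_left fun n => ?_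
    simp [mertensSum]
  have hint := LSeries_eq_mul_integral _ (by linarith) (by linarith : z.re / 2 < z.re) hS hO
  have hsplit : ∫ t in Ioi (1 : ℝ),
      (∑ k ∈ Finset.Icc 1 ⌊t⌋₊, (vonMangoldt k : ℂ) * ψ k / k) * (t : ℂ) ^ (-(z + 1)) =
      mellin (fun t => mertensError ψ (Real.log t)) (-z) + poleOrder ψ * (1 / z ^ 2) +
        regularLogDeriv ψ 1 * (1 / z) := by
    rw [hm, ← h1, ← h2, ← integral_const_mul, ← integral_const_mul, ← integral_add hi0 hi1',
      ← integral_add hi01 hi2']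
    refine setIntegral_congr_fun measurableSet_Ioi fun t ht => ?_
    have ht0 : (0 : ℝ) < t := lt_trans one_pos ht
    rw [mertensError_of_nonneg ψ (Real.log_nonneg (le_of_lt ht)), Real.exp_log ht0,
      show -(z + 1) = -z - 1 by ring, mertensSum]
    ring
  have hne : (1 : ℂ) + z ≠ 1 := by simpa using hz0
  have hLne : LFunction ψ (1 + z) ≠ 0 :=
    LFunction_ne_zero_of_one_le_re ψ (Or.inr hne) (by simpa using hz.le)
  rw [dslope_of_ne _ hne, slope_def_field, regularLogDeriv_eq ψ hLne hne, ← hL, hint, hsplit]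
  field_simp
  ring

theorem exists_norm_mertensSum_sub_le :
    ∃ C : ℝ, 0 < C ∧ ∀ y : ℝ, Real.exp 1 ≤ y →
      ‖mertensSum ψ y - (poleOrder ψ * Real.log y + regularLogDeriv ψ 1)‖ ≤ C / Real.log y := by
  obtain ⟨B, hB0, hB⟩ := exists_norm_iteratedDeriv_dslope_le ψ
  have hneg : ∀ u < 0, mertensError ψ u = 0 := fun u hu => mertensError_of_neg ψ hu
  have hle : ∀ u, 0 ≤ u → ‖mertensError ψ u‖ ≤ 2 * (1 + ‖regularLogDeriv ψ 1‖) * (1 + u) ^ 2 :=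
    fun u hu => norm_mertensError_le ψ hu
  obtain ⟨C, hC0, hC⟩ := exists_norm_le_div_of_fourier_bound (D := mertensError ψ) (B := B)
    (C := 1 + ‖regularLogDeriv ψ 1‖) (by positivity) hB0 hneg
    (fun _ _ h h' => norm_mertensError_sub_le' ψ h h') (norm_mertensError_zero ψ)
    (fun σ hσ => integrable_sq_mul_exp_smul (by positivity) (measurable_mertensError ψ) hneg hle hσ)
    (by
      intro σ hσ hσ1 ξ hξ
      set z : ℂ := ⟨σ, 2 * Real.pi * ξ⟩ with hz
      have hzre : z.re = σ := rfl
      have hzim : z.im = 2 * Real.pi * ξ := rfl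
      have h := iteratedDeriv_two_eq_fourier (by positivity) (measurable_mertensError ψ) hneg hle
        (g := dslope (regularLogDeriv ψ) 1)
        (fun z hz => dslope_regularLogDeriv_eq_mellin ψ hz) (z := z) (by rw [hzre]; exact hσ)
      have hpi := Real.pi_pos
      rw [hzre, hzim, mul_div_cancel_left₀ _ (by positivity)] at h
      rw [← h]
      have h1 := hB (1 + z) (by simp [hzre, hσ.le]) (by simp [hzre]; linarith)
        (by simp [hzim, hξ, hpi.ne'])
      refine h1.trans ?_
      have h2 : |ξ| ≤ |(1 + z).im| := by
        have : (1 + z).im = 2 * Real.pi * ξ := by simp [hzim]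
        rw [this, abs_mul]
        refine le_mul_of_one_le_left (abs_nonneg _) ?_
        rw [abs_of_pos (by positivity)]
        linarith [Real.pi_gt_three]
      have h3 : 0 < |ξ| := abs_pos.2 hξ
      exact mul_le_mul_of_nonneg_left
        (Real.rpow_le_rpow_of_nonpos h3 h2 (by norm_num)) hB0)
  refine ⟨C, hC0, fun y hy => ?_⟩
  have hy0 : 0 < y := (Real.exp_pos 1).trans_le hy
  have hly : 1 ≤ Real.log y := (Real.le_log_iff_exp_le hy0).2 hy
  have h := hC (Real.log y) hly
  rw [mertensError_of_nonneg ψ (by linarith), Real.exp_log hy0] at h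
  rwa [← sub_sub]

end MertensAsymptotic

section PrimePowerSums

open ArithmeticFunction

lemma vonMangoldt_prime_pow {p k : ℕ} (hp : p.Prime) :
    vonMangoldt (p ^ (k + 1)) = Real.log p := by
  rw [vonMangoldt_apply_pow k.succ_ne_zero, vonMangoldt_apply_prime hp]

lemma exists_prime_pow_of_vonMangoldt_ne_zero {n : ℕ} (hn : vonMangoldt n ≠ 0) :
    ∃ p k : ℕ, p.Prime ∧ n = p ^ (k + 1) := by
  obtain ⟨p, k, hp, hk, rfl⟩ := (isPrimePow_nat_iff n).1 (vonMangoldt_ne_zero_iff.1 hn)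
  exact ⟨p, k - 1, hp, by rw [Nat.sub_add_cancel hk]⟩

lemma summable_log_sq_div_sq : Summable fun n : ℕ => Real.log n ^ 2 / (n : ℝ) ^ 2 := by
  have h : Summable fun n : ℕ => 16 * (n : ℝ) ^ (-(3 / 2) : ℝ) :=
    (Real.summable_nat_rpow.2 (by norm_num)).mul_left 16
  refine h.of_nonneg_of_le (fun n => by positivity) fun n => ?_
  rcases Nat.eq_zero_or_pos n with rfl | hn
  · simp
  · have hn0 : (0 : ℝ) < n := by exact_mod_cast hn
    have h1 : Real.log n ≤ 4 * (n : ℝ) ^ (1 / 4 : ℝ) := by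
      have := Real.log_le_rpow_div hn0.le (ε := 1 / 4) (by norm_num)
      linarith
    have h2 : 0 ≤ Real.log n := Real.log_natCast_nonneg n
    rw [div_le_iff₀ (by positivity)]
    calc Real.log n ^ 2 ≤ (4 * (n : ℝ) ^ (1 / 4 : ℝ)) ^ 2 := by gcongr
      _ = 16 * (n : ℝ) ^ (1 / 2 : ℝ) := by
        rw [mul_pow, ← Real.rpow_natCast ((n : ℝ) ^ (1 / 4 : ℝ)), ← Real.rpow_mul hn0.le]
        norm_num
      _ = 16 * (n : ℝ) ^ (-(3 / 2) : ℝ) * (n : ℝ) ^ 2 := by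
        rw [← Real.rpow_natCast (n : ℝ) 2, mul_assoc, ← Real.rpow_add hn0]
        norm_num

lemma summable_nonprime_vonMangoldt_mul_log_div :
    Summable fun n : ℕ => if n.Prime then 0 else vonMangoldt n * Real.log n / n := by
  set i : Nat.Primes × ℕ → ℕ := fun x => (x.1 : ℕ) ^ (x.2 + 1 + 1) with hi
  have hinj : Function.Injective i := by
    intro x y hxy
    have h : Nat.Primes.prodNatEquiv (x.1, x.2 + 1) = Nat.Primes.prodNatEquiv (y.1, y.2 + 1) :=
      Subtype.ext (by simpa [Nat.Primes.coe_prodNatEquiv_apply] using hxy)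
    have := Nat.Primes.prodNatEquiv.injective h
    simp only [Prod.mk.injEq, add_left_inj] at this
    exact Prod.ext this.1 this.2
  refine (hinj.summable_iff fun n hn => ?_).1 ?_
  · split_ifs with hp
    · rfl
    · by_contra h
      have hΛ : vonMangoldt n ≠ 0 := fun h' => h (by simp [h'])
      obtain ⟨p, k, hpp, rfl⟩ := exists_prime_pow_of_vonMangoldt_ne_zero hΛ
      rcases k with _ | k
      · exact hp (by simpa using hpp)
      · exact hn ⟨(⟨p, hpp⟩, k), rfl⟩
  · have h1 : Summable fun p : Nat.Primes => Real.log (p : ℕ) ^ 2 / ((p : ℕ) : ℝ) ^ 2 :=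
      summable_log_sq_div_sq.comp_injective Subtype.val_injective
    have h2 : Summable fun k : ℕ => ((k : ℝ) + 2) * (1 / 2) ^ k := by
      have ha := summable_pow_mul_geometric_of_norm_lt_one (R := ℝ) 1 (r := 1 / 2) (by norm_num)
      have hb := (summable_geometric_of_lt_one (r := (1 / 2 : ℝ)) (by norm_num)
        (by norm_num)).mul_left 2
      refine (ha.add hb).congr fun k => ?_
      ring
    refine (h1.mul_of_nonneg h2 (fun p => by positivity) (fun k => by positivity)).of_nonneg_of_le
      (fun x => ?_) fun x => ?_
    · simp only [Function.comp]
      split_ifs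
      · exact le_rfl
      · exact div_nonneg (mul_nonneg vonMangoldt_nonneg (Real.log_natCast_nonneg _))
          (Nat.cast_nonneg _)
    · obtain ⟨⟨p, hp⟩, k⟩ := x
      simp only [Function.comp, hi]
      rw [if_neg (Nat.Prime.not_prime_pow (by omega)), vonMangoldt_prime_pow hp]
      have hp2 : (2 : ℝ) ≤ p := by exact_mod_cast hp.two_le
      have hp0 : (0 : ℝ) < p := by linarith
      push_cast
      rw [Real.log_pow]
      push_cast
      rw [pow_succ, pow_succ, one_div_pow]
      have h4 : (2 : ℝ) ^ k ≤ (p : ℝ) ^ k := by gcongr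
      calc _ = Real.log p ^ 2 * ((k : ℝ) + 2) / ((p : ℝ) ^ 2 * (p : ℝ) ^ k) := by ring
        _ ≤ Real.log p ^ 2 * ((k : ℝ) + 2) / ((p : ℝ) ^ 2 * 2 ^ k) := by gcongr
        _ = _ := by ring

/-- The terms `Λ(n) log n / n` with `n` not a prime coprime to `q`. -/
noncomputable def exceptionalTerm (q n : ℕ) : ℝ :=
  if n.Prime ∧ ¬n ∣ q then 0 else vonMangoldt n * Real.log n / n

lemma exceptionalTerm_nonneg (q n : ℕ) : 0 ≤ exceptionalTerm q n := by
  unfold exceptionalTerm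
  split_ifs
  · exact le_rfl
  · exact div_nonneg (mul_nonneg vonMangoldt_nonneg (Real.log_natCast_nonneg _))
      (Nat.cast_nonneg _)

lemma summable_exceptionalTerm (q : ℕ) [NeZero q] : Summable (exceptionalTerm q) := by
  have h : Summable fun n : ℕ => if n ∣ q then vonMangoldt n * Real.log n / n else 0 := by
    refine summable_of_ne_finset_zero (s := q.divisors) fun n hn => if_neg fun h => hn ?_
    exact Nat.mem_divisors.2 ⟨h, NeZero.ne q⟩
  refine (summable_nonprime_vonMangoldt_mul_log_div.add h).of_nonneg_of_le
    (exceptionalTerm_nonneg q) fun n => ?_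
  have h0 : 0 ≤ vonMangoldt n * Real.log n / n :=
    div_nonneg (mul_nonneg vonMangoldt_nonneg (Real.log_natCast_nonneg _)) (Nat.cast_nonneg _)
  unfold exceptionalTerm
  by_cases h1 : n.Prime <;> by_cases h2 : n ∣ q <;> simp [h1, h2, h0]

variable {q : ℕ} (ψ : DirichletCharacter ℂ q)

/-- The completely multiplicative function with value `-1` at primes dividing `q` and `-ψ(p)` at
all other primes `p`. -/
noncomputable def negTwist (n : ℕ) : ℂ :=
  n.factorization.prod fun p k => (if p ∣ q then -1 else -ψ p) ^ k

lemma negTwist_prime_pow {p : ℕ} (hp : p.Prime) (k : ℕ) :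
    negTwist ψ (p ^ k) = (if p ∣ q then -1 else -ψ p) ^ k := by
  rw [negTwist, hp.factorization_pow]
  exact Finsupp.prod_single_index (h := fun p k => (if p ∣ q then -1 else -ψ p : ℂ) ^ k)
    (pow_zero _)

lemma negTwist_prime {p : ℕ} (hp : p.Prime) :
    negTwist ψ p = if p ∣ q then -1 else -ψ p := by
  simpa using negTwist_prime_pow ψ hp 1

lemma norm_neg_twist_le (p : ℕ) : ‖(if p ∣ q then -1 else -ψ p : ℂ)‖ ≤ 1 := by
  split_ifs
  · simp
  · rw [norm_neg]; exact ψ.norm_le_one _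

lemma norm_vonMangoldt_mul_negTwist_add_le (n : ℕ) :
    ‖(vonMangoldt n : ℂ) * (negTwist ψ n + ψ n) / n‖ ≤ 2 / Real.log 2 * exceptionalTerm q n := by
  have hlog2 : 0 < Real.log 2 := Real.log_pos one_lt_two
  by_cases hΛ : vonMangoldt n = 0
  · rw [hΛ]
    simpa using mul_nonneg (by positivity) (exceptionalTerm_nonneg q n)
  obtain ⟨p, k, hp, hpk⟩ := exists_prime_pow_of_vonMangoldt_ne_zero hΛ
  by_cases h : n.Prime ∧ ¬n ∣ q
  · rw [negTwist_prime ψ h.1, if_neg h.2, neg_add_cancel]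
    simpa using mul_nonneg (by positivity) (exceptionalTerm_nonneg q n)
  · have h1 : ‖negTwist ψ n + ψ n‖ ≤ 2 := by
      refine (norm_add_le _ _).trans ?_
      have ha : ‖negTwist ψ n‖ ≤ 1 := by
        rw [hpk, negTwist_prime_pow ψ hp, norm_pow]
        exact pow_le_one₀ (norm_nonneg _) (norm_neg_twist_le ψ p)
      linarith [ψ.norm_le_one n]
    have h2 : (2 : ℝ) ≤ n := by
      have : p ≤ n := by rw [hpk]; exact Nat.le_self_pow k.succ_ne_zero p
      exact_mod_cast hp.two_le.trans this
    have h3 : Real.log 2 ≤ Real.log n := Real.log_le_log two_pos h2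
    rw [exceptionalTerm, if_neg h, norm_div, norm_mul, Complex.norm_natCast, Complex.norm_real,
      Real.norm_of_nonneg vonMangoldt_nonneg, mul_div_assoc']
    have hΛ0 : 0 ≤ vonMangoldt n := vonMangoldt_nonneg
    refine div_le_div_of_nonneg_right ?_ (Nat.cast_nonneg n)
    rw [div_mul_eq_mul_div, le_div_iff₀ hlog2]
    calc vonMangoldt n * ‖negTwist ψ n + ψ n‖ * Real.log 2
        ≤ vonMangoldt n * 2 * Real.log n := by gcongr
      _ = _ := by ring

lemma summable_vonMangoldt_mul_negTwist_add [NeZero q] :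
    Summable fun n : ℕ => (vonMangoldt n : ℂ) * (negTwist ψ n + ψ n) / n :=
  ((summable_exceptionalTerm q).mul_left _).of_norm_bounded
    (norm_vonMangoldt_mul_negTwist_add_le ψ)

lemma hasSum_primes_dvd [NeZero q] (g : ℕ → ℂ) :
    HasSum (fun p : Nat.Primes => if (p : ℕ) ∣ q then g p else 0) (∑ p ∈ q.primeFactors, g p) := by
  refine (hasSum_subtype_iff_indicator (s := {p : ℕ | p.Prime})
    (f := fun n : ℕ => if n ∣ q then g n else 0)).2 ?_
  have h : ∑ p ∈ q.primeFactors, g p = ∑ p ∈ q.primeFactors,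
      ({p : ℕ | p.Prime}.indicator fun n : ℕ => if n ∣ q then g n else 0) p := by
    refine Finset.sum_congr rfl fun p hp => ?_
    rw [Set.indicator_of_mem (show p ∈ {p : ℕ | p.Prime} from Nat.prime_of_mem_primeFactors hp),
      if_pos (Nat.dvd_of_mem_primeFactors hp)]
  rw [h]
  refine hasSum_sum_of_ne_finset_zero fun p hp => ?_
  by_cases h1 : p ∈ {p : ℕ | p.Prime}
  · rw [Set.indicator_of_mem h1, if_neg fun h2 => hp ?_]
    exact Nat.mem_primeFactors.2 ⟨h1, h2, NeZero.ne q⟩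
  · exact Set.indicator_of_notMem h1 _

lemma hasSum_pow_succ_div {p : ℕ} (hp : p.Prime) {z : ℂ} (hz : ‖z‖ ≤ 1) :
    HasSum (fun k : ℕ => z ^ (k + 1) / (p : ℂ) ^ (k + 1)) (z / (p - z)) := by
  have hp1 : (1 : ℝ) < p := by exact_mod_cast hp.one_lt
  have hp0 : (p : ℂ) ≠ 0 := by exact_mod_cast hp.ne_zero
  have hlt : ‖z / p‖ < 1 := by
    rw [norm_div, Complex.norm_natCast, div_lt_one (by linarith)]
    linarith
  have hne : (p : ℂ) - z ≠ 0 := by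
    intro h
    rw [sub_eq_zero] at h
    rw [← h, Complex.norm_natCast] at hz
    linarith
  have h := (hasSum_geometric_of_norm_lt_one hlt).mul_left (z / p)
  have h1 : z / p * (1 - z / p)⁻¹ = z / (p - z) := by
    have : 1 - z / p = (p - z) / p := by field_simp
    rw [this, inv_div]
    field_simp
  rw [h1] at h
  refine h.congr_fun fun k => ?_
  rw [div_pow]
  field_simp
  ring

theorem tsum_vonMangoldt_mul_negTwist_add [NeZero q] :
    ∑' n : ℕ, (vonMangoldt n : ℂ) * (negTwist ψ n + ψ n) / n =
      2 * (∑' p : Nat.Primes, ψ ((p : ℕ) : ZMod q) ^ 2 * (Real.log (p : ℕ) : ℂ) /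
        (((p : ℕ) : ℂ) ^ 2 - ψ ((p : ℕ) : ZMod q) ^ 2)) -
      ∑ p ∈ q.primeFactors, ((Real.log p / ((p : ℝ) + 1) : ℝ) : ℂ) := by
  set f : ℕ → ℂ := fun n => (vonMangoldt n : ℂ) * (negTwist ψ n + ψ n) / n with hf
  have hs : Summable f := summable_vonMangoldt_mul_negTwist_add ψ
  have hsupp : Function.support f ⊆ {n | IsPrimePow n} := fun n hn => by
    refine vonMangoldt_ne_zero_iff.1 fun h => hn ?_
    simp [hf, h]
  rw [tsum_eq_tsum_primes_of_support_subset_prime_powers hs hsupp]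
  have hin : ∀ p : Nat.Primes, ∑' k : ℕ, f ((p : ℕ) ^ (k + 1)) =
      2 * (ψ ((p : ℕ) : ZMod q) ^ 2 * (Real.log (p : ℕ) : ℂ) /
        (((p : ℕ) : ℂ) ^ 2 - ψ ((p : ℕ) : ZMod q) ^ 2)) -
      if (p : ℕ) ∣ q then ((Real.log (p : ℕ) / (((p : ℕ) : ℝ) + 1) : ℝ) : ℂ) else 0 := by
    rintro ⟨p, hp⟩
    simp only
    have hp1 : (1 : ℝ) < p := by exact_mod_cast hp.one_lt
    set β : ℂ := if p ∣ q then -1 else -ψ p with hβ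
    have h1 := ((hasSum_pow_succ_div hp (norm_neg_twist_le ψ p)).add
      (hasSum_pow_succ_div hp (ψ.norm_le_one p))).mul_left (Real.log p : ℂ)
    have h2 : ∀ k : ℕ, f (p ^ (k + 1)) = (Real.log p : ℂ) *
        (β ^ (k + 1) / (p : ℂ) ^ (k + 1) + ψ p ^ (k + 1) / (p : ℂ) ^ (k + 1)) := fun k => by
      simp only [hf]
      rw [vonMangoldt_prime_pow hp, negTwist_prime_pow ψ hp]
      push_cast
      rw [map_pow]
      ring
    rw [(h1.congr_fun h2).tsum_eq]
    by_cases hpq : p ∣ q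
    · have hψ : ψ p = 0 := by
        refine ψ.map_nonunit fun hu => ?_
        rw [ZMod.isUnit_prime_iff_not_dvd hp] at hu
        exact hu hpq
      rw [if_pos hpq, if_pos hpq, hψ]
      push_cast
      simp
      ring
    · have hne : ∀ z : ℂ, ‖z‖ ≤ 1 → (p : ℂ) - z ≠ 0 := fun z hz h => by
        rw [sub_eq_zero] at h
        rw [← h, Complex.norm_natCast] at hz
        linarith
      have ha := hne (ψ p) (ψ.norm_le_one p)
      have hb := hne (-ψ p) (by rw [norm_neg]; exact ψ.norm_le_one p)
      have hc : (p : ℂ) ^ 2 - ψ p ^ 2 ≠ 0 := by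
        rw [show (p : ℂ) ^ 2 - ψ p ^ 2 = (p - ψ p) * (p - -ψ p) by ring]
        exact mul_ne_zero ha hb
      rw [if_neg hpq, if_neg hpq, sub_zero]
      field_simp
      ring
  have hprod : Summable fun p : Nat.Primes => ∑' k : ℕ, f ((p : ℕ) ^ (k + 1)) := by
    have := hs.comp_injective (i := fun x : Nat.Primes × ℕ => (x.1 : ℕ) ^ (x.2 + 1))
      (Subtype.val_injective.comp Nat.Primes.prodNatEquiv.injective)
    exact this.prod
  have hfin := hasSum_primes_dvd (q := q) fun p => ((Real.log p / ((p : ℝ) + 1) : ℝ) : ℂ)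
  simp_rw [hin] at hprod ⊢
  have hA : Summable fun p : Nat.Primes => 2 * (ψ ((p : ℕ) : ZMod q) ^ 2 * (Real.log (p : ℕ) : ℂ) /
        (((p : ℕ) : ℂ) ^ 2 - ψ ((p : ℕ) : ZMod q) ^ 2)) := by
    refine (hprod.add hfin.summable).congr fun p => ?_
    ring
  rw [hA.tsum_sub hfin.summable, hfin.tsum_eq, tsum_mul_left]

end PrimePowerSums

section ExponentialSumZero

open Metric Filter Topology

lemma norm_exp_sub_exp_sub_le {a b : ℂ} {M : ℝ} (hM : M ≤ 1) (ha : ‖a‖ ≤ M) (hb : ‖b‖ ≤ M) :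
    ‖Complex.exp a - Complex.exp b - (a - b)‖ ≤ 2 * M * ‖a - b‖ := by
  have hd : ∀ z : ℂ, HasDerivAt (fun z => Complex.exp z - z) (Complex.exp z - 1) z := fun z =>
    (Complex.hasDerivAt_exp z).sub (hasDerivAt_id z)
  have h := (convex_closedBall (0 : ℂ) M).norm_image_sub_le_of_norm_deriv_le (𝕜 := ℂ)
    (f := fun z => Complex.exp z - z) (C := 2 * M) (fun z _ => (hd z).differentiableAt)
    (fun z hz => by
      rw [mem_closedBall_zero_iff] at hz
      rw [(hd z).deriv]
      exact (Complex.norm_exp_sub_one_le (hz.trans hM)).trans (by gcongr))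
    (mem_closedBall_zero_iff.2 hb) (mem_closedBall_zero_iff.2 ha)
  rwa [show Complex.exp a - Complex.exp b - (a - b) =
    Complex.exp a - a - (Complex.exp b - b) by ring]

lemma norm_expSum_sub_le {s : Finset ℕ} {c : ℕ → ℂ} {l : ℕ → ℝ} {L K A : ℝ} (hL : 0 < L)
    (hAL : A ≤ L) (hA : 0 ≤ A) (hl : ∀ n ∈ s, 0 ≤ l n ∧ l n ≤ L) (hc : ∑ n ∈ s, ‖c n‖ ≤ K * L)
    {w w' : ℂ} (hw : ‖w‖ ≤ A / L ^ 2) (hw' : ‖w'‖ ≤ A / L ^ 2) :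
    ‖∑ n ∈ s, c n * Complex.exp (-w * l n) - ∑ n ∈ s, c n * Complex.exp (-w' * l n) +
      (w - w') * ∑ n ∈ s, c n * l n‖ ≤ 2 * A * K * L * ‖w - w'‖ := by
  have hb : ∀ v : ℂ, ‖v‖ ≤ A / L ^ 2 → ∀ n ∈ s, ‖-v * l n‖ ≤ A / L := fun v hv n hn => by
    obtain ⟨h0, h1⟩ := hl n hn
    rw [norm_mul, norm_neg, Complex.norm_real, Real.norm_of_nonneg h0]
    calc ‖v‖ * l n ≤ A / L ^ 2 * L := by gcongr
      _ = A / L := by field_simp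
  rw [Finset.mul_sum, ← Finset.sum_sub_distrib, ← Finset.sum_add_distrib]
  calc _ ≤ ∑ n ∈ s, ‖c n‖ * (2 * A * ‖w - w'‖) := by
        refine norm_sum_le_of_le _ fun n hn => ?_
        obtain ⟨h0, h1⟩ := hl n hn
        have h := norm_exp_sub_exp_sub_le (M := A / L) ((div_le_one hL).2 hAL) (hb w hw n hn)
          (hb w' hw' n hn)
        rw [show c n * Complex.exp (-w * l n) - c n * Complex.exp (-w' * l n) +
          (w - w') * (c n * l n) = c n * (Complex.exp (-w * l n) - Complex.exp (-w' * l n) -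
          (-w * l n - -w' * l n)) by ring, norm_mul]
        gcongr
        refine h.trans ?_
        rw [show -w * l n - -w' * l n = -(w - w') * l n by ring, norm_mul, norm_neg,
          Complex.norm_real, Real.norm_of_nonneg h0]
        calc 2 * (A / L) * (‖w - w'‖ * l n) ≤ 2 * (A / L) * (‖w - w'‖ * L) := by gcongr
          _ = _ := by field_simp
    _ = (∑ n ∈ s, ‖c n‖) * (2 * A * ‖w - w'‖) := by rw [Finset.sum_mul]
    _ ≤ K * L * (2 * A * ‖w - w'‖) := by gcongr
    _ = _ := by ring

theorem exists_zero_expSum {K κ : ℝ} (hK : 0 < K) (hκ : 0 < κ) (S : ℂ) :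
    ∃ C L₀ : ℝ, 0 < C ∧ ∀ L : ℝ, L₀ ≤ L → ∀ (s : Finset ℕ) (c : ℕ → ℂ) (l : ℕ → ℝ),
      (∀ n ∈ s, 0 ≤ l n ∧ l n ≤ L) → ∑ n ∈ s, ‖c n‖ ≤ K * L →
      ‖∑ n ∈ s, c n - S‖ ≤ K / L → ‖∑ n ∈ s, c n * l n - (κ * L ^ 2 / 2 : ℝ)‖ ≤ K * L →
      ∃ w : ℂ, ∑ n ∈ s, c n * Complex.exp (-w * l n) = 0 ∧
        ‖w - 2 * S / (κ * L ^ 2 : ℝ)‖ ≤ C / L ^ 3 := by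
  set A : ℝ := 2 * ‖S‖ / κ + 1 with hA
  have hA0 : 0 < A := by positivity
  set K' : ℝ := K + A * (K * (1 + 2 * A)) with hK'
  have hK'0 : 0 < K' := by positivity
  set C : ℝ := 8 * K' / κ + 1 with hC
  have hC0 : 0 < C := by positivity
  refine ⟨C, max 1 (max A (max C (4 * (K * (1 + 2 * A)) / κ))), hC0, ?_⟩
  intro L hL s c l hl hc hS hP
  simp only [max_le_iff] at hL
  obtain ⟨hL1, hLA, hLC, hLK⟩ := hL
  have hL0 : 0 < L := by linarith
  set P : ℂ := ∑ n ∈ s, c n * l n with hPdef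
  set f : ℂ → ℂ := fun w => ∑ n ∈ s, c n * Complex.exp (-w * l n) with hf
  set w₀ : ℂ := 2 * S / (κ * L ^ 2 : ℝ) with hw₀
  have hlip : ∀ w w' : ℂ, ‖w‖ ≤ A / L ^ 2 → ‖w'‖ ≤ A / L ^ 2 →
      ‖f w - f w' + (w - w') * P‖ ≤ 2 * A * K * L * ‖w - w'‖ := fun w w' hw hw' =>
    norm_expSum_sub_le hL0 hLA hA0.le hl hc hw hw'
  have hw₀n : ‖w₀‖ = 2 * ‖S‖ / κ / L ^ 2 := by
    rw [hw₀, norm_div, norm_mul, Complex.norm_real, Real.norm_of_nonneg (by positivity)]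
    simp only [Complex.norm_ofNat]
    field_simp
  have hw₀A : ‖w₀‖ ≤ A / L ^ 2 := by
    rw [hw₀n]; gcongr; linarith
  have hPn : κ * L ^ 2 / 2 - K * L ≤ ‖P‖ := by
    have h1 : ‖((κ * L ^ 2 / 2 : ℝ) : ℂ)‖ = κ * L ^ 2 / 2 := by
      rw [Complex.norm_real, Real.norm_of_nonneg (by positivity)]
    have h2 := norm_sub_norm_le ((κ * L ^ 2 / 2 : ℝ) : ℂ) P
    rw [norm_sub_rev, h1] at h2
    linarith
  set r : ℝ := C / L ^ 3 with hr
  have hr0 : 0 < r := by positivity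
  have hrL : r ≤ 1 / L ^ 2 := by
    rw [hr, div_le_div_iff₀ (by positivity) (by positivity)]
    nlinarith [pow_pos hL0 2]
  have hball : ∀ w ∈ closedBall w₀ r, ‖w‖ ≤ A / L ^ 2 := fun w hw => by
    rw [mem_closedBall, dist_eq_norm] at hw
    have h1 := norm_le_norm_add_norm_sub' w w₀
    have h2 : A / L ^ 2 = 2 * ‖S‖ / κ / L ^ 2 + 1 / L ^ 2 := by rw [hA]; ring
    rw [h2, ← hw₀n]
    linarith
  have hlow : ∀ w ∈ closedBall w₀ r, κ * L ^ 2 / 4 * ‖w - w₀‖ ≤ ‖f w - f w₀‖ := fun w hw => by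
    have h1 := hlip w w₀ (hball w hw) hw₀A
    have h2 := norm_sub_le (f w - f w₀ + (w - w₀) * P) (f w - f w₀)
    rw [add_sub_cancel_left, norm_mul] at h2
    have h3 : ‖w - w₀‖ * (κ * L ^ 2 / 2 - K * L) ≤ ‖w - w₀‖ * ‖P‖ := by gcongr
    have h4 : K * (1 + 2 * A) * L ≤ κ * L ^ 2 / 4 := by
      rw [div_le_iff₀ hκ] at hLK
      nlinarith
    nlinarith [norm_nonneg (w - w₀)]
  have hfw₀ : ‖f w₀‖ ≤ K' / L := by
    have h1 := hlip w₀ 0 hw₀A (by rw [norm_zero]; positivity)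
    have h2 : f 0 = ∑ n ∈ s, c n := by simp [hf]
    have hκL : ((κ * L ^ 2 : ℝ) : ℂ) ≠ 0 := by
      rw [Complex.ofReal_ne_zero]; positivity
    have h3 : w₀ * ((κ * L ^ 2 / 2 : ℝ) : ℂ) = S := by
      rw [hw₀, Complex.ofReal_div]
      field_simp
      push_cast
      ring
    rw [sub_zero, h2] at h1
    have h4 : ‖w₀ * (P - (κ * L ^ 2 / 2 : ℝ))‖ ≤ ‖w₀‖ * (K * L) := by
      rw [norm_mul]; gcongr
    have h5 : f w₀ = (f w₀ - ∑ n ∈ s, c n + w₀ * P) + (∑ n ∈ s, c n - S) -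
        w₀ * (P - (κ * L ^ 2 / 2 : ℝ)) := by
      rw [mul_sub, h3]; ring
    rw [h5]
    refine (norm_sub_le _ _).trans ((add_le_add ((norm_add_le _ _).trans (add_le_add h1 hS))
      h4).trans ?_)
    have h6 : (2 * A * K * L + K * L) * ‖w₀‖ ≤ (2 * A * K * L + K * L) * (A / L ^ 2) := by gcongr
    have h7 : (2 * A * K * L + K * L) * (A / L ^ 2) = A * (K * (1 + 2 * A)) / L := by
      field_simp; ring
    rw [hK', add_div]
    linarith
  have hdiff : Differentiable ℂ f := by
    rw [hf]; fun_prop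
  have hfreq : ∃ᶠ w in 𝓝 w₀, f w ≠ f w₀ := by
    have hev : ∀ᶠ w in 𝓝[≠] w₀, f w ≠ f w₀ := by
      filter_upwards [self_mem_nhdsWithin,
        mem_nhdsWithin_of_mem_nhds (closedBall_mem_nhds w₀ hr0)] with w hw hwb heq
      have h1 := hlow w hwb
      rw [heq, sub_self, norm_zero] at h1
      have h2 : 0 < ‖w - w₀‖ := norm_pos_iff.2 (sub_ne_zero.2 hw)
      have h3 : 0 < κ * L ^ 2 / 4 * ‖w - w₀‖ := by positivity
      linarith
    exact hev.frequently.filter_mono nhdsWithin_le_nhds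
  have hsub := hdiff.diffContOnCl.ball_subset_image_closedBall hr0
    (ε := κ * L ^ 2 / 4 * r) (fun w hw => by
      have := hlow w (sphere_subset_closedBall hw)
      rwa [mem_sphere_iff_norm.1 hw] at this) hfreq
  have hzero : (0 : ℂ) ∈ ball (f w₀) (κ * L ^ 2 / 4 * r / 2) := by
    rw [mem_ball, dist_zero_left]
    refine hfw₀.trans_lt ?_
    have : κ * L ^ 2 / 4 * r / 2 = (K' + κ / 8) / L := by
      rw [hr, hC]; field_simp; norm_num
    rw [this]
    gcongr
    linarith
  obtain ⟨w, hw, hw0⟩ := hsub hzero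
  exact ⟨w, hw0, by rwa [mem_closedBall, dist_eq_norm] at hw⟩

end ExponentialSumZero

section LogMertensSum

open DirichletCharacter ArithmeticFunction

lemma exists_norm_mertensSum_sub_log_le {N : ℕ} [NeZero N] (ψ : DirichletCharacter ℂ N) :
    ∃ K : ℝ, 0 < K ∧ ∀ y : ℝ, 1 ≤ y → ‖mertensSum ψ y - poleOrder ψ * Real.log y‖ ≤ K := by
  obtain ⟨C, hC0, hC⟩ := exists_norm_mertensSum_sub_le ψ
  refine ⟨C + ‖regularLogDeriv ψ 1‖ + 17, by positivity, fun y hy => ?_⟩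
  have hl := Real.log_nonneg hy
  rcases le_or_gt (Real.exp 1) y with h | h
  · have h1 : 1 ≤ Real.log y := (Real.le_log_iff_exp_le (by linarith)).2 h
    have h2 : C / Real.log y ≤ C := div_le_self hC0.le h1
    have h3 := hC y h
    rw [← sub_sub] at h3
    have h4 := norm_le_norm_add_norm_sub' (mertensSum ψ y - poleOrder ψ * Real.log y)
      (regularLogDeriv ψ 1)
    linarith
  · have h1 : Real.log y ≤ 1 := (Real.log_le_iff_le_exp (by linarith)).2 h.le
    have h2 : ‖mertensSum ψ y‖ ≤ 16 := by
      refine (norm_mertensSum_le ψ hy).trans ?_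
      have : (1 + Real.log y) ^ 4 ≤ (1 + 1) ^ 4 := by gcongr
      linarith
    have h3 : ‖(poleOrder ψ : ℂ) * (Real.log y : ℂ)‖ ≤ 1 * 1 := by
      rw [norm_mul, Complex.norm_natCast, Complex.norm_real, Real.norm_of_nonneg hl]
      exact mul_le_mul (by exact_mod_cast poleOrder_le_one ψ) h1 hl zero_le_one
    have h4 := norm_sub_le (mertensSum ψ y) (poleOrder ψ * Real.log y)
    have h5 := norm_nonneg (regularLogDeriv ψ 1)
    linarith

/-- The sum of `Λ(n) ψ(n) log n / n` over `n ≤ t`. -/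
noncomputable def logMertensSum {N : ℕ} (ψ : DirichletCharacter ℂ N) (t : ℝ) : ℂ :=
  ∑ n ∈ Finset.Icc 1 ⌊t⌋₊, (vonMangoldt n : ℂ) * ψ n / n * (Real.log n : ℂ)

lemma norm_logMertensSum_natCast_sub_le {N : ℕ} [NeZero N] (ψ : DirichletCharacter ℂ N) {K : ℝ}
    (hK : ∀ y : ℝ, 1 ≤ y → ‖mertensSum ψ y - poleOrder ψ * Real.log y‖ ≤ K) {n : ℕ} (hn : 1 ≤ n) :
    ‖logMertensSum ψ n - poleOrder ψ / 2 * Real.log n ^ 2 -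
      (mertensSum ψ n - poleOrder ψ * Real.log n) * Real.log n‖ ≤ (K + 1) * Real.log n := by
  induction n, hn using Nat.le_induction with
  | base => simp [logMertensSum, mertensSum]
  | succ n hn ih =>
    have hn1 : (1 : ℝ) ≤ n := by exact_mod_cast hn
    have hU : logMertensSum ψ ((n + 1 : ℕ) : ℝ) = logMertensSum ψ n +
        (mertensSum ψ ((n + 1 : ℕ) : ℝ) - mertensSum ψ n) * Real.log ((n + 1 : ℕ) : ℝ) := by
      rw [logMertensSum, logMertensSum, mertensSum, mertensSum, Nat.floor_natCast,
        Nat.floor_natCast, Finset.sum_Icc_succ_top (by omega), Finset.sum_Icc_succ_top (by omega)]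
      ring
    have hlog0 : Real.log n ≤ Real.log ((n + 1 : ℕ) : ℝ) :=
      Real.log_le_log (by linarith) (by push_cast; linarith)
    have hlog1 : Real.log ((n + 1 : ℕ) : ℝ) - Real.log n ≤ 1 := by
      rw [← Real.log_div (by positivity) (by positivity)]
      refine (Real.log_le_sub_one_of_pos (by positivity)).trans ?_
      rw [tsub_le_iff_right, div_le_iff₀ (by linarith)]
      push_cast
      linarith
    set l := Real.log n
    set l' := Real.log ((n + 1 : ℕ) : ℝ)
    have hEn := hK n hn1
    have hκ : (poleOrder ψ : ℝ) ≤ 1 := by exact_mod_cast poleOrder_le_one ψ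
    have h1 : ‖((poleOrder ψ : ℂ) / 2 * ((l' - l : ℝ) : ℂ) -
        (mertensSum ψ n - poleOrder ψ * l)) * ((l' - l : ℝ) : ℂ)‖ ≤ (K + 1) * (l' - l) := by
      rw [norm_mul, Complex.norm_real, Real.norm_of_nonneg (by linarith)]
      refine mul_le_mul_of_nonneg_right ((norm_sub_le _ _).trans ?_) (by linarith)
      rw [norm_mul, norm_div, Complex.norm_natCast, Complex.norm_real,
        Real.norm_of_nonneg (by linarith), Complex.norm_ofNat]
      have : (poleOrder ψ : ℝ) / 2 * (l' - l) ≤ 1 := by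
        have h0 : (0 : ℝ) ≤ poleOrder ψ := Nat.cast_nonneg _
        nlinarith
      linarith
    rw [hU]
    have h2 : logMertensSum ψ n + (mertensSum ψ ((n + 1 : ℕ) : ℝ) - mertensSum ψ n) * l' -
        poleOrder ψ / 2 * (l' : ℂ) ^ 2 -
        (mertensSum ψ ((n + 1 : ℕ) : ℝ) - poleOrder ψ * l') * l' =
        (logMertensSum ψ n - poleOrder ψ / 2 * (l : ℂ) ^ 2 -
          (mertensSum ψ n - poleOrder ψ * l) * l) +
        ((poleOrder ψ : ℂ) / 2 * ((l' - l : ℝ) : ℂ) -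
        (mertensSum ψ n - poleOrder ψ * l)) * ((l' - l : ℝ) : ℂ) := by
      push_cast; ring
    rw [h2]
    refine (norm_add_le _ _).trans ((add_le_add ih h1).trans (le_of_eq ?_))
    ring

theorem exists_norm_logMertensSum_sub_le {N : ℕ} [NeZero N] (ψ : DirichletCharacter ℂ N) :
    ∃ K : ℝ, 0 < K ∧ ∀ y : ℝ, 1 ≤ y →
      ‖mertensSum ψ y - poleOrder ψ * Real.log y‖ ≤ K ∧
      ‖logMertensSum ψ y - poleOrder ψ / 2 * Real.log y ^ 2‖ ≤ K * Real.log y := by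
  obtain ⟨K, hK0, hK⟩ := exists_norm_mertensSum_sub_log_le ψ
  refine ⟨2 * K + 2, by positivity, fun y hy => ⟨(hK y hy).trans (by linarith), ?_⟩⟩
  set n := ⌊y⌋₊ with hn
  have hn1 : 1 ≤ n := Nat.le_floor (by simpa using hy)
  have hn1' : (1 : ℝ) ≤ n := by exact_mod_cast hn1
  have hU : logMertensSum ψ y = logMertensSum ψ n := by
    rw [logMertensSum, logMertensSum, Nat.floor_natCast]
  have hny : (n : ℝ) ≤ y := Nat.floor_le (by linarith)
  have hl0 : 0 ≤ Real.log n := Real.log_nonneg hn1'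
  have hl1 : Real.log n ≤ Real.log y := Real.log_le_log (by linarith) hny
  have hl2 : Real.log y - Real.log n ≤ 1 := by
    rw [← Real.log_div (by linarith) (by linarith)]
    refine (Real.log_le_sub_one_of_pos (by positivity)).trans ?_
    rw [tsub_le_iff_right, div_le_iff₀ (by linarith)]
    have := (Nat.lt_floor_add_one y).le
    rw [← hn] at this
    linarith
  have h1 := norm_logMertensSum_natCast_sub_le ψ hK hn1
  have h2 : ‖(mertensSum ψ n - poleOrder ψ * Real.log n) * Real.log n‖ ≤ K * Real.log n := by
    rw [norm_mul, Complex.norm_real, Real.norm_of_nonneg hl0]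
    exact mul_le_mul_of_nonneg_right (hK n hn1') hl0
  have h3 : ‖(poleOrder ψ : ℂ) / 2 * ((Real.log y ^ 2 - Real.log n ^ 2 : ℝ) : ℂ)‖ ≤
      1 / 2 * (2 * Real.log y) := by
    have h4 : 0 ≤ Real.log y ^ 2 - Real.log n ^ 2 := by nlinarith
    have h5 : Real.log y ^ 2 - Real.log n ^ 2 ≤ 2 * Real.log y := by nlinarith
    rw [norm_mul, norm_div, Complex.norm_natCast, Complex.norm_real, Real.norm_of_nonneg h4,
      Complex.norm_ofNat]
    have hκ : (poleOrder ψ : ℝ) ≤ 1 := by exact_mod_cast poleOrder_le_one ψ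
    gcongr
  have h4 : logMertensSum ψ y - poleOrder ψ / 2 * (Real.log y : ℂ) ^ 2 =
      (logMertensSum ψ n - poleOrder ψ / 2 * (Real.log n : ℂ) ^ 2 -
      (mertensSum ψ n - poleOrder ψ * Real.log n) * Real.log n) +
      (mertensSum ψ n - poleOrder ψ * Real.log n) * Real.log n -
      (poleOrder ψ : ℂ) / 2 * ((Real.log y ^ 2 - Real.log n ^ 2 : ℝ) : ℂ) := by
    rw [hU]; push_cast; ring
  rw [h4]
  refine (norm_sub_le _ _).trans ((add_le_add ((norm_add_le _ _).trans (add_le_add h1 h2))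
    h3).trans ?_)
  nlinarith

end LogMertensSum

section ComparisonSum

open DirichletCharacter ArithmeticFunction

variable {q : ℕ} (ψ : DirichletCharacter ℂ q)

/-- The function equal to `-ψ`, `1`, `-1`, `1` on the successive ranges cut out by
`y₁ ≤ y₂ ≤ y₃`. -/
noncomputable def comparison (y₁ y₂ y₃ : ℝ) (n : ℕ) : ℂ :=
  if (n : ℝ) ≤ y₁ then -ψ n else if (n : ℝ) ≤ y₂ then 1 else if (n : ℝ) ≤ y₃ then -1 else 1

lemma norm_comparison_le (y₁ y₂ y₃ : ℝ) (n : ℕ) : ‖comparison ψ y₁ y₂ y₃ n‖ ≤ 1 := by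
  unfold comparison
  split_ifs <;> simp [ψ.norm_le_one]

lemma sum_Icc_floor_ite (f : ℕ → ℂ) {y x : ℝ} (hy : 0 ≤ y) (hyx : y ≤ x) :
    ∑ n ∈ Finset.Icc 1 ⌊x⌋₊, (if (n : ℝ) ≤ y then f n else 0) = ∑ n ∈ Finset.Icc 1 ⌊y⌋₊, f n := by
  rw [← Finset.sum_filter]
  refine Finset.sum_congr ?_ fun _ _ => rfl
  ext n
  simp only [Finset.mem_filter, Finset.mem_Icc, Nat.le_floor_iff hy,
    Nat.le_floor_iff (hy.trans hyx)]
  constructor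
  · exact fun h => ⟨h.1.1, h.2⟩
  · exact fun h => ⟨⟨h.1, h.2.trans hyx⟩, h.2⟩

lemma sum_comparison (g : ℕ → ℂ) {y₁ y₂ y₃ x : ℝ} (h₀ : 0 ≤ y₁) (h₁ : y₁ ≤ y₂) (h₂ : y₂ ≤ y₃)
    (h₃ : y₃ ≤ x) :
    ∑ n ∈ Finset.Icc 1 ⌊x⌋₊, (vonMangoldt n : ℂ) * comparison ψ y₁ y₂ y₃ n / n * g n =
      -∑ n ∈ Finset.Icc 1 ⌊y₁⌋₊, (vonMangoldt n : ℂ) * ψ n / n * g n -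
      ∑ n ∈ Finset.Icc 1 ⌊y₁⌋₊,
        (vonMangoldt n : ℂ) * (1 : DirichletCharacter ℂ 1) n / n * g n +
      2 * ∑ n ∈ Finset.Icc 1 ⌊y₂⌋₊,
        (vonMangoldt n : ℂ) * (1 : DirichletCharacter ℂ 1) n / n * g n -
      2 * ∑ n ∈ Finset.Icc 1 ⌊y₃⌋₊,
        (vonMangoldt n : ℂ) * (1 : DirichletCharacter ℂ 1) n / n * g n +
      ∑ n ∈ Finset.Icc 1 ⌊x⌋₊,
        (vonMangoldt n : ℂ) * (1 : DirichletCharacter ℂ 1) n / n * g n := by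
  rw [← sum_Icc_floor_ite _ h₀ (h₁.trans (h₂.trans h₃)),
    ← sum_Icc_floor_ite (fun n => (vonMangoldt n : ℂ) * (1 : DirichletCharacter ℂ 1) n / n * g n)
      h₀ (h₁.trans (h₂.trans h₃)),
    ← sum_Icc_floor_ite _ (h₀.trans h₁) (h₂.trans h₃),
    ← sum_Icc_floor_ite _ (h₀.trans (h₁.trans h₂)) h₃, Finset.mul_sum, Finset.mul_sum,
    ← Finset.sum_neg_distrib, ← Finset.sum_sub_distrib, ← Finset.sum_add_distrib,
    ← Finset.sum_sub_distrib, ← Finset.sum_add_distrib]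
  refine Finset.sum_congr rfl fun n _ => ?_
  have hone : (1 : DirichletCharacter ℂ 1) (n : ZMod 1) = 1 := by
    rw [Subsingleton.elim (n : ZMod 1) 1, map_one]
  rw [hone, comparison]
  by_cases ha : (n : ℝ) ≤ y₁
  · have hb := ha.trans h₁
    have hc := hb.trans h₂
    simp only [ha, hb, hc, if_true]
    ring
  · by_cases hb : (n : ℝ) ≤ y₂
    · have hc := hb.trans h₂
      simp only [ha, hb, hc, if_true, if_false]
      ring
    · by_cases hc : (n : ℝ) ≤ y₃
      · simp only [ha, hb, hc, if_true, if_false]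
        ring
      · simp only [ha, hb, hc, if_false]
        ring

variable {ψ}

lemma exists_norm_sum_comparison_sub_le [NeZero q] (hψ : ψ ≠ 1) :
    ∃ K : ℝ, 0 < K ∧ ∀ y₁ y₂ y₃ x : ℝ, Real.exp 1 ≤ y₁ → y₁ ≤ y₂ → y₂ ≤ y₃ → y₃ ≤ x →
      ‖∑ n ∈ Finset.Icc 1 ⌊x⌋₊, (vonMangoldt n : ℂ) * comparison ψ y₁ y₂ y₃ n / n -
        ((-Real.log y₁ + 2 * Real.log y₂ - 2 * Real.log y₃ + Real.log x : ℝ) -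
          regularLogDeriv ψ 1)‖ ≤ K / Real.log y₁ ∧
      ‖∑ n ∈ Finset.Icc 1 ⌊x⌋₊, (vonMangoldt n : ℂ) * comparison ψ y₁ y₂ y₃ n / n * Real.log n -
        ((-Real.log y₁ ^ 2 + 2 * Real.log y₂ ^ 2 - 2 * Real.log y₃ ^ 2 + Real.log x ^ 2) / 2 : ℝ)‖
        ≤ K * Real.log x := by
  obtain ⟨A, hA0, hA⟩ := exists_norm_mertensSum_sub_le ψ
  obtain ⟨B, hB0, hB⟩ := exists_norm_mertensSum_sub_le (1 : DirichletCharacter ℂ 1)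
  obtain ⟨A', hA'0, hA'⟩ := exists_norm_logMertensSum_sub_le ψ
  obtain ⟨B', hB'0, hB'⟩ := exists_norm_logMertensSum_sub_le (1 : DirichletCharacter ℂ 1)
  have hp0 : poleOrder ψ = 0 := by simp [poleOrder, hψ]
  have hp1 : poleOrder (1 : DirichletCharacter ℂ 1) = 1 := by simp [poleOrder]
  rw [hp0] at hA hA'
  rw [hp1] at hB hB'
  simp only [Nat.cast_zero, Nat.cast_one, zero_mul, zero_add, one_mul, zero_div, sub_zero]
    at hA hB hA' hB'
  refine ⟨A + 6 * B + A' + 6 * B', by positivity, fun y₁ y₂ y₃ x h₀ h₁ h₂ h₃ => ?_⟩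
  have he : (1 : ℝ) ≤ Real.exp 1 := Real.one_le_exp zero_le_one
  have hy1 : 1 ≤ y₁ := he.trans h₀
  have hl1 : 1 ≤ Real.log y₁ := (Real.le_log_iff_exp_le (by linarith)).2 h₀
  have hl12 : Real.log y₁ ≤ Real.log y₂ := Real.log_le_log (by linarith) h₁
  have hl23 : Real.log y₂ ≤ Real.log y₃ := Real.log_le_log (by linarith) h₂
  have hl34 : Real.log y₃ ≤ Real.log x := Real.log_le_log (by linarith) h₃
  constructor
  · have hs := sum_comparison ψ (fun _ => 1) (by linarith) h₁ h₂ h₃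
    simp only [mul_one] at hs
    have e0 := hA y₁ h₀
    have hdiv : ∀ l : ℝ, Real.log y₁ ≤ l → B / l ≤ B / Real.log y₁ := fun l hl => by gcongr
    have e1 := hB y₁ h₀
    have e2 := (hB y₂ (h₀.trans h₁)).trans (hdiv _ hl12)
    have e3 := (hB y₃ (h₀.trans (h₁.trans h₂))).trans (hdiv _ (hl12.trans hl23))
    have e4 := (hB x (h₀.trans (h₁.trans (h₂.trans h₃)))).trans
      (hdiv _ (hl12.trans (hl23.trans hl34)))
    unfold mertensSum at e0 e1 e2 e3 e4
    rw [hs]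
    set F := ∑ n ∈ Finset.Icc 1 ⌊y₁⌋₊, (vonMangoldt n : ℂ) * ψ n / n
    set G₁ := ∑ n ∈ Finset.Icc 1 ⌊y₁⌋₊, (vonMangoldt n : ℂ) * (1 : DirichletCharacter ℂ 1) n / n
    set G₂ := ∑ n ∈ Finset.Icc 1 ⌊y₂⌋₊, (vonMangoldt n : ℂ) * (1 : DirichletCharacter ℂ 1) n / n
    set G₃ := ∑ n ∈ Finset.Icc 1 ⌊y₃⌋₊, (vonMangoldt n : ℂ) * (1 : DirichletCharacter ℂ 1) n / n
    set G₄ := ∑ n ∈ Finset.Icc 1 ⌊x⌋₊, (vonMangoldt n : ℂ) * (1 : DirichletCharacter ℂ 1) n / n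
    set c := regularLogDeriv ψ 1
    set d := regularLogDeriv (1 : DirichletCharacter ℂ 1) 1
    have hid : -F - G₁ + 2 * G₂ - 2 * G₃ + G₄ -
        ((-Real.log y₁ + 2 * Real.log y₂ - 2 * Real.log y₃ + Real.log x : ℝ) - c) =
        -(F - c) - (G₁ - (Real.log y₁ + d)) + 2 * (G₂ - (Real.log y₂ + d)) -
          2 * (G₃ - (Real.log y₃ + d)) + (G₄ - (Real.log x + d)) := by
      push_cast; ring
    rw [hid]
    have n1 := norm_add_le (-(F - c) - (G₁ - (Real.log y₁ + d)) + 2 * (G₂ - (Real.log y₂ + d)) -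
          2 * (G₃ - (Real.log y₃ + d))) (G₄ - (Real.log x + d))
    have n2 := norm_sub_le (-(F - c) - (G₁ - (Real.log y₁ + d)) + 2 * (G₂ - (Real.log y₂ + d)))
          (2 * (G₃ - (Real.log y₃ + d)))
    have n3 := norm_add_le (-(F - c) - (G₁ - (Real.log y₁ + d))) (2 * (G₂ - (Real.log y₂ + d)))
    have n4 := norm_sub_le (-(F - c)) (G₁ - (Real.log y₁ + d))
    rw [norm_neg] at n4
    rw [norm_mul, Complex.norm_ofNat] at n2 n3
    have hK : (A + 6 * B + A' + 6 * B') / Real.log y₁ = A / Real.log y₁ + 6 * (B / Real.log y₁) +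
        (A' + 6 * B') / Real.log y₁ := by ring
    have hpos : 0 ≤ (A' + 6 * B') / Real.log y₁ := by positivity
    linarith
  · have hs := sum_comparison ψ (fun n => (Real.log n : ℂ)) (by linarith) h₁ h₂ h₃
    have hmul : ∀ l : ℝ, l ≤ Real.log x → B' * l ≤ B' * Real.log x := fun l hl => by gcongr
    have e0 : ‖logMertensSum ψ y₁‖ ≤ A' * Real.log x := by
      refine (hA' y₁ hy1).2.trans ?_
      gcongr
      linarith
    have e1 := (hB' y₁ hy1).2.trans (hmul _ (by linarith))
    have e2 := (hB' y₂ (by linarith)).2.trans (hmul _ (by linarith))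
    have e3 := (hB' y₃ (by linarith)).2.trans (hmul _ (by linarith))
    have e4 := (hB' x (by linarith)).2
    unfold logMertensSum at e0 e1 e2 e3 e4
    rw [hs]
    set F := ∑ n ∈ Finset.Icc 1 ⌊y₁⌋₊, (vonMangoldt n : ℂ) * ψ n / n * (Real.log n : ℂ)
    set G₁ := ∑ n ∈ Finset.Icc 1 ⌊y₁⌋₊,
      (vonMangoldt n : ℂ) * (1 : DirichletCharacter ℂ 1) n / n * (Real.log n : ℂ)
    set G₂ := ∑ n ∈ Finset.Icc 1 ⌊y₂⌋₊,
      (vonMangoldt n : ℂ) * (1 : DirichletCharacter ℂ 1) n / n * (Real.log n : ℂ)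
    set G₃ := ∑ n ∈ Finset.Icc 1 ⌊y₃⌋₊,
      (vonMangoldt n : ℂ) * (1 : DirichletCharacter ℂ 1) n / n * (Real.log n : ℂ)
    set G₄ := ∑ n ∈ Finset.Icc 1 ⌊x⌋₊,
      (vonMangoldt n : ℂ) * (1 : DirichletCharacter ℂ 1) n / n * (Real.log n : ℂ)
    set l₁ := Real.log y₁
    set l₂ := Real.log y₂
    set l₃ := Real.log y₃
    set l₄ := Real.log x
    have hid : -F - G₁ + 2 * G₂ - 2 * G₃ + G₄ -
        ((-l₁ ^ 2 + 2 * l₂ ^ 2 - 2 * l₃ ^ 2 + l₄ ^ 2) / 2 : ℝ) =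
        -F - (G₁ - 1 / 2 * l₁ ^ 2) + 2 * (G₂ - 1 / 2 * l₂ ^ 2) -
          2 * (G₃ - 1 / 2 * l₃ ^ 2) + (G₄ - 1 / 2 * l₄ ^ 2) := by
      push_cast; ring
    rw [hid]
    have n1 := norm_add_le (-F - (G₁ - 1 / 2 * l₁ ^ 2) + 2 * (G₂ - 1 / 2 * l₂ ^ 2) -
          2 * (G₃ - 1 / 2 * l₃ ^ 2)) (G₄ - 1 / 2 * l₄ ^ 2)
    have n2 := norm_sub_le (-F - (G₁ - 1 / 2 * l₁ ^ 2) + 2 * (G₂ - 1 / 2 * l₂ ^ 2))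
          (2 * (G₃ - 1 / 2 * l₃ ^ 2))
    have n3 := norm_add_le (-F - (G₁ - 1 / 2 * l₁ ^ 2)) (2 * (G₂ - 1 / 2 * l₂ ^ 2))
    have n4 := norm_sub_le (-F) (G₁ - 1 / 2 * l₁ ^ 2)
    rw [norm_neg] at n4
    rw [norm_mul, Complex.norm_ofNat] at n2 n3
    have hpos : 0 ≤ (A + 6 * B) * l₄ := mul_nonneg (by positivity) (by linarith)
    linarith

end ComparisonSum

section Approximation

open DirichletCharacter ArithmeticFunction

variable {q : ℕ} {ψ : DirichletCharacter ℂ q}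

lemma norm_negTwist_le {n : ℕ} (hn : vonMangoldt n ≠ 0) : ‖negTwist ψ n‖ ≤ 1 := by
  obtain ⟨p, k, hp, rfl⟩ := exists_prime_pow_of_vonMangoldt_ne_zero hn
  rw [negTwist_prime_pow ψ hp, norm_pow]
  exact pow_le_one₀ (norm_nonneg _) (norm_neg_twist_le ψ p)

lemma exceptionalTerm_eq {n : ℕ} (h : ¬(n.Prime ∧ ¬n ∣ q)) :
    exceptionalTerm q n = vonMangoldt n * Real.log n / n := if_neg h

/-- If `b` has modulus at most one on prime powers, agrees with the comparison function at primes
not dividing `q`, and agrees with `negTwist ψ` on prime powers up to `y₁`, then the difference of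
their weighted sums converges to the corresponding full series. -/
lemma norm_sum_sub_comparison_sub_le [NeZero q] {b : ℕ → ℂ} {y₁ y₂ y₃ x : ℝ} (hy₁ : 1 < y₁)
    (hqy : (q : ℝ) < y₁) (hyx : y₁ ≤ x)
    (hb₁ : ∀ n : ℕ, (n : ℝ) ≤ x → vonMangoldt n ≠ 0 → ‖b n‖ ≤ 1)
    (hb₂ : ∀ n : ℕ, n.Prime → ¬n ∣ q → (n : ℝ) ≤ x → b n = comparison ψ y₁ y₂ y₃ n)
    (hb₃ : ∀ n : ℕ, (n : ℝ) ≤ y₁ → vonMangoldt n ≠ 0 → b n = negTwist ψ n) :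
    ‖∑ n ∈ Finset.Icc 1 ⌊x⌋₊, (vonMangoldt n : ℂ) * (b n - comparison ψ y₁ y₂ y₃ n) / n -
      ∑' n : ℕ, (vonMangoldt n : ℂ) * (negTwist ψ n + ψ n) / n‖ ≤
        4 / Real.log y₁ * ∑' n, exceptionalTerm q n := by
  have hL : 0 < Real.log y₁ := Real.log_pos hy₁
  have hS := (summable_vonMangoldt_mul_negTwist_add ψ).hasSum
  have hF : HasSum (fun n : ℕ => if n ∈ Finset.Icc 1 ⌊x⌋₊ then
      (vonMangoldt n : ℂ) * (b n - comparison ψ y₁ y₂ y₃ n) / n else 0)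
      (∑ n ∈ Finset.Icc 1 ⌊x⌋₊, (vonMangoldt n : ℂ) * (b n - comparison ψ y₁ y₂ y₃ n) / n) := by
    have := hasSum_sum_of_ne_finset_zero (s := Finset.Icc 1 ⌊x⌋₊) (L := .unconditional ℕ)
      (f := fun n : ℕ => if n ∈ Finset.Icc 1 ⌊x⌋₊ then
        (vonMangoldt n : ℂ) * (b n - comparison ψ y₁ y₂ y₃ n) / n else 0)
      (fun n hn => if_neg hn)
    rwa [Finset.sum_congr rfl fun n hn => if_pos hn] at this
  refine (hF.sub hS).norm_le_of_bounded ((summable_exceptionalTerm q).hasSum.mul_left _)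
    fun n => ?_
  have hE := exceptionalTerm_nonneg q n
  by_cases hΛ : vonMangoldt n = 0
  · simp only [hΛ, Complex.ofReal_zero, zero_mul, zero_div, ite_self, sub_zero, norm_zero]
    positivity
  have hn0 : 0 < n := Nat.pos_of_ne_zero fun h => hΛ (by simp [h])
  rcases le_or_gt (n : ℝ) y₁ with hny | hny
  · have hmem : n ∈ Finset.Icc 1 ⌊x⌋₊ :=
      Finset.mem_Icc.2 ⟨hn0, Nat.le_floor (hny.trans hyx)⟩
    rw [if_pos hmem, hb₃ n hny hΛ]
    simp only [comparison, if_pos hny, sub_neg_eq_add, sub_self, norm_zero]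
    positivity
  have hdvd : ¬n ∣ q := fun h => by
    have : (n : ℝ) ≤ q := by exact_mod_cast Nat.le_of_dvd (Nat.pos_of_ne_zero (NeZero.ne q)) h
    linarith
  by_cases hp : n.Prime
  · have h1 : negTwist ψ n + ψ n = 0 := by rw [negTwist_prime ψ hp, if_neg hdvd]; ring
    have h2 : (if n ∈ Finset.Icc 1 ⌊x⌋₊ then
        (vonMangoldt n : ℂ) * (b n - comparison ψ y₁ y₂ y₃ n) / n else 0) = 0 := by
      split_ifs with hmem
      · rw [hb₂ n hp hdvd ((Nat.le_floor_iff (by linarith)).1 (Finset.mem_Icc.1 hmem).2)]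
        simp
      · rfl
    rw [h1, h2]
    simp only [mul_zero, zero_div, sub_zero, norm_zero]
    positivity
  · rw [exceptionalTerm_eq fun h => hp h.1]
    have hΛ0 : 0 ≤ vonMangoldt n := vonMangoldt_nonneg
    have hnR : (0 : ℝ) < n := by exact_mod_cast hn0
    have hnorm : ∀ z : ℂ, ‖z‖ ≤ 2 → ‖(vonMangoldt n : ℂ) * z / n‖ ≤ 2 * (vonMangoldt n / n) := by
      intro z hz
      rw [norm_div, norm_mul, Complex.norm_real, Complex.norm_natCast, Real.norm_of_nonneg hΛ0,
        mul_div_right_comm, mul_comm]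
      exact mul_le_mul_of_nonneg_right hz (by positivity)
    have h1 : ‖(vonMangoldt n : ℂ) * (negTwist ψ n + ψ n) / n‖ ≤ 2 * (vonMangoldt n / n) :=
      hnorm _ ((norm_add_le _ _).trans (by linarith [norm_negTwist_le (ψ := ψ) hΛ, ψ.norm_le_one n]))
    have h2 : ‖(if n ∈ Finset.Icc 1 ⌊x⌋₊ then
        (vonMangoldt n : ℂ) * (b n - comparison ψ y₁ y₂ y₃ n) / n else 0)‖ ≤
          2 * (vonMangoldt n / n) := by
      split_ifs with hmem
      · have hnx := (Nat.le_floor_iff (by linarith)).1 (Finset.mem_Icc.1 hmem).2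
        exact hnorm _ ((norm_sub_le _ _).trans
          (by linarith [hb₁ n hnx hΛ, norm_comparison_le ψ y₁ y₂ y₃ n]))
      · rw [norm_zero]
        positivity
    refine (norm_sub_le _ _).trans ((add_le_add h2 h1).trans ?_)
    have h3 : Real.log y₁ ≤ Real.log n := Real.log_le_log (by linarith) hny.le
    rw [div_mul_eq_mul_div, le_div_iff₀ hL]
    calc _ = 4 * (vonMangoldt n / n) * Real.log y₁ := by ring
      _ ≤ 4 * (vonMangoldt n / n) * Real.log n := mul_le_mul_of_nonneg_left h3 (by positivity)
      _ = _ := by ring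

lemma norm_sum_sub_comparison_mul_log_le [NeZero q] {b : ℕ → ℂ} {y₁ y₂ y₃ x : ℝ} (hx : 0 ≤ x)
    (hb₁ : ∀ n : ℕ, (n : ℝ) ≤ x → vonMangoldt n ≠ 0 → ‖b n‖ ≤ 1)
    (hb₂ : ∀ n : ℕ, n.Prime → ¬n ∣ q → (n : ℝ) ≤ x → b n = comparison ψ y₁ y₂ y₃ n) :
    ‖∑ n ∈ Finset.Icc 1 ⌊x⌋₊,
      (vonMangoldt n : ℂ) * (b n - comparison ψ y₁ y₂ y₃ n) / n * Real.log n‖ ≤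
        2 * ∑' n, exceptionalTerm q n := by
  have hle : ∑ n ∈ Finset.Icc 1 ⌊x⌋₊, 2 * exceptionalTerm q n ≤ 2 * ∑' n, exceptionalTerm q n := by
    rw [← Finset.mul_sum]
    exact mul_le_mul_of_nonneg_left ((summable_exceptionalTerm q).sum_le_tsum _
      fun n _ => exceptionalTerm_nonneg q n) zero_le_two
  refine (norm_sum_le_of_le _ fun n hn => ?_).trans hle
  have hnx := (Nat.le_floor_iff hx).1 (Finset.mem_Icc.1 hn).2
  have hE := exceptionalTerm_nonneg q n
  by_cases hΛ : vonMangoldt n = 0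
  · simp [hΛ, hE]
  by_cases h : n.Prime ∧ ¬n ∣ q
  · rw [hb₂ n h.1 h.2 hnx]
    simp [hE]
  · rw [exceptionalTerm_eq h, norm_mul, norm_div, norm_mul, Complex.norm_real, Complex.norm_real,
      Complex.norm_natCast, Real.norm_of_nonneg vonMangoldt_nonneg,
      Real.norm_of_nonneg (Real.log_natCast_nonneg n)]
    have h1 : ‖b n - comparison ψ y₁ y₂ y₃ n‖ ≤ 2 := (norm_sub_le _ _).trans
      (by linarith [hb₁ n hnx hΛ, norm_comparison_le ψ y₁ y₂ y₃ n])
    have h2 : 0 ≤ vonMangoldt n * Real.log n / n :=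
      div_nonneg (mul_nonneg vonMangoldt_nonneg (Real.log_natCast_nonneg n)) (Nat.cast_nonneg n)
    calc _ = ‖b n - comparison ψ y₁ y₂ y₃ n‖ * (vonMangoldt n * Real.log n / n) := by ring
      _ ≤ _ := mul_le_mul_of_nonneg_right h1 h2

/-- The Chebyshev-type bound for the total mass of the coefficients. -/
lemma exists_sum_vonMangoldt_div_le :
    ∃ K > 0, ∀ x : ℝ, 1 ≤ x →
      ∑ n ∈ Finset.Icc 1 ⌊x⌋₊, vonMangoldt n / n ≤ Real.log x + K := by
  obtain ⟨K, hK, h⟩ := exists_norm_mertensSum_sub_log_le (1 : DirichletCharacter ℂ 1)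
  refine ⟨K, hK, fun x hx => ?_⟩
  have h1 : mertensSum (1 : DirichletCharacter ℂ 1) x =
      ((∑ n ∈ Finset.Icc 1 ⌊x⌋₊, vonMangoldt n / n : ℝ) : ℂ) := by
    rw [mertensSum, Complex.ofReal_sum]
    refine Finset.sum_congr rfl fun n _ => ?_
    rw [Subsingleton.elim (n : ZMod 1) 1, map_one]
    push_cast
    ring
  have h2 := h x hx
  rw [h1, poleOrder, if_pos rfl, Nat.cast_one, one_mul, ← Complex.ofReal_sub,
    Complex.norm_real] at h2
  linarith [le_of_abs_le h2]

end Approximation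

section FullSums

open DirichletCharacter ArithmeticFunction

lemma map_pow_of_map_mul {b : ℕ → ℂ} (h₁ : b 1 = 1) (hmul : ∀ k n : ℕ, b (k * n) = b k * b n)
    (p k : ℕ) : b (p ^ k) = b p ^ k := by
  induction k with
  | zero => simpa using h₁
  | succ k ih => rw [pow_succ, hmul, ih, pow_succ]

lemma exists_norm_sum_sub_le {q : ℕ} [NeZero q] {ψ : DirichletCharacter ℂ q} (hψ : ψ ≠ 1) :
    ∃ K > 0, ∀ (b : ℕ → ℂ) (y₁ y₂ y₃ x : ℝ), Real.exp 1 ≤ y₁ → (q : ℝ) < y₁ → y₁ ≤ y₂ → y₂ ≤ y₃ →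
      y₃ ≤ x → (∀ n : ℕ, (n : ℝ) ≤ x → vonMangoldt n ≠ 0 → ‖b n‖ ≤ 1) →
      (∀ n : ℕ, n.Prime → ¬n ∣ q → (n : ℝ) ≤ x → b n = comparison ψ y₁ y₂ y₃ n) →
      (∀ n : ℕ, (n : ℝ) ≤ y₁ → vonMangoldt n ≠ 0 → b n = negTwist ψ n) →
      ‖∑ n ∈ Finset.Icc 1 ⌊x⌋₊, (vonMangoldt n : ℂ) * b n / n -
        ((-Real.log y₁ + 2 * Real.log y₂ - 2 * Real.log y₃ + Real.log x : ℝ) +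
          (deriv (LFunction ψ) 1 / LFunction ψ 1 +
            ∑' n : ℕ, (vonMangoldt n : ℂ) * (negTwist ψ n + ψ n) / n))‖ ≤ K / Real.log y₁ ∧
      ‖∑ n ∈ Finset.Icc 1 ⌊x⌋₊, (vonMangoldt n : ℂ) * b n / n * Real.log n -
        ((-Real.log y₁ ^ 2 + 2 * Real.log y₂ ^ 2 - 2 * Real.log y₃ ^ 2 + Real.log x ^ 2) / 2 : ℝ)‖ ≤
          K * Real.log x := by
  obtain ⟨K, hK, h⟩ := exists_norm_sum_comparison_sub_le hψ
  set W : ℝ := ∑' n, exceptionalTerm q n with hW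
  have hW0 : 0 ≤ W := tsum_nonneg (exceptionalTerm_nonneg q)
  refine ⟨K + 4 * W, by positivity, fun b y₁ y₂ y₃ x h₁ hq h₁₂ h₂₃ h₃ hb₁ hb₂ hb₃ => ?_⟩
  have he : (1 : ℝ) < Real.exp 1 := Real.one_lt_exp_iff.2 one_pos
  have hy₁ : 1 < y₁ := he.trans_le h₁
  have hyx : y₁ ≤ x := h₁₂.trans (h₂₃.trans h₃)
  have hlogx : 1 ≤ Real.log x := by
    rw [Real.le_log_iff_exp_le (by linarith)]
    exact h₁.trans hyx
  obtain ⟨hc₁, hc₂⟩ := h y₁ y₂ y₃ x h₁ h₁₂ h₂₃ h₃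
  have hd₁ := norm_sum_sub_comparison_sub_le hy₁ hq hyx hb₁ hb₂ hb₃
  have hd₂ := norm_sum_sub_comparison_mul_log_le (by linarith) hb₁ hb₂
  rw [← hW] at hd₁ hd₂
  have hsplit : ∀ n : ℕ, (vonMangoldt n : ℂ) * (b n - comparison ψ y₁ y₂ y₃ n) / n =
      (vonMangoldt n : ℂ) * b n / n - (vonMangoldt n : ℂ) * comparison ψ y₁ y₂ y₃ n / n :=
    fun n => by ring
  simp only [hsplit, sub_mul, Finset.sum_sub_distrib] at hd₁ hd₂
  rw [regularLogDeriv_one ψ hψ] at hc₁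
  constructor
  · calc _ = _ := by
          congr 1
          ring
      _ ≤ _ := norm_add_le_of_le hd₁ hc₁
      _ = _ := by ring
  · calc _ = _ := by
          congr 1
          ring
      _ ≤ _ := norm_add_le_of_le hd₂ hc₂
      _ ≤ _ := by nlinarith

end FullSums

section Coefficients

open DirichletCharacter ArithmeticFunction

lemma ne_one_of_isPrimitive {q : ℕ} [NeZero q] (hq : 2 < q) {χ : DirichletCharacter ℂ q}
    (hχ : χ.IsPrimitive) : χ ≠ 1 := by
  rintro rfl
  have h := (DirichletCharacter.isPrimitive_def _).1 hχ
  rw [DirichletCharacter.conductor_one] at h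
  omega

/-- The values of a completely multiplicative function on prime powers up to `x`, in terms of
prescribed values at the primes in the ranges cut out by `y₁`, `y₂`, `y₃` and `x`. -/
lemma values_of_map_mul {q : ℕ} {ψ : DirichletCharacter ℂ q} {b : ℕ → ℂ} {y₁ y₂ y₃ x : ℝ}
    (h₁ : b 1 = 1) (hmul : ∀ k n : ℕ, b (k * n) = b k * b n)
    (hb : ∀ p : ℕ, p.Prime →
      (p ∣ q → b p = -1) ∧
      ((p : ℝ) ≤ y₁ → ¬p ∣ q → b p = -ψ (p : ZMod q)) ∧
      (y₁ < (p : ℝ) → (p : ℝ) ≤ y₂ → b p = 1) ∧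
      (y₂ < (p : ℝ) → (p : ℝ) ≤ y₃ → b p = -1) ∧
      (y₃ < (p : ℝ) → (p : ℝ) ≤ x → b p = 1)) :
    (∀ n : ℕ, (n : ℝ) ≤ x → vonMangoldt n ≠ 0 → ‖b n‖ ≤ 1) ∧
    (∀ n : ℕ, n.Prime → ¬n ∣ q → (n : ℝ) ≤ x → b n = comparison ψ y₁ y₂ y₃ n) ∧
    (∀ n : ℕ, (n : ℝ) ≤ y₁ → vonMangoldt n ≠ 0 → b n = negTwist ψ n) := by
  have hprime : ∀ n : ℕ, n.Prime → ¬n ∣ q → (n : ℝ) ≤ x → b n = comparison ψ y₁ y₂ y₃ n := by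
    intro n hn hd hx
    obtain ⟨-, hb₁, hb₂, hb₃, hb₄⟩ := hb n hn
    unfold comparison
    split_ifs with i₁ i₂ i₃
    · exact hb₁ i₁ hd
    · exact hb₂ (not_le.1 i₁) i₂
    · exact hb₃ (not_le.1 i₂) i₃
    · exact hb₄ (not_le.1 i₃) hx
  have hle : ∀ {p : ℕ} (k : ℕ), p.Prime → (p : ℝ) ≤ (p ^ (k + 1) : ℕ) := fun k _ => by
    exact_mod_cast Nat.le_self_pow k.succ_ne_zero _
  refine ⟨fun n hx hΛ => ?_, hprime, fun n hy hΛ => ?_⟩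
  · obtain ⟨p, k, hp, rfl⟩ := exists_prime_pow_of_vonMangoldt_ne_zero hΛ
    rw [map_pow_of_map_mul h₁ hmul, norm_pow]
    refine pow_le_one₀ (norm_nonneg _) ?_
    by_cases hd : p ∣ q
    · simp [(hb p hp).1 hd]
    · rw [hprime p hp hd ((hle k hp).trans hx)]
      exact norm_comparison_le ψ y₁ y₂ y₃ p
  · obtain ⟨p, k, hp, rfl⟩ := exists_prime_pow_of_vonMangoldt_ne_zero hΛ
    rw [map_pow_of_map_mul h₁ hmul, negTwist_prime_pow ψ hp]
    congr 1
    split_ifs with hd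
    · exact (hb p hp).1 hd
    · exact (hb p hp).2.1 ((hle k hp).trans hy) hd

end Coefficients

open Complex DirichletCharacter Finset

/-- Lemma 6, second part: for all sufficiently large `x` (with `x^ε > q` and
`log x > 2 log m/(1−ε)`), the function `Z_x(s) = ∑_{n ≤ x} Λ(n) b'(n)/n^s` has a zero `s` with
`Re s > 1`, located at `1 + 2(S₂ + 2 log m)/((−2δ²+1+ε²)(log x)²) + O(1/(log x)³)`. -/
theorem Z_x_has_zero (q : ℕ) [NeZero q] (hq : 2 < q)
    (χ : DirichletCharacter ℂ q) (hχ : χ.IsPrimitive)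
    (χbar : DirichletCharacter ℂ q) (hχbar : ∀ a : ZMod q, χbar a = starRingEnd ℂ (χ a))
    (δ : ℝ) (hδ : 1 / 2 < δ) (hδ' : δ < 1) (ε : ℝ) (hε : ε = 2 * δ - 1)
    (S₂ : ℂ) (hS₂ : S₂ = deriv (LFunction χbar) 1 / LFunction χbar 1 +
      2 * (∑' p : Nat.Primes, χbar ((p : ℕ) : ZMod q) ^ 2 * (Real.log (p : ℕ) : ℂ) /
        (((p : ℕ) : ℂ) ^ 2 - χbar ((p : ℕ) : ZMod q) ^ 2)) -
      ((∑ p ∈ q.primeFactors, Real.log p / ((p : ℝ) + 1) : ℝ) : ℂ))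
    (m : ℝ) (hm1 : 1 < m) (hm : 4 * Real.log m = -S₂.re + 4 * ‖S₂‖ + 1) :
    ∃ C : ℝ, 0 < C ∧ ∃ x₀ : ℝ,
      ∀ x : ℝ, x₀ ≤ x → (q : ℝ) < x ^ ε → 2 * Real.log m / (1 - ε) < Real.log x →
        ∀ b' : ℕ → ℂ, b' 1 = 1 → (∀ k n : ℕ, b' (k * n) = b' k * b' n) →
          (∀ p : ℕ, p.Prime →
            (p ∣ q → b' p = -1) ∧
            ((p : ℝ) ≤ x ^ ε → ¬p ∣ q → b' p = -χbar (p : ZMod q)) ∧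
            (x ^ ε < (p : ℝ) → (p : ℝ) ≤ m * x ^ ε → b' p = 1) ∧
            (m * x ^ ε < (p : ℝ) → (p : ℝ) ≤ x ^ δ → b' p = -1) ∧
            (x ^ δ < (p : ℝ) → (p : ℝ) ≤ x → b' p = 1)) →
          ∃ s : ℂ,
            (∑ n ∈ Finset.Icc 1 ⌊x⌋₊,
              (ArithmeticFunction.vonMangoldt n : ℂ) * b' n / (n : ℂ) ^ s) = 0 ∧
            1 < s.re ∧
            ‖s - (1 + 2 * (S₂ + 2 * (Real.log m : ℂ)) /
                (((-2 * δ ^ 2 + 1 + ε ^ 2) * Real.log x ^ 2 : ℝ) : ℂ))‖ ≤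
              C / Real.log x ^ 3 := by
  have hχbar1 : χbar ≠ 1 := by
    rintro rfl
    refine ne_one_of_isPrimitive hq hχ (MulChar.ext fun a => ?_)
    have h := congrArg (starRingEnd ℂ) (hχbar a)
    rw [starRingEnd_self_apply, MulChar.one_apply_coe, map_one] at h
    rw [MulChar.one_apply_coe, ← h]
  obtain ⟨K₁, hK₁, hsum⟩ := exists_sum_vonMangoldt_div_le
  obtain ⟨K₂, hK₂, hmain⟩ := exists_norm_sum_sub_le hχbar1
  have hε0 : 0 < ε := by linarith
  have hε1 : ε < 1 := by linarith
  set κ : ℝ := -2 * δ ^ 2 + 1 + ε ^ 2 with hκ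
  have hκ0 : 0 < κ := by
    have : κ = 2 * (1 - δ) ^ 2 := by rw [hκ, hε]; ring
    rw [this]
    have : 0 < 1 - δ := by linarith
    positivity
  set ℓ : ℝ := Real.log m with hℓ
  have hℓ0 : 0 < ℓ := Real.log_pos hm1
  set S : ℂ := S₂ + 2 * (ℓ : ℂ) with hS
  have hSre : 0 < S.re := by
    have h1 : S.re = S₂.re + 2 * ℓ := by simp [hS]
    linarith [neg_abs_le S₂.re, Complex.abs_re_le_norm S₂, norm_nonneg S₂]
  set K : ℝ := 1 + K₁ + K₂ / ε + K₂ + 2 * ℓ + ℓ ^ 2 with hK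
  have hK0 : 0 < K := by positivity
  obtain ⟨C, L₀, hC, hzero⟩ := exists_zero_expSum hK0 hκ0 S
  refine ⟨C, hC, Real.exp (max L₀ (max (1 / ε) (C * κ / (2 * S.re) + 1))), ?_⟩
  intro x hx hqx hmx b' hb1 hbmul hb
  have hx0 : 0 < x := (Real.exp_pos _).trans_le hx
  set L : ℝ := Real.log x with hL
  have hLmax : max L₀ (max (1 / ε) (C * κ / (2 * S.re) + 1)) ≤ L :=
    (Real.le_log_iff_exp_le hx0).2 hx
  obtain ⟨hL₀, hLε, hLC⟩ : L₀ ≤ L ∧ 1 / ε ≤ L ∧ C * κ / (2 * S.re) + 1 ≤ L := by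
    simpa only [max_le_iff] using hLmax
  have hεL : 1 ≤ ε * L := by
    rw [div_le_iff₀ hε0] at hLε
    linarith
  have hL1 : 1 ≤ L := by
    have : 0 < C * κ / (2 * S.re) := by positivity
    linarith
  have hx1 : 1 ≤ x := by
    by_contra h
    linarith [Real.log_nonpos hx0.le (not_le.1 h).le]
  have hm0 : 0 < m := by linarith
  have hy₁0 : 0 < x ^ ε := Real.rpow_pos_of_pos hx0 ε
  have hlog₁ : Real.log (x ^ ε) = ε * L := Real.log_rpow hx0 ε
  have hlog₂ : Real.log (m * x ^ ε) = ℓ + ε * L := by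
    rw [Real.log_mul hm0.ne' hy₁0.ne', hlog₁]
  have hlog₃ : Real.log (x ^ δ) = δ * L := Real.log_rpow hx0 δ
  have hy₁ : Real.exp 1 ≤ x ^ ε := by
    rw [← Real.le_log_iff_exp_le hy₁0, hlog₁]
    exact hεL
  have h₁₂ : x ^ ε ≤ m * x ^ ε := le_mul_of_one_le_left hy₁0.le hm1.le
  have h₂₃ : m * x ^ ε ≤ x ^ δ := by
    rw [← Real.log_le_log_iff (by positivity) (Real.rpow_pos_of_pos hx0 δ), hlog₂, hlog₃]
    rw [div_lt_iff₀ (by linarith)] at hmx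
    rw [hε] at hmx ⊢
    linarith
  have h₃ : x ^ δ ≤ x := by
    simpa using Real.rpow_le_rpow_of_exponent_le hx1 hδ'.le
  obtain ⟨hv₁, hv₂, hv₃⟩ := values_of_map_mul hb1 hbmul hb
  obtain ⟨hM₁, hM₂⟩ := hmain b' _ _ _ x hy₁ hqx h₁₂ h₂₃ h₃ hv₁ hv₂ hv₃
  rw [tsum_vonMangoldt_mul_negTwist_add, ← Complex.ofReal_sum, ← add_sub_assoc, ← hS₂, hlog₁,
    hlog₂, hlog₃] at hM₁
  rw [hlog₁, hlog₂, hlog₃] at hM₂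
  have hlog_le : ∀ n ∈ Finset.Icc 1 ⌊x⌋₊, 0 ≤ Real.log n ∧ Real.log n ≤ L := by
    intro n hn
    obtain ⟨hn1, hnx⟩ := Finset.mem_Icc.1 hn
    have hnx' : (n : ℝ) ≤ x := (Nat.le_floor_iff hx0.le).1 hnx
    have hn1' : (1 : ℝ) ≤ n := by exact_mod_cast hn1
    exact ⟨Real.log_nonneg hn1', Real.log_le_log (by linarith) hnx'⟩
  have hmass : ∑ n ∈ Finset.Icc 1 ⌊x⌋₊,
      ‖(ArithmeticFunction.vonMangoldt n : ℂ) * b' n / n‖ ≤ K * L := by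
    refine (Finset.sum_le_sum fun n hn => ?_).trans ((hsum x hx1).trans ?_)
    · have hnx : (n : ℝ) ≤ x := (Nat.le_floor_iff hx0.le).1 (Finset.mem_Icc.1 hn).2
      have hΛ0 : 0 ≤ ArithmeticFunction.vonMangoldt n := ArithmeticFunction.vonMangoldt_nonneg
      by_cases hΛ : ArithmeticFunction.vonMangoldt n = 0
      · simp [hΛ]
      · rw [norm_div, norm_mul, Complex.norm_real, Complex.norm_natCast, Real.norm_of_nonneg hΛ0]
        exact div_le_div_of_nonneg_right (mul_le_of_le_one_right hΛ0 (hv₁ n hnx hΛ))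
          (Nat.cast_nonneg n)
    · have h1 : 1 + K₁ ≤ K := by
        have : 0 ≤ K₂ / ε + K₂ + 2 * ℓ + ℓ ^ 2 := by positivity
        linarith
      calc L + K₁ ≤ (1 + K₁) * L := by nlinarith
        _ ≤ K * L := mul_le_mul_of_nonneg_right h1 (by linarith)
  have hconst : ‖∑ n ∈ Finset.Icc 1 ⌊x⌋₊, (ArithmeticFunction.vonMangoldt n : ℂ) * b' n / n - S‖ ≤
      K / L := by
    have h1 : (-(ε * L) + 2 * (ℓ + ε * L) - 2 * (δ * L) + L : ℝ) = 2 * ℓ := by rw [hε]; ring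
    have h2 : ((2 * ℓ : ℝ) : ℂ) + S₂ = S := by rw [hS]; push_cast; ring
    rw [h1, h2] at hM₁
    refine hM₁.trans ?_
    rw [← div_div]
    refine div_le_div_of_nonneg_right ?_ (by linarith)
    have : 0 ≤ 1 + K₁ + K₂ + 2 * ℓ + ℓ ^ 2 := by positivity
    linarith
  have hlin : ‖∑ n ∈ Finset.Icc 1 ⌊x⌋₊, (ArithmeticFunction.vonMangoldt n : ℂ) * b' n / n *
      Real.log n - (κ * L ^ 2 / 2 : ℝ)‖ ≤ K * L := by
    set q₀ : ℝ := 2 * ε * ℓ * L + ℓ ^ 2 with hq₀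
    have h1 : ((-(ε * L) ^ 2 + 2 * (ℓ + ε * L) ^ 2 - 2 * (δ * L) ^ 2 + L ^ 2) / 2 : ℝ) =
        κ * L ^ 2 / 2 + q₀ := by
      rw [hκ, hq₀]
      ring
    have h2 : ‖(q₀ : ℂ)‖ ≤ (2 * ℓ + ℓ ^ 2) * L := by
      rw [Complex.norm_real, Real.norm_of_nonneg (by positivity)]
      have ha : ε * (ℓ * L) ≤ 1 * (ℓ * L) := mul_le_mul_of_nonneg_right hε1.le (by positivity)
      have hb : ℓ ^ 2 * 1 ≤ ℓ ^ 2 * L := mul_le_mul_of_nonneg_left hL1 (by positivity)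
      rw [hq₀]
      linarith
    rw [h1, Complex.ofReal_add] at hM₂
    calc _ = ‖(∑ n ∈ Finset.Icc 1 ⌊x⌋₊, (ArithmeticFunction.vonMangoldt n : ℂ) * b' n / n *
            Real.log n - (((κ * L ^ 2 / 2 : ℝ) : ℂ) + q₀)) + q₀‖ := by
          congr 1
          ring
      _ ≤ K₂ * L + (2 * ℓ + ℓ ^ 2) * L := norm_add_le_of_le hM₂ h2
      _ = (K₂ + 2 * ℓ + ℓ ^ 2) * L := by ring
      _ ≤ K * L := by
          refine mul_le_mul_of_nonneg_right ?_ (by linarith)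
          have : 0 ≤ 1 + K₁ + K₂ / ε := by positivity
          linarith
  obtain ⟨w, hw, hwn⟩ := hzero L hL₀ _ (fun n => (ArithmeticFunction.vonMangoldt n : ℂ) * b' n / n)
    (fun n => Real.log n) hlog_le hmass hconst hlin
  refine ⟨1 + w, ?_, ?_, ?_⟩
  · rw [← hw]
    refine Finset.sum_congr rfl fun n hn => ?_
    have hn0 : (n : ℂ) ≠ 0 := by
      have := (Finset.mem_Icc.1 hn).1
      exact_mod_cast (by omega : n ≠ 0)
    rw [Complex.cpow_add _ _ hn0, Complex.cpow_one, Complex.cpow_def_of_ne_zero hn0,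
      ← Complex.natCast_log, neg_mul, Complex.exp_neg, mul_comm w, ← div_div, div_eq_mul_inv]
  · have h1 : (2 * S / (κ * L ^ 2 : ℝ)).re = 2 * S.re / (κ * L ^ 2) := by
      rw [Complex.div_ofReal_re]
      simp
    have h2 := (Complex.abs_re_le_norm _).trans hwn
    rw [Complex.sub_re, h1] at h2
    have h3 : C / L ^ 3 < 2 * S.re / (κ * L ^ 2) := by
      have h4 : C * κ < 2 * S.re * L := by
        have : C * κ / (2 * S.re) < L := by linarith
        rw [div_lt_iff₀ (by positivity)] at this
        linarith
      rw [div_lt_div_iff₀ (by positivity) (by positivity)]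
      calc C * (κ * L ^ 2) = C * κ * L ^ 2 := by ring
        _ < 2 * S.re * L * L ^ 2 := mul_lt_mul_of_pos_right h4 (by positivity)
        _ = _ := by ring
    have h5 := (abs_le.1 h2).1
    rw [Complex.add_re, Complex.one_re]
    linarith
  · rwa [add_sub_add_left_eq_sub]
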